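/- Let k ≥ l ≥ 1 be integers with k + l ≥ 6. Then the sequence n ↦ i(S_{k,l}, n) converges as n → ∞, and its limit equals ((2k+1)!/(2^{2k}(k!)²)) · max_{α ∈ [0,1]} [α(1−α)^{2k} + (1−α)α^{2k}] if k = l, and equals ((k+l+1)!/(k!·l!)) · max_{(α,d) ∈ [0,1/2] × [0,k/(k+l)]} [α(1−α)^{k+l} d^k (1−d)^l + ((k−1)^{k−1} l^l/(k+l−1)^{k+l−1}) (1−α) α^{k+l} (1−d)] if k > l. -/

import Mathlib

open scoped BigOperators

/-- The arc relation of the oriented star `S_{k,l}` on `Fin (k+l+1)`: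
vertex `0` is the center, vertices `1,…,k` are the out-leaves and
vertices `k+1,…,k+l` are the in-leaves. -/
def StarArc (k l : ℕ) (a b : Fin (k + l + 1)) : Prop :=
  (a.val = 0 ∧ 1 ≤ b.val ∧ b.val ≤ k) ∨ (b.val = 0 ∧ k + 1 ≤ a.val)

/-- `φ` witnesses an induced copy of `S_{k,l}` in the digraph with arc relation `A`:
it is injective and maps arcs to arcs and non-arcs to non-arcs. -/
def IsStarEmb (k l : ℕ) {V : Type*} (A : V → V → Prop) (φ : Fin (k + l + 1) → V) : Prop :=
  Function.Injective φ ∧ ∀ a b, StarArc k l a b ↔ A (φ a) (φ b)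

/-- `s(G)`: the probability that a uniformly random map `V(S_{k,l}) → V(G)`
induces a copy of `S_{k,l}`. -/
noncomputable def starProb (k l : ℕ) (V : Type*) [Fintype V] (A : V → V → Prop) : ℝ :=
  (Nat.card {φ : Fin (k + l + 1) → V // IsStarEmb k l A φ} : ℝ) /
    (Fintype.card V : ℝ) ^ (k + l + 1)

/-- The probability that a uniformly random map induces a copy of `S_{k,l}`
and moreover has property `P`. -/
noncomputable def starProbOn (k l : ℕ) {V : Type*} [Fintype V] (A : V → V → Prop)
    (P : (Fin (k + l + 1) → V) → Prop) : ℝ :=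
  (Nat.card {φ : Fin (k + l + 1) → V // IsStarEmb k l A φ ∧ P φ} : ℝ) /
    (Fintype.card V : ℝ) ^ (k + l + 1)

/-- `s(z→v) = Pr[φ ∈ 𝒮 | φ z = v]`. -/
noncomputable def sCond (k l : ℕ) {V : Type*} [Fintype V] (A : V → V → Prop)
    (z : Fin (k + l + 1)) (v : V) : ℝ :=
  (Nat.card {φ : Fin (k + l + 1) → V // IsStarEmb k l A φ ∧ φ z = v} : ℝ) /
    (Fintype.card V : ℝ) ^ (k + l)

/-- `Pr[φ ∈ 𝒮 ∧ P φ | φ(c) = v]`, where `c = 0` is the center of the star. -/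
noncomputable def sCondOn (k l : ℕ) {V : Type*} [Fintype V] (A : V → V → Prop) (v : V)
    (P : (Fin (k + l + 1) → V) → Prop) : ℝ :=
  (Nat.card {φ : Fin (k + l + 1) → V // IsStarEmb k l A φ ∧ φ 0 = v ∧ P φ} : ℝ) /
    (Fintype.card V : ℝ) ^ (k + l)

open scoped Fin.NatCast in
/-- `s(v) = (s(c→v) + l·s(i→v) + k·s(o→v))/(m+1)`, where the center is `0`,
`k+1` is an in-leaf and `1` is an out-leaf. -/
noncomputable def sVert (k l : ℕ) {V : Type*} [Fintype V] (A : V → V → Prop) (v : V) : ℝ :=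
  (sCond k l A 0 v + l * sCond k l A ((k + 1 : ℕ) : Fin (k + l + 1)) v
      + k * sCond k l A 1 v) / ((k : ℝ) + l + 1)

/-- `ρ(v)`: the proportion of vertices adjacent to `v`. -/
noncomputable def rho {V : Type*} [Fintype V] (A : V → V → Prop) (v : V) : ℝ :=
  (Nat.card {u : V // A v u ∨ A u v} : ℝ) / (Fintype.card V : ℝ)

/-- `ρ⁺_B(v)`: the proportion of vertices that are out-neighbours of `v` lying in `B`. -/
noncomputable def rhoPIn {V : Type*} [Fintype V] (A : V → V → Prop) (B : Set V) (v : V) : ℝ :=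
  (Nat.card {u : V // A v u ∧ u ∈ B} : ℝ) / (Fintype.card V : ℝ)

/-- `ρ⁻_B(v)`: the proportion of vertices that are in-neighbours of `v` lying in `B`. -/
noncomputable def rhoMIn {V : Type*} [Fintype V] (A : V → V → Prop) (B : Set V) (v : V) : ℝ :=
  (Nat.card {u : V // A u v ∧ u ∈ B} : ℝ) / (Fintype.card V : ℝ)

/-- `ρ_B(v)`: the proportion of vertices adjacent to `v` lying in `B`. -/
noncomputable def rhoIn {V : Type*} [Fintype V] (A : V → V → Prop) (B : Set V) (v : V) : ℝ :=
  (Nat.card {u : V // (A v u ∨ A u v) ∧ u ∈ B} : ℝ) / (Fintype.card V : ℝ)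

/-- `μ(B) = |B|/n`. -/
noncomputable def muSet {V : Type*} [Fintype V] (B : Set V) : ℝ :=
  (Nat.card B : ℝ) / (Fintype.card V : ℝ)

/-- `X`: the set of vertices of large degree, `ρ(v) ≥ 1/2`. -/
def bigX {V : Type*} [Fintype V] (A : V → V → Prop) : Set V := {v | 1 / 2 ≤ rho A v}

/-- `Y = V(G) \ X`. -/
def bigY {V : Type*} [Fintype V] (A : V → V → Prop) : Set V := (bigX A)ᶜ

/-- `α = μ(X)`. -/
noncomputable def alphaX {V : Type*} [Fintype V] (A : V → V → Prop) : ℝ := muSet (bigX A)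

/-- `D = min_{x ∈ X} ρ(x)`. -/
noncomputable def Dmin {V : Type*} [Fintype V] (A : V → V → Prop) : ℝ :=
  sInf (rho A '' bigX A)

/-- `β = max_{y ∈ Y} ρ_Y(y)`. -/
noncomputable def betaY {V : Type*} [Fintype V] (A : V → V → Prop) : ℝ :=
  sSup ((fun y => rhoIn A (bigY A) y) '' bigY A)

/-- `γ = min_{x ∈ X} ρ⁻_Y(x)`. -/
noncomputable def gammaX {V : Type*} [Fintype V] (A : V → V → Prop) : ℝ :=
  sInf ((fun x => rhoMIn A (bigY A) x) '' bigX A)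

/-- `S = (m+1)·min_{v ∈ V(G)} s(v)`. -/
noncomputable def Smin (k l : ℕ) {V : Type*} [Fintype V] (A : V → V → Prop) : ℝ :=
  ((k : ℝ) + l + 1) * sInf (Set.range (sVert k l A))

/-- `S₁ = min_{x ∈ X} (ρ⁺_Y(x))^k (ρ⁻_Y(x))^l`. -/
noncomputable def S1min (k l : ℕ) {V : Type*} [Fintype V] (A : V → V → Prop) : ℝ :=
  sInf ((fun x => rhoPIn A (bigY A) x ^ k * rhoMIn A (bigY A) x ^ l) '' bigX A)

/-- `S₂ = S₁ − ((m−1)/((m+1)·C(m,k)))·(α+β)(1−α)(1−D)^{m−2}`. -/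
noncomputable def S2min (k l : ℕ) {V : Type*} [Fintype V] (A : V → V → Prop) : ℝ :=
  S1min k l A - (((k : ℝ) + l - 1) / (((k : ℝ) + l + 1) * (Nat.choose (k + l) k : ℝ)))
    * (alphaX A + betaY A) * (1 - alphaX A) * (1 - Dmin A) ^ (k + l - 2)

/-- `λ₀ = k^k l^l / m^m`. -/
noncomputable def lam0 (k l : ℕ) : ℝ := (k : ℝ) ^ k * (l : ℝ) ^ l / ((k : ℝ) + l) ^ (k + l)

/-- `λ₁ = k^k l (l−1)^{l−1} / (m−1)^{m−1}` (with the convention `0⁰ = 1`). -/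
noncomputable def lam1 (k l : ℕ) : ℝ :=
  (k : ℝ) ^ k * (l : ℝ) * ((l : ℝ) - 1) ^ (l - 1) / ((k : ℝ) + l - 1) ^ (k + l - 1)

/-- The edge density `ρ(Z)` of a set of vertices `Z`: the number of unordered adjacent
pairs in `Z` divided by `C(|Z|,2)`. -/
noncomputable def densSet {V : Type*} [Fintype V] (A : V → V → Prop) (Z : Set V) : ℝ :=
  ((Nat.card {p : V × V // p.1 ∈ Z ∧ p.2 ∈ Z ∧ (A p.1 p.2 ∨ A p.2 p.1)} : ℝ) / 2) /
    (Nat.choose (Nat.card Z) 2 : ℝ)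

/-- `d = 1 − (E_{x ∈ X} ρ⁻_Y(x))/(1−α)`. -/
noncomputable def dXY {V : Type*} [Fintype V] (A : V → V → Prop) : ℝ :=
  1 - ((∑ᶠ x ∈ bigX A, rhoMIn A (bigY A) x) / (Nat.card (bigX A) : ℝ)) / (1 - alphaX A)

/-- `OPT(k,l)`. -/
noncomputable def OPT (k l : ℕ) : ℝ :=
  if k = l then
    (1 / 2 ^ (2 * k)) *
      sSup {y : ℝ | ∃ a ∈ Set.Icc (0 : ℝ) 1, y = a * (1 - a) ^ (2 * k) + (1 - a) * a ^ (2 * k)}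
  else
    sSup {y : ℝ | ∃ a ∈ Set.Icc (0 : ℝ) (1 / 2),
      ∃ d ∈ Set.Icc (0 : ℝ) ((k : ℝ) / ((k : ℝ) + (l : ℝ))),
      y = a * (1 - a) ^ (k + l) * d ^ k * (1 - d) ^ l
        + (((k : ℝ) - 1) ^ (k - 1) * (l : ℝ) ^ l / ((k : ℝ) + (l : ℝ) - 1) ^ (k + l - 1))
          * (1 - a) * a ^ (k + l) * (1 - d)}

/-- Induced density `i(S_{k,l}, G)`: the number of `(k+l+1)`-subsets of `V(G)` inducing a
copy of `S_{k,l}`, divided by `C(n, k+l+1)`. -/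
noncomputable def indDensity (k l : ℕ) {V : Type} [Fintype V] (A : V → V → Prop) : ℝ :=
  (Nat.card {W : Finset V // W.card = k + l + 1 ∧
      ∃ φ : Fin (k + l + 1) → V, (∀ a, φ a ∈ W) ∧ IsStarEmb k l A φ} : ℝ) /
    (Nat.choose (Fintype.card V) (k + l + 1) : ℝ)

/-- `i(S_{k,l}, n)`: the maximum of `i(S_{k,l}, G)` over all oriented graphs `G`
on `n` vertices. -/
noncomputable def indMax (k l n : ℕ) : ℝ :=
  sSup {x : ℝ | ∃ A : Fin n → Fin n → Prop, Irreflexive A ∧ (∀ u v, A u v → ¬ A v u) ∧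
    x = indDensity k l A}

namespace OStar
open Finset
open scoped Classical in
/-- measure of a predicate -/
noncomputable def mu {V : Type*} [Fintype V] (w : V → ℝ) (S : V → Prop) : ℝ :=
  ∑ v, if S v then w v else 0

open scoped Classical in
/-- weighted sum over leaf functions satisfying a predicate -/
noncomputable def Lf {V ι : Type*} [Fintype V] [Fintype ι] [DecidableEq ι] (w : V → ℝ) (R : (ι → V) → Prop) : ℝ :=
  ∑ f : ι → V, if R f then ∏ i, w (f i) else 0

section mu
variable {V : Type*} [Fintype V] {w : V → ℝ}

lemma mu_nonneg (hw : ∀ v, 0 ≤ w v) (S : V → Prop) : 0 ≤ mu w S := by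
  classical
  exact Finset.sum_nonneg fun v _ => by split_ifs <;> simp [hw]

lemma mu_mono (hw : ∀ v, 0 ≤ w v) {S S' : V → Prop} (h : ∀ v, S v → S' v) : mu w S ≤ mu w S' := by
  classical
  refine Finset.sum_le_sum fun v _ => ?_
  by_cases h1 : S v
  · simp [h1, h v h1]
  · simp only [h1, if_false]; split_ifs <;> simp [hw]

lemma mu_split (S R : V → Prop) :
    mu w S = mu w (fun v => S v ∧ R v) + mu w (fun v => S v ∧ ¬ R v) := by
  classical
  unfold mu
  rw [← Finset.sum_add_distrib]
  refine Finset.sum_congr rfl fun v _ => ?_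
  by_cases h1 : S v <;> by_cases h2 : R v <;> simp [h1, h2]

lemma mu_union (hw : ∀ v, 0 ≤ w v) {S R R' : V → Prop} (h : ∀ v, S v → R v ∨ R' v) :
    mu w S ≤ mu w R + mu w R' := by
  classical
  unfold mu
  rw [← Finset.sum_add_distrib]
  refine Finset.sum_le_sum fun v _ => ?_
  have := hw v
  by_cases h1 : S v
  · rcases h v h1 with h2 | h2
    · by_cases h3 : R' v <;> simp [h1, h2, h3, this]
    · by_cases h3 : R v <;> simp [h1, h2, h3, this]
  · by_cases h2 : R v <;> by_cases h3 : R' v <;> simp [h1, h2, h3, this]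

lemma mu_disj (hw : ∀ v, 0 ≤ w v) {S R R' : V → Prop} (h : ∀ v, R v → S v) (h' : ∀ v, R' v → S v)
    (hd : ∀ v, R v → ¬ R' v) :
    mu w R + mu w R' ≤ mu w S := by
  classical
  unfold mu
  rw [← Finset.sum_add_distrib]
  refine Finset.sum_le_sum fun v _ => ?_
  have := hw v
  by_cases h2 : R v
  · simp [h2, h v h2, hd v h2]
  · by_cases h3 : R' v
    · simp [h2, h3, h' v h3]
    · by_cases h1 : S v <;> simp [h1, h2, h3, this]

lemma mu_true : mu w (fun _ => True) = ∑ v, w v := by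
  classical
  simp [mu]

lemma mu_congr {S S' : V → Prop} (h : ∀ v, S v ↔ S' v) : mu w S = mu w S' := by
  have : S = S' := funext fun v => propext (h v)
  rw [this]

open scoped Classical in
/-- double counting -/
lemma sum_mu_swap (S : V → Prop) (R : V → V → Prop) (g : V → ℝ) :
    (∑ c, if S c then w c * (∑ x, if R c x then w x * g x else 0) else 0)
      = ∑ x, w x * (g x * mu w (fun c => S c ∧ R c x)) := by
  unfold mu
  have : ∀ c, (if S c then w c * (∑ x, if R c x then w x * g x else 0) else 0)
      = ∑ x, (w x * g x) * (if S c ∧ R c x then w c else 0) := by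
    intro c
    by_cases h : S c
    · simp only [h, if_true, true_and, Finset.mul_sum]
      refine Finset.sum_congr rfl fun x _ => ?_
      split_ifs <;> ring
    · simp [h]
  simp_rw [this]
  rw [Finset.sum_comm]
  refine Finset.sum_congr rfl fun x _ => ?_
  rw [← Finset.mul_sum]; ring

end mu

section Lf
variable {V ι : Type*} [Fintype V] [Fintype ι] [DecidableEq ι] {w : V → ℝ}

lemma Lf_nonneg (hw : ∀ v, 0 ≤ w v) (R : (ι → V) → Prop) : 0 ≤ Lf w R := by
  classical
  exact Finset.sum_nonneg fun v _ => by
    split_ifs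
    · exact Finset.prod_nonneg fun i _ => hw _
    · exact le_rfl

lemma Lf_mono (hw : ∀ v, 0 ≤ w v) {R R' : (ι → V) → Prop} (h : ∀ f, R f → R' f) :
    Lf w R ≤ Lf w R' := by
  classical
  refine Finset.sum_le_sum fun f _ => ?_
  have h0 : 0 ≤ ∏ i, w (f i) := Finset.prod_nonneg fun i _ => hw _
  by_cases h1 : R f
  · simp [h1, h f h1]
  · simp only [h1, if_false]; split_ifs <;> simp [h0]

lemma Lf_split (R Q : (ι → V) → Prop) :
    Lf w R = Lf w (fun f => R f ∧ Q f) + Lf w (fun f => R f ∧ ¬ Q f) := by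
  classical
  unfold Lf
  rw [← Finset.sum_add_distrib]
  refine Finset.sum_congr rfl fun v _ => ?_
  by_cases h1 : R v <;> by_cases h2 : Q v <;> simp [h1, h2]

lemma Lf_union (hw : ∀ v, 0 ≤ w v) {κ : Type*} (s : Finset κ) {R : (ι → V) → Prop}
    {R' : κ → (ι → V) → Prop} (h : ∀ f, R f → ∃ j ∈ s, R' j f) :
    Lf w R ≤ ∑ j ∈ s, Lf w (R' j) := by
  classical
  unfold Lf
  rw [Finset.sum_comm]
  refine Finset.sum_le_sum fun f _ => ?_
  have h0 : 0 ≤ ∏ i, w (f i) := Finset.prod_nonneg fun i _ => hw _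
  have hn : ∀ j ∈ s, 0 ≤ (if R' j f then ∏ i, w (f i) else 0) := fun j _ => by split_ifs <;> simp [h0]
  by_cases h1 : R f
  · obtain ⟨j, hj, hj'⟩ := h f h1
    have := Finset.single_le_sum (f := fun j => if R' j f then ∏ i, w (f i) else 0) hn hj
    simpa [h1, hj'] using this
  · simp only [h1, if_false]
    exact Finset.sum_nonneg hn

lemma sum_fun_prod (u : ι → V → ℝ) : ∑ f : ι → V, ∏ i, u i (f i) = ∏ i, ∑ v, u i v := by
  classical
  rw [Finset.prod_univ_sum, Fintype.piFinset_univ]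

lemma Lf_prod (hw : ∀ v, 0 ≤ w v) {R : (ι → V) → Prop} {S : ι → V → Prop}
    (h : ∀ f, R f → ∀ i, S i (f i)) : Lf w R ≤ ∏ i, mu w (S i) := by
  classical
  unfold mu Lf
  rw [← sum_fun_prod]
  refine Finset.sum_le_sum fun f _ => ?_
  by_cases h1 : R f
  · simp only [h1, if_true]
    refine le_of_eq (Finset.prod_congr rfl fun i _ => ?_)
    simp [h f h1 i]
  · simp only [h1, if_false]
    exact Finset.prod_nonneg fun i _ => by split_ifs <;> simp [hw]

open scoped Classical in
lemma Lf_one (hw : ∀ v, 0 ≤ w v) {R : (ι → V) → Prop} (j : ι) {S : V → Prop} [DecidablePred S]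
    {U : V → ι → V → Prop}
    (h : ∀ f, R f → S (f j) ∧ ∀ i, i ≠ j → U (f j) i (f i)) :
    Lf w R ≤ ∑ x, if S x then w x * ∏ i ∈ univ.erase j, mu w (U x i) else 0 := by
  set u : V → ι → V → ℝ := fun x i v => if i = j then (if v = x then w x else 0)
    else if U x i v then w v else 0 with hu
  have hu0 : ∀ x i v, 0 ≤ u x i v := by
    intro x i v; simp only [hu]; split_ifs <;> simp [hw]
  have key : Lf w R ≤ ∑ f : ι → V, ∑ x, if S x then ∏ i, u x i (f i) else 0 := by
    unfold Lf
    refine Finset.sum_le_sum fun f _ => ?_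
    have hn : ∀ x ∈ (univ : Finset V), 0 ≤ (if S x then ∏ i, u x i (f i) else 0) := fun x _ => by
      split_ifs
      · exact Finset.prod_nonneg fun i _ => hu0 _ _ _
      · exact le_rfl
    by_cases h1 : R f
    · obtain ⟨hS, hU⟩ := h f h1
      refine le_trans (le_of_eq ?_) (Finset.single_le_sum (f := fun x => if S x then ∏ i, u x i (f i) else 0) hn (Finset.mem_univ (f j)))
      simp only [h1, hS, if_true]
      refine Finset.prod_congr rfl fun i _ => ?_
      by_cases hij : i = j
      · simp [hu, hij]
      · simp [hu, hij, hU i hij]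
    · simp only [h1, if_false]
      exact Finset.sum_nonneg hn
  refine key.trans (le_of_eq ?_)
  rw [Finset.sum_comm]
  refine Finset.sum_congr rfl fun x _ => ?_
  by_cases hS : S x
  · simp only [hS, if_true]
    rw [sum_fun_prod (u x), ← Finset.mul_prod_erase univ _ (Finset.mem_univ j)]
    congr 1
    · simp [hu]
    · refine Finset.prod_congr rfl fun i hi => ?_
      have : i ≠ j := Finset.ne_of_mem_erase hi
      simp [hu, this, mu]
  · simp [hS]

open scoped Classical in
lemma Lf_two (hw : ∀ v, 0 ≤ w v) {R : (ι → V) → Prop} (a b : ι) (hab : a ≠ b)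
    {S : V → V → Prop} [∀ x y, Decidable (S x y)] {U : V → V → ι → V → Prop}
    (h : ∀ f, R f → S (f a) (f b) ∧ ∀ i, i ≠ a → i ≠ b → U (f a) (f b) i (f i)) :
    Lf w R ≤ ∑ x, ∑ y, if S x y then w x * w y * ∏ i ∈ (univ.erase a).erase b, mu w (U x y i)
      else 0 := by
  set u : V → V → ι → V → ℝ := fun x y i v => if i = a then (if v = x then w x else 0)
    else if i = b then (if v = y then w y else 0)
    else if U x y i v then w v else 0 with hu
  have hu0 : ∀ x y i v, 0 ≤ u x y i v := by
    intro x y i v; simp only [hu]; split_ifs <;> simp [hw]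
  have key : Lf w R ≤ ∑ f : ι → V, ∑ x, ∑ y, if S x y then ∏ i, u x y i (f i) else 0 := by
    unfold Lf
    refine Finset.sum_le_sum fun f _ => ?_
    have hn : ∀ x, ∀ y ∈ (univ : Finset V), 0 ≤ (if S x y then ∏ i, u x y i (f i) else 0) :=
      fun x y _ => by
        split_ifs
        · exact Finset.prod_nonneg fun i _ => hu0 _ _ _ _
        · exact le_rfl
    by_cases h1 : R f
    · obtain ⟨hS, hU⟩ := h f h1
      refine le_trans ?_ (Finset.single_le_sum
        (f := fun x => ∑ y, if S x y then ∏ i, u x y i (f i) else 0)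
        (fun x _ => Finset.sum_nonneg (hn x)) (Finset.mem_univ (f a)))
      refine le_trans (le_of_eq ?_) (Finset.single_le_sum
        (f := fun y => if S (f a) y then ∏ i, u (f a) y i (f i) else 0)
        (hn (f a)) (Finset.mem_univ (f b)))
      simp only [h1, hS, if_true]
      refine Finset.prod_congr rfl fun i _ => ?_
      by_cases hia : i = a
      · simp [hu, hia]
      · by_cases hib : i = b
        · subst hib; simp [hu, hia]
        · simp [hu, hia, hib, hU i hia hib]
    · simp only [h1, if_false]
      exact Finset.sum_nonneg fun x _ => Finset.sum_nonneg (hn x)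
  refine key.trans (le_of_eq ?_)
  rw [Finset.sum_comm]
  refine Finset.sum_congr rfl fun x _ => ?_
  rw [Finset.sum_comm]
  refine Finset.sum_congr rfl fun y _ => ?_
  by_cases hS : S x y
  · simp only [hS, if_true]
    have hb : b ∈ univ.erase a := by simp [hab.symm]
    rw [sum_fun_prod (u x y), ← Finset.mul_prod_erase univ _ (Finset.mem_univ a),
      ← Finset.mul_prod_erase _ _ hb, ← mul_assoc]
    congr 1
    · simp [hu, hab.symm]
    · refine Finset.prod_congr rfl fun i hi => ?_
      have h1 : i ≠ b := Finset.ne_of_mem_erase hi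
      have h2 : i ≠ a := Finset.ne_of_mem_erase (Finset.mem_of_mem_erase hi)
      simp [hu, h1, h2, mu]
  · simp [hS]

end Lf

/-- the constant `a^a b^b/(a+b)^(a+b)` -/
noncomputable def Gf (a b : ℕ) : ℝ := (a : ℝ) ^ a * (b : ℝ) ^ b / ((a : ℝ) + b) ^ (a + b)

lemma Gf_nonneg (a b : ℕ) : 0 ≤ Gf a b := by unfold Gf; positivity

lemma pow_self_pos (a : ℕ) : (0 : ℝ) < (a : ℝ) ^ a := by
  rcases Nat.eq_zero_or_pos a with h | h
  · simp [h]
  · positivity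

lemma Gf_pos (a b : ℕ) : 0 < Gf a b := by
  unfold Gf
  have := pow_self_pos (a + b)
  push_cast at this
  exact div_pos (mul_pos (pow_self_pos a) (pow_self_pos b)) this

/-- weighted AM-GM -/
lemma amgm (a b : ℕ) {p q s : ℝ} (hp : 0 ≤ p) (hq : 0 ≤ q) (hs : p + q ≤ s) :
    p ^ a * q ^ b ≤ Gf a b * s ^ (a + b) := by
  have hs0 : 0 ≤ p + q := by linarith
  refine le_trans ?_ (mul_le_mul_of_nonneg_left (pow_le_pow_left₀ hs0 hs _) (Gf_nonneg a b))
  unfold Gf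
  rcases Nat.eq_zero_or_pos a with ha | ha
  · subst ha
    rcases Nat.eq_zero_or_pos b with hb | hb
    · subst hb; simp
    · have hb' : (0 : ℝ) < b := by exact_mod_cast hb
      simp only [pow_zero, one_mul, Nat.cast_zero, zero_add]
      rw [div_self (by positivity), one_mul]
      exact pow_le_pow_left₀ hq (by linarith) _
  rcases Nat.eq_zero_or_pos b with hb | hb
  · subst hb
    have ha' : (0 : ℝ) < a := by exact_mod_cast ha
    simp only [pow_zero, mul_one, Nat.cast_zero, add_zero]
    rw [div_self (by positivity), one_mul]
    exact pow_le_pow_left₀ hp (by linarith) _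
  have ha' : (0 : ℝ) < a := by exact_mod_cast ha
  have hb' : (0 : ℝ) < b := by exact_mod_cast hb
  rcases hs0.eq_or_lt with h0 | h0
  · have : p = 0 := by linarith
    rw [this, zero_pow ha.ne', zero_mul]; positivity
  set x : ℝ := p * (a + b) / (a * (p + q)) with hx
  set y : ℝ := q * (a + b) / (b * (p + q)) with hy
  have hx0 : 0 ≤ x := by positivity
  have hy0 : 0 ≤ y := by positivity
  have h1 : x ≤ Real.exp (x - 1) := by have := Real.add_one_le_exp (x - 1); linarith
  have h2 : y ≤ Real.exp (y - 1) := by have := Real.add_one_le_exp (y - 1); linarith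
  have h3 : x ^ a * y ^ b ≤ 1 := by
    calc x ^ a * y ^ b ≤ Real.exp (x - 1) ^ a * Real.exp (y - 1) ^ b := by gcongr
      _ = Real.exp (a * (x - 1) + b * (y - 1)) := by
        rw [← Real.exp_nat_mul, ← Real.exp_nat_mul, ← Real.exp_add]
      _ = 1 := by
        rw [Real.exp_eq_one_iff, hx, hy]; field_simp; ring_nf
  have e1 : p = x * (a * (p + q) / (a + b)) := by rw [hx]; field_simp
  have e2 : q = y * (b * (p + q) / (a + b)) := by rw [hy]; field_simp
  clear_value x y
  have e3 : p ^ a = x ^ a * ((a:ℝ) ^ a * (p + q) ^ a / (a + b) ^ a) := by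
    conv_lhs => rw [e1]
    rw [mul_pow, div_pow, mul_pow]
  have e4 : q ^ b = y ^ b * ((b:ℝ) ^ b * (p + q) ^ b / (a + b) ^ b) := by
    conv_lhs => rw [e2]
    rw [mul_pow, div_pow, mul_pow]
  calc p ^ a * q ^ b
      = (x ^ a * y ^ b) * ((a:ℝ) ^ a * b ^ b / (a + b) ^ (a + b) * (p + q) ^ (a + b)) := by
        rw [e3, e4, pow_add, pow_add]; field_simp
    _ ≤ 1 * ((a:ℝ) ^ a * b ^ b / (a + b) ^ (a + b) * (p + q) ^ (a + b)) := by gcongr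
    _ = _ := one_mul _

/-- label of a leaf -/
def lab (k l : ℕ) (i : Fin (k + l)) : Prop := i.val < k

instance (k l : ℕ) (i : Fin (k + l)) : Decidable (lab k l i) := by unfold lab; infer_instance

lemma card_lab (k l : ℕ) : (univ.filter (fun i : Fin (k + l) => lab k l i)).card = k := by
  have : (univ.filter (fun i : Fin (k + l) => lab k l i)) = univ.map (Fin.castAddEmb (n := k) l) := by
    ext i
    simp only [mem_filter, mem_univ, true_and, mem_map]
    unfold lab
    constructor
    · intro h; exact ⟨⟨i.val, h⟩, rfl⟩
    · rintro ⟨j, rfl⟩; simp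
  rw [this]; simp

lemma card_nlab (k l : ℕ) : (univ.filter (fun i : Fin (k + l) => ¬ lab k l i)).card = l := by
  have h := Finset.card_filter_add_card_filter_not (s := (univ : Finset (Fin (k+l))))
    (fun i => lab k l i)
  rw [card_lab] at h
  simp at h; omega

lemma prod_lab (k l : ℕ) (p q : ℝ) :
    ∏ i : Fin (k + l), (if lab k l i then p else q) = p ^ k * q ^ l := by
  rw [Finset.prod_ite, Finset.prod_const, Finset.prod_const, card_lab, card_nlab]

lemma prod_lab_erase (k l : ℕ) (p q : ℝ) (j : Fin (k + l)) :
    ∏ i ∈ univ.erase j, (if lab k l i then p else q) =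
      if lab k l j then p ^ (k - 1) * q ^ l else p ^ k * q ^ (l - 1) := by
  rw [Finset.prod_ite, Finset.prod_const, Finset.prod_const, Finset.filter_erase, Finset.filter_erase]
  by_cases h : lab k l j
  · rw [Finset.card_erase_of_mem (by simp [h]), Finset.erase_eq_of_notMem (by simp [h]), card_lab,
      card_nlab, if_pos h]
  · rw [Finset.erase_eq_of_notMem (by simp [h]), Finset.card_erase_of_mem (by simp [h]), card_lab,
      card_nlab, if_neg h]

lemma lab_pos {k l : ℕ} {j : Fin (k + l)} (h : lab k l j) : 1 ≤ k := by
  unfold lab at h; omega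

lemma nlab_pos {k l : ℕ} {j : Fin (k + l)} (h : ¬ lab k l j) : 1 ≤ l := by
  unfold lab at h; have := j.2; omega

lemma prod_lab_erase_le (k l : ℕ) {p q s : ℝ} (hp : 0 ≤ p) (hq : 0 ≤ q) (hs : p + q ≤ s)
    (j : Fin (k + l)) :
    ∏ i ∈ univ.erase j, (if lab k l i then p else q) ≤
      (if lab k l j then Gf (k - 1) l else Gf k (l - 1)) * s ^ (k + l - 1) := by
  rw [prod_lab_erase]
  split_ifs with h
  · have h1 := lab_pos h
    have := amgm (k - 1) l hp hq hs
    rwa [show k - 1 + l = k + l - 1 by omega] at this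
  · have h1 := nlab_pos h
    have := amgm k (l - 1) hp hq hs
    rwa [show k + (l - 1) = k + l - 1 by omega] at this

end OStar

namespace OStar
open Finset

/-- leaf functions of a (not necessarily injective) star centered at `c` -/
def star (k l : ℕ) {V : Type*} (A : V → V → Prop) (c : V) (f : Fin (k + l) → V) : Prop :=
  (∀ i, (lab k l i → A c (f i)) ∧ (¬ lab k l i → A (f i) c)) ∧ ∀ i j, ¬ A (f i) (f j)

/-- adjacency -/
def adj {V : Type*} (A : V → V → Prop) (u v : V) : Prop := A u v ∨ A v u

/-- total weight of stars -/
noncomputable def TT (k l : ℕ) {V : Type*} [Fintype V] (A : V → V → Prop) (w : V → ℝ) : ℝ :=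
  ∑ c, w c * Lf w (star k l A c)

/-- An optimal configuration -/
structure Cfg (k l : ℕ) (V : Type*) [Fintype V] where
  A : V → V → Prop
  asym : ∀ u v, A u v → ¬ A v u
  w : V → ℝ
  wpos : ∀ v, 0 < w v
  wsum : ∑ v, w v = 1
  hmax : ∀ w' : V → ℝ, (∀ v, 0 ≤ w' v) → TT k l A w' ≤ TT k l A w * (∑ v, w' v) ^ (k + l + 1)
  ht : Gf k l * (((k + l : ℕ) : ℝ) ^ (k + l) / ((k + l : ℕ) + 1 : ℝ) ^ (k + l + 1)) ≤ TT k l A w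
  hl : 1 ≤ l
  hlk : l ≤ k
  hm : 6 ≤ k + l

lemma prod_bern {ι : Type*} (s : Finset ι) (x : ι → ℝ) (h0 : ∀ i ∈ s, 0 ≤ x i) (h1 : ∀ i ∈ s, x i ≤ 1) :
    1 - ∑ i ∈ s, x i ≤ ∏ i ∈ s, (1 - x i) := by
  classical
  induction s using Finset.induction_on with
  | empty => simp
  | insert a s ha ih =>
    rw [Finset.sum_insert ha, Finset.prod_insert ha]
    have h2 := ih (fun i hi => h0 i (mem_insert_of_mem hi)) (fun i hi => h1 i (mem_insert_of_mem hi))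
    have h3 := h0 a (mem_insert_self _ _)
    have h4 := h1 a (mem_insert_self _ _)
    have h5 : 0 ≤ ∑ i ∈ s, x i := Finset.sum_nonneg fun i hi => h0 i (mem_insert_of_mem hi)
    have h6 := mul_le_mul_of_nonneg_left h2 (sub_nonneg.2 h4)
    nlinarith

namespace Cfg
variable {k l : ℕ} {V : Type*} [Fintype V] (C : Cfg k l V)

/-- center contribution -/
noncomputable def sc (v : V) : ℝ := Lf C.w (star k l C.A v)

/-- leaf contribution -/
noncomputable def M (v : V) : ℝ :=
  ∑ j, ∑ c, C.w c * Lf C.w (fun f => star k l C.A c f ∧ f j = v)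

/-- the total -/
noncomputable def t : ℝ := TT k l C.A C.w

lemma w0 (v : V) : 0 ≤ C.w v := (C.wpos v).le

lemma sc_nonneg (v : V) : 0 ≤ C.sc v := Lf_nonneg C.w0 _

lemma M_nonneg (v : V) : 0 ≤ C.M v :=
  Finset.sum_nonneg fun _ _ => Finset.sum_nonneg fun _ _ => mul_nonneg (C.w0 _) (Lf_nonneg C.w0 _)

lemma t_eq : C.t = ∑ v, C.w v * C.sc v := rfl

lemma t_nonneg : 0 ≤ C.t := Finset.sum_nonneg fun v _ => mul_nonneg (C.w0 _) (C.sc_nonneg _)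

lemma sum_M : ∑ v, C.M v = ((k + l : ℕ) : ℝ) * C.t := by
  classical
  unfold M
  rw [Finset.sum_comm]
  have : ∀ j : Fin (k + l), ∑ v, ∑ c, C.w c * Lf C.w (fun f => star k l C.A c f ∧ f j = v) = C.t := by
    intro j
    rw [Finset.sum_comm, t_eq]
    refine Finset.sum_congr rfl fun c _ => ?_
    rw [← Finset.mul_sum]
    congr 1
    unfold sc Lf
    rw [Finset.sum_comm]
    refine Finset.sum_congr rfl fun f _ => ?_
    by_cases h : star k l C.A c f <;> simp [h]
  simp [this]

lemma scale_lower (v : V) {ε : ℝ} (h0 : 0 ≤ ε) (h1 : ε ≤ 1) :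
    open scoped Classical in
    C.t - ε * (C.w v * C.sc v + C.M v) ≤
      TT k l C.A (fun u => if u = v then (1 - ε) * C.w u else C.w u) := by
  classical
  set e : V → ℝ := fun u => if u = v then ε else 0 with he
  have hw' : (fun u => if u = v then (1 - ε) * C.w u else C.w u) = fun u => (1 - e u) * C.w u := by
    funext u; simp only [he]; split_ifs <;> ring
  rw [hw']
  have key : ∀ c, ∀ f : Fin (k + l) → V, (1 - e c - ∑ j, e (f j)) * (C.w c * ∏ i, C.w (f i)) ≤
      ((1 - e c) * C.w c) * ∏ i, ((1 - e (f i)) * C.w (f i)) := by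
    intro c f
    rw [Finset.prod_mul_distrib]
    have e0 : ∀ u, 0 ≤ e u := fun u => by simp only [he]; split_ifs <;> simp [h0]
    have e1 : ∀ u, e u ≤ 1 := fun u => by simp only [he]; split_ifs <;> simp [h1]
    have hb := prod_bern univ (fun i => e (f i)) (fun i _ => e0 _) (fun i _ => e1 _)
    have hp : 0 ≤ C.w c * ∏ i, C.w (f i) :=
      mul_nonneg (C.w0 _) (Finset.prod_nonneg fun i _ => C.w0 _)
    have hs : 0 ≤ ∑ i, e (f i) := Finset.sum_nonneg fun i _ => e0 _
    have : (1 - e c - ∑ j, e (f j)) ≤ (1 - e c) * ∏ i, (1 - e (f i)) := by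
      have := mul_le_mul_of_nonneg_left hb (sub_nonneg.2 (e1 c))
      have h3 := mul_nonneg (e0 c) hs
      nlinarith
    calc _ ≤ ((1 - e c) * ∏ i, (1 - e (f i))) * (C.w c * ∏ i, C.w (f i)) :=
          mul_le_mul_of_nonneg_right this hp
      _ = _ := by ring
  have h2 : ∑ c, ∑ f : Fin (k+l) → V, (if star k l C.A c f then
      (1 - e c - ∑ j, e (f j)) * (C.w c * ∏ i, C.w (f i)) else 0) ≤
      TT k l C.A (fun u => (1 - e u) * C.w u) := by
    unfold TT Lf
    refine Finset.sum_le_sum fun c _ => ?_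
    rw [Finset.mul_sum]
    refine Finset.sum_le_sum fun f _ => ?_
    split_ifs
    · exact key c f
    · simp
  refine le_trans (le_of_eq ?_) h2
  have h3 : ∀ c, ∀ f : Fin (k+l) → V, (if star k l C.A c f then
      (1 - e c - ∑ j, e (f j)) * (C.w c * ∏ i, C.w (f i)) else 0) =
      C.w c * (if star k l C.A c f then ∏ i, C.w (f i) else 0)
      - (if c = v then ε * (C.w c * (if star k l C.A c f then ∏ i, C.w (f i) else 0)) else 0)
      - ∑ j, ε * (C.w c * (if star k l C.A c f ∧ f j = v then ∏ i, C.w (f i) else 0)) := by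
    intro c f
    by_cases h : star k l C.A c f
    · simp only [h, if_true, true_and]
      have : ∑ j, ε * (C.w c * (if f j = v then ∏ i, C.w (f i) else 0)) =
          (∑ j, e (f j)) * (C.w c * ∏ i, C.w (f i)) := by
        rw [Finset.sum_mul]
        refine Finset.sum_congr rfl fun j _ => ?_
        simp only [he]; split_ifs <;> ring
      rw [this]
      simp only [he]
      split_ifs <;> ring
    · simp [h]
  simp_rw [h3, Finset.sum_sub_distrib]
  have h4 : ∑ c, ∑ f : Fin (k+l) → V, C.w c * (if star k l C.A c f then ∏ i, C.w (f i) else 0) = C.t := by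
    unfold t TT Lf; simp_rw [Finset.mul_sum]
  have h5 : ∑ c, ∑ f : Fin (k+l) → V, (if c = v then ε * (C.w c * (if star k l C.A c f then ∏ i, C.w (f i) else 0)) else 0) = ε * (C.w v * C.sc v) := by
    rw [Finset.sum_eq_single v]
    · simp only [if_true]
      rw [← Finset.mul_sum, ← Finset.mul_sum]; rfl
    · intro b _ hb; simp [hb]
    · simp
  have h6 : ∑ c, ∑ f : Fin (k+l) → V, ∑ j, ε * (C.w c * (if star k l C.A c f ∧ f j = v then ∏ i, C.w (f i) else 0)) = ε * C.M v := by
    unfold M Lf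
    simp_rw [Finset.mul_sum]
    conv_rhs => rw [Finset.sum_comm]
    refine Finset.sum_congr rfl fun c _ => ?_
    rw [Finset.sum_comm]
    refine Finset.sum_congr rfl fun j _ => Finset.sum_congr rfl fun f _ => ?_
    by_cases h : star k l C.A c f ∧ f j = v <;> simp only [h, if_true, if_false]
  rw [h4, h5, h6]; ring

lemma lagrange (v : V) : ((k + l : ℕ) + 1 : ℝ) * C.t * C.w v ≤ C.w v * C.sc v + C.M v := by
  classical
  set K := C.w v * C.sc v + C.M v with hK
  set n : ℕ := k + l + 1 with hn
  have hcast : ((k + l : ℕ) + 1 : ℝ) = n := by rw [hn]; push_cast; ring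
  rw [hcast]
  have hK0 : 0 ≤ K := add_nonneg (mul_nonneg (C.w0 v) (C.sc_nonneg v)) (C.M_nonneg v)
  have hw1 : C.w v ≤ 1 := by
    rw [← C.wsum]; exact Finset.single_le_sum (fun u _ => C.w0 u) (mem_univ v)
  have main : ∀ ε : ℝ, 0 < ε → ε ≤ 1 → n * C.t * C.w v ≤ K * (1 + n * (ε * C.w v)) := by
    intro ε h0 h1
    have a1 := C.scale_lower v h0.le h1
    have a2 := C.hmax (fun u => if u = v then (1 - ε) * C.w u else C.w u) (fun u => by
      split_ifs
      · exact mul_nonneg (by linarith) (C.w0 _)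
      · exact C.w0 _)
    have a3 : ∑ u, (if u = v then (1 - ε) * C.w u else C.w u) = 1 - ε * C.w v := by
      have : ∀ u, (if u = v then (1 - ε) * C.w u else C.w u) = C.w u - (if u = v then ε * C.w u else 0) := by
        intro u; split_ifs <;> ring
      rw [Finset.sum_congr rfl fun u _ => this u, Finset.sum_sub_distrib, C.wsum]; simp
    rw [a3] at a2
    have a4 := a1.trans a2
    rw [← hK] at a4
    set y := ε * C.w v with hy
    have hy0 : 0 ≤ y := mul_nonneg h0.le (C.w0 v)
    have hy1 : y ≤ 1 := by nlinarith [C.w0 v]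
    have b1 : (1 - y) ^ n * (1 + n * y) ≤ 1 := by
      calc (1 - y) ^ n * (1 + n * y) ≤ (1 - y) ^ n * (1 + y) ^ n := by
            exact mul_le_mul_of_nonneg_left (one_add_mul_le_pow (by linarith) n)
              (pow_nonneg (by linarith) _)
        _ = (1 - y ^ 2) ^ n := by rw [← mul_pow]; ring
        _ ≤ 1 := pow_le_one₀ (by nlinarith) (by nlinarith)
    have b2 : 0 ≤ 1 + n * y := by positivity
    have b3 := mul_le_mul_of_nonneg_right a4 b2
    have b4 : C.t * (1 - y) ^ n * (1 + n * y) ≤ C.t := by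
      have := mul_le_mul_of_nonneg_left b1 C.t_nonneg
      linarith
    have b5 : (C.t - ε * K) * (1 + n * y) ≤ C.t := b3.trans b4
    have b6 : ε * (n * C.t * C.w v) ≤ ε * (K * (1 + n * y)) := by
      rw [hy] at b5 ⊢; nlinarith
    exact le_of_mul_le_mul_left b6 h0
  refine le_of_forall_pos_le_add fun δ hδ => ?_
  have hQ : 0 < K * (n * C.w v) + 1 := by
    have := C.w0 v; positivity
  have := main (min 1 (δ / (K * (n * C.w v) + 1))) (by positivity) (min_le_left _ _)
  have h2 : min 1 (δ / (K * (n * C.w v) + 1)) * (K * (n * C.w v)) ≤ δ := by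
    have h3 : min 1 (δ / (K * (n * C.w v) + 1)) ≤ δ / (K * (n * C.w v) + 1) := min_le_right _ _
    have h4 : 0 ≤ K * (n * C.w v) := by have := C.w0 v; positivity
    calc _ ≤ δ / (K * (n * C.w v) + 1) * (K * (n * C.w v)) := by gcongr
      _ ≤ δ / (K * (n * C.w v) + 1) * (K * (n * C.w v) + 1) := by gcongr; linarith
      _ = δ := div_mul_cancel₀ _ hQ.ne'
  nlinarith

end Cfg
end OStar

namespace OStar
open Finset

lemma Gf_comm (a b : ℕ) : Gf a b = Gf b a := by
  unfold Gf; rw [add_comm a b, add_comm (a:ℝ) b]; ring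

lemma one_add_inv_pow_le (n : ℕ) : ((n : ℝ) + 1) ^ n ≤ Real.exp 1 * (n : ℝ) ^ n := by
  rcases Nat.eq_zero_or_pos n with h | h
  · subst h; simp [Real.one_le_exp]
  have hn : (0 : ℝ) < n := by exact_mod_cast h
  have h1 : (1 + 1 / (n : ℝ)) ≤ Real.exp (1 / n) := by
    have := Real.add_one_le_exp (1 / (n : ℝ)); linarith
  have h2 : (1 + 1 / (n : ℝ)) ^ n ≤ Real.exp 1 := by
    calc _ ≤ Real.exp (1 / n) ^ n := by gcongr
      _ = Real.exp 1 := by rw [← Real.exp_nat_mul]; congr 1; field_simp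
  have h3 : ((n : ℝ) + 1) = (1 + 1 / n) * n := by field_simp
  rw [h3, mul_pow]; gcongr

lemma Gf_step (a b : ℕ) :
    ((a : ℝ) + 1) * Gf a b ≤ Real.exp 1 * ((a : ℝ) + 1 + b) * Gf (a + 1) b := by
  have h := one_add_inv_pow_le (a + b)
  have hpos := pow_self_pos (a + b)
  unfold Gf
  push_cast at h hpos ⊢
  rw [show a + 1 + b = (a + b) + 1 by ring, pow_succ ((a:ℝ) + 1), pow_succ ((a:ℝ) + 1 + b),
    show (a:ℝ) + 1 + b = a + b + 1 by ring]
  have h1 : (0:ℝ) < (a + b + 1) ^ (a + b) := by positivity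
  have h2 : (a:ℝ) ^ a ≤ (a + 1) ^ a := by gcongr; linarith
  rw [mul_div_assoc', mul_div_assoc', div_le_div_iff₀ hpos (by positivity)]
  have hb := pow_self_pos b
  have ha0 : (0:ℝ) ≤ (a:ℝ) ^ a := (pow_self_pos a).le
  calc ((a:ℝ) + 1) * (a ^ a * b ^ b) * ((a + b + 1) ^ (a + b) * (a + b + 1))
      = ((a:ℝ) + 1) * b ^ b * (a + b + 1) * (a ^ a * (a + b + 1) ^ (a + b)) := by ring
    _ ≤ ((a:ℝ) + 1) * b ^ b * (a + b + 1) * ((a + 1) ^ a * (Real.exp 1 * (a + b) ^ (a + b))) := by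
        gcongr
    _ = _ := by ring

lemma Gf_stepo {k l : ℕ} (hk : 1 ≤ k) :
    (k : ℝ) * Gf (k - 1) l ≤ Real.exp 1 * ((k + l : ℕ) : ℝ) * Gf k l := by
  obtain ⟨a, rfl⟩ := Nat.exists_eq_add_of_le' hk
  have := Gf_step a l
  simpa using this

lemma Gf_stepi {k l : ℕ} (hl : 1 ≤ l) :
    (l : ℝ) * Gf k (l - 1) ≤ Real.exp 1 * ((k + l : ℕ) : ℝ) * Gf k l := by
  have := Gf_stepo (k := l) (l := k) hl
  rwa [Gf_comm (l - 1) k, Gf_comm l k, add_comm l k] at this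

/-- constant attached to leaf `j` -/
noncomputable def gj (k l : ℕ) (j : Fin (k + l)) : ℝ :=
  if lab k l j then Gf (k - 1) l else Gf k (l - 1)

lemma gj_nonneg (k l : ℕ) (j : Fin (k + l)) : 0 ≤ gj k l j := by
  unfold gj; split_ifs <;> exact Gf_nonneg _ _

lemma sum_lab (k l : ℕ) (a b : ℝ) :
    ∑ i : Fin (k + l), (if lab k l i then a else b) = k * a + l * b := by
  rw [Finset.sum_ite, Finset.sum_const, Finset.sum_const, card_lab, card_nlab]; simp

section
variable {k l : ℕ} {V : Type*} [Fintype V] {w : V → ℝ}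

lemma Lf_lab (hw : ∀ v, 0 ≤ w v) {R : (Fin (k + l) → V) → Prop} {Sp Sq : V → Prop}
    (h : ∀ f, R f → ∀ i, (lab k l i → Sp (f i)) ∧ (¬ lab k l i → Sq (f i))) :
    Lf w R ≤ mu w Sp ^ k * mu w Sq ^ l := by
  have := Lf_prod (S := fun i v => (lab k l i → Sp v) ∧ (¬ lab k l i → Sq v)) hw h
  refine this.trans (le_of_eq ?_)
  rw [← prod_lab]
  refine Finset.prod_congr rfl fun i _ => ?_
  by_cases hi : lab k l i <;> simp [hi]

open scoped Classical in
lemma Lf_lab_one (hw : ∀ v, 0 ≤ w v) {R : (Fin (k + l) → V) → Prop} (j : Fin (k + l))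
    {S : V → Prop} [DecidablePred S] {Up Uq : V → V → Prop} {s : V → ℝ}
    (h : ∀ f, R f → S (f j) ∧ ∀ i, i ≠ j → (lab k l i → Up (f j) (f i)) ∧
      (¬ lab k l i → Uq (f j) (f i)))
    (hs : ∀ x, S x → mu w (Up x) + mu w (Uq x) ≤ s x) :
    Lf w R ≤ ∑ x, if S x then w x * (gj k l j * s x ^ (k + l - 1)) else 0 := by
  have := Lf_one (S := S) (U := fun x i v => (lab k l i → Up x v) ∧ (¬ lab k l i → Uq x v)) hw j h
  refine this.trans (Finset.sum_le_sum fun x _ => ?_)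
  split_ifs with hS
  · refine mul_le_mul_of_nonneg_left ?_ (hw x)
    refine le_trans (le_of_eq ?_) (prod_lab_erase_le k l (mu_nonneg hw (Up x)) (mu_nonneg hw (Uq x))
      (hs x hS) j)
    refine Finset.prod_congr rfl fun i _ => ?_
    by_cases hi : lab k l i <;> simp [hi]
  · exact le_rfl

end

namespace Cfg
variable {k l : ℕ} {V : Type*} [Fintype V] (C : Cfg k l V)

/-- degree -/
noncomputable def rho (v : V) : ℝ := mu C.w (adj C.A v)
/-- out-degree -/
noncomputable def rp (v : V) : ℝ := mu C.w (fun u => C.A v u)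
/-- in-degree -/
noncomputable def rm (v : V) : ℝ := mu C.w (fun u => C.A u v)

lemma irr (v : V) : ¬ C.A v v := fun h => C.asym v v h h

lemma hk (C : Cfg k l V) : 1 ≤ k := C.hl.trans C.hlk

lemma mm6 (C : Cfg k l V) : (6 : ℝ) ≤ ((k + l : ℕ) : ℝ) := by exact_mod_cast C.hm

lemma mu_nn (S : V → Prop) : 0 ≤ mu C.w S := mu_nonneg C.w0 S

lemma mu_le_one (S : V → Prop) : mu C.w S ≤ 1 := by
  rw [← C.wsum, ← mu_true]
  exact mu_mono C.w0 (by simp)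

lemma rp_add_rm (v : V) : C.rp v + C.rm v = C.rho v := by
  unfold rp rm rho
  rw [mu_split (adj C.A v) (fun u => C.A v u)]
  congr 1
  · exact mu_congr fun u => by unfold adj; tauto
  · refine mu_congr fun u => ?_
    have := C.asym v u
    unfold adj; tauto

lemma mu_add_not (S : V → Prop) : mu C.w S + mu C.w (fun u => ¬ S u) = 1 := by
  have := mu_split (w := C.w) (fun _ => True) S
  rw [mu_true, C.wsum] at this
  rw [this]; simp

lemma mu_AA (v : V) (B : V → Prop) :
    mu C.w (fun u => C.A v u ∧ B u) + mu C.w (fun u => C.A u v ∧ B u) ≤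
      mu C.w (fun u => adj C.A v u ∧ B u) :=
  mu_disj C.w0 (fun u h => ⟨Or.inl h.1, h.2⟩) (fun u h => ⟨Or.inr h.1, h.2⟩)
    (fun u h h' => C.asym _ _ h.1 h'.1)

lemma sc_le (v : V) : C.sc v ≤ C.rp v ^ k * C.rm v ^ l :=
  Lf_lab C.w0 fun _ hf i => ⟨fun hi => (hf.1 i).1 hi, fun hi => (hf.1 i).2 hi⟩

lemma sc_le' (v : V) : C.sc v ≤ Gf k l * C.rho v ^ (k + l) :=
  (C.sc_le v).trans (amgm k l (C.mu_nn _) (C.mu_nn _) (C.rp_add_rm v).le)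

lemma star_adj {c : V} {f : Fin (k + l) → V} (h : star k l C.A c f) (i : Fin (k + l)) :
    adj C.A c (f i) := by
  by_cases hi : lab k l i
  · exact Or.inl ((h.1 i).1 hi)
  · exact Or.inr ((h.1 i).2 hi)

lemma star_nadj {c : V} {f : Fin (k + l) → V} (h : star k l C.A c f) (i j : Fin (k + l)) :
    ¬ adj C.A (f i) (f j) := by
  rintro (h1 | h1)
  · exact h.2 _ _ h1
  · exact h.2 _ _ h1

open scoped Classical in
lemma MgenK {K : ℝ} (hKo : (k:ℝ) * Gf (k - 1) l ≤ K) (hKi : (l:ℝ) * Gf k (l - 1) ≤ K) (v : V) (R : V → (Fin (k + l) → V) → Prop) (Z : V → Prop) (B : V → V → Prop)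
    (hR : ∀ c f, R c f → star k l C.A c f)
    (hZ : ∀ c f, R c f → Z c)
    (hB : ∀ j c f, R c f → f j = v → ∀ i, i ≠ j → B c (f i)) :
    ∑ j, ∑ c, C.w c * Lf C.w (fun f => R c f ∧ f j = v) ≤
      C.w v * K *
        ∑ c, if Z c ∧ adj C.A c v then C.w c *
          mu C.w (fun u => adj C.A c u ∧ ¬ adj C.A v u ∧ B c u) ^ (k + l - 1) else 0 := by
  set s : V → ℝ := fun c => mu C.w (fun u => adj C.A c u ∧ ¬ adj C.A v u ∧ B c u) with hs
  have h1 : ∀ j c, Lf C.w (fun f => R c f ∧ f j = v) ≤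
      if Z c ∧ ((lab k l j ∧ C.A c v) ∨ (¬ lab k l j ∧ C.A v c)) then
        C.w v * (gj k l j * s c ^ (k + l - 1)) else 0 := by
    intro j c
    have := Lf_lab_one (w := C.w) C.w0 (R := fun f => R c f ∧ f j = v) j
      (S := fun x => x = v ∧ Z c ∧ ((lab k l j ∧ C.A c v) ∨ (¬ lab k l j ∧ C.A v c)))
      (Up := fun _ u => C.A c u ∧ ¬ adj C.A v u ∧ B c u)
      (Uq := fun _ u => C.A u c ∧ ¬ adj C.A v u ∧ B c u)
      (s := fun _ => s c) ?_ ?_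
    · refine this.trans (le_of_eq ?_)
      rw [Finset.sum_eq_single v]
      · simp
      · intro b _ hb; simp [hb]
      · simp
    · rintro f ⟨hf, hv⟩
      have hst := hR c f hf
      refine ⟨⟨hv, hZ c f hf, ?_⟩, ?_⟩
      · by_cases hj : lab k l j
        · left; exact ⟨hj, hv ▸ (hst.1 j).1 hj⟩
        · right; exact ⟨hj, hv ▸ (hst.1 j).2 hj⟩
      · intro i hi
        have h3 : ¬ adj C.A v (f i) := hv ▸ C.star_nadj hst j i
        exact ⟨fun h => ⟨(hst.1 i).1 h, h3, hB j c f hf hv i hi⟩,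
          fun h => ⟨(hst.1 i).2 h, h3, hB j c f hf hv i hi⟩⟩
    · intro x _
      exact C.mu_AA c _
  rw [Finset.sum_comm, Finset.mul_sum]
  refine Finset.sum_le_sum fun c _ => ?_
  have hs0 : 0 ≤ s c := C.mu_nn _
  have hwv := C.w0 v
  have hwc := C.w0 c
  rw [← Finset.mul_sum]
  refine (mul_le_mul_of_nonneg_left (Finset.sum_le_sum fun j _ => h1 j c) hwc).trans ?_
  by_cases hz : Z c
  swap
  · simp [hz]
  by_cases ha : C.A c v
  · have ha' : ¬ C.A v c := C.asym _ _ ha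
    have e1 : ∀ j, (if Z c ∧ ((lab k l j ∧ C.A c v) ∨ (¬ lab k l j ∧ C.A v c)) then
        C.w v * (gj k l j * s c ^ (k + l - 1)) else 0) =
        if lab k l j then C.w v * (Gf (k - 1) l * s c ^ (k + l - 1)) else 0 := by
      intro j; by_cases hj : lab k l j <;> simp [hz, ha, ha', hj, gj]
    simp_rw [e1]
    rw [sum_lab]
    have h4 := hKo
    rw [if_pos ⟨hz, Or.inl ha⟩]
    have h5 : 0 ≤ C.w c * C.w v * s c ^ (k + l - 1) := by positivity
    have := mul_le_mul_of_nonneg_right h4 h5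
    calc _ = (k : ℝ) * Gf (k - 1) l * (C.w c * C.w v * s c ^ (k + l - 1)) := by ring
      _ ≤ _ := this
      _ = _ := by ring
  · by_cases hb : C.A v c
    · have e1 : ∀ j, (if Z c ∧ ((lab k l j ∧ C.A c v) ∨ (¬ lab k l j ∧ C.A v c)) then
          C.w v * (gj k l j * s c ^ (k + l - 1)) else 0) =
          if lab k l j then 0 else C.w v * (Gf k (l - 1) * s c ^ (k + l - 1)) := by
        intro j; by_cases hj : lab k l j <;> simp [hz, ha, hb, hj, gj]
      simp_rw [e1]
      rw [sum_lab]
      have h4 := hKi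
      rw [if_pos ⟨hz, Or.inr hb⟩]
      have h5 : 0 ≤ C.w c * C.w v * s c ^ (k + l - 1) := by positivity
      have := mul_le_mul_of_nonneg_right h4 h5
      calc _ = (l : ℝ) * Gf k (l - 1) * (C.w c * C.w v * s c ^ (k + l - 1)) := by ring
        _ ≤ _ := this
        _ = _ := by ring
    · simp [adj, ha, hb]

open scoped Classical in
lemma Mgen (v : V) (R : V → (Fin (k + l) → V) → Prop) (Z : V → Prop) (B : V → V → Prop)
    (hR : ∀ c f, R c f → star k l C.A c f)
    (hZ : ∀ c f, R c f → Z c)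
    (hB : ∀ j c f, R c f → f j = v → ∀ i, i ≠ j → B c (f i)) :
    ∑ j, ∑ c, C.w c * Lf C.w (fun f => R c f ∧ f j = v) ≤
      C.w v * (Real.exp 1 * ((k + l : ℕ) : ℝ) * Gf k l) *
        ∑ c, if Z c ∧ adj C.A c v then C.w c *
          mu C.w (fun u => adj C.A c u ∧ ¬ adj C.A v u ∧ B c u) ^ (k + l - 1) else 0 :=
  C.MgenK (Gf_stepo C.hk) (Gf_stepi C.hl) v R Z B hR hZ hB

lemma adj_comm (u v : V) : adj C.A u v ↔ adj C.A v u := by unfold adj; tauto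

lemma rho_nn (v : V) : 0 ≤ C.rho v := C.mu_nn _
lemma rho_le (v : V) : C.rho v ≤ 1 := C.mu_le_one _

lemma M_le (v : V) : C.M v ≤ C.w v * (Real.exp 1 * ((k + l : ℕ) : ℝ) * Gf k l) *
    (C.rho v * (1 - C.rho v) ^ (k + l - 1)) := by
  classical
  have h := C.Mgen v (star k l C.A) (fun _ => True) (fun _ _ => True) (fun _ _ h => h) (by simp) (by simp)
  refine le_trans h ?_
  refine mul_le_mul_of_nonneg_left ?_ ?_
  · unfold rho mu
    rw [Finset.sum_mul]
    refine Finset.sum_le_sum fun c _ => ?_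
    by_cases hc : adj C.A c v
    · rw [if_pos ⟨trivial, hc⟩, if_pos ((C.adj_comm _ _).1 hc)]
      refine mul_le_mul_of_nonneg_left ?_ (C.w0 c)
      refine pow_le_pow_left₀ (C.mu_nn _) ?_ _
      have h1 := C.mu_add_not (adj C.A v)
      have h2 : mu C.w (fun u => adj C.A c u ∧ ¬ adj C.A v u ∧ True) ≤ mu C.w (fun u => ¬ adj C.A v u) :=
        mu_mono C.w0 (by tauto)
      have : (1 - ∑ v_1, if adj C.A v v_1 then C.w v_1 else 0) = 1 - mu C.w (adj C.A v) := by
        unfold mu; simp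
      rw [this]; linarith
    · rw [if_neg (by tauto), if_neg (fun h => hc ((C.adj_comm _ _).1 h)), zero_mul]
  · have := C.w0 v; have := Gf_nonneg k l; positivity

/-- normalized total -/
noncomputable def sg : ℝ := (((k + l : ℕ) : ℝ) + 1) * C.t / Gf k l

lemma t_sg : (((k + l : ℕ) : ℝ) + 1) * C.t = C.sg * Gf k l := by
  unfold sg; rw [div_mul_cancel₀ _ (Gf_pos k l).ne']

lemma sg_ge : ((k + l : ℕ) : ℝ) ^ (k + l) / (((k + l : ℕ) : ℝ) + 1) ^ (k + l) ≤ C.sg := by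
  have h := C.ht
  have hp := Gf_pos k l
  unfold sg t
  rw [le_div_iff₀ hp]
  have h0 : (0:ℝ) < ((k + l : ℕ) : ℝ) + 1 := by positivity
  have := mul_le_mul_of_nonneg_left h h0.le
  refine le_trans (le_of_eq ?_) this
  rw [pow_succ (((k + l : ℕ) : ℝ) + 1)]; field_simp

lemma sg_ge' : 1 / Real.exp 1 ≤ C.sg := by
  refine le_trans ?_ C.sg_ge
  have h := one_add_inv_pow_le (k + l)
  rw [div_le_div_iff₀ (Real.exp_pos 1) (by positivity)]
  linarith

lemma lagrange' (v : V) : C.sg ≤ C.sc v / Gf k l +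
    Real.exp 1 * ((k + l : ℕ) : ℝ) * (C.rho v * (1 - C.rho v) ^ (k + l - 1)) := by
  have h1 := C.lagrange v
  have h2 := C.M_le v
  rw [C.t_sg] at h1
  have hp := Gf_pos k l
  have hw := C.wpos v
  have h3 : C.w v * (C.sg * Gf k l) ≤ C.w v * (C.sc v + (Real.exp 1 * ((k + l : ℕ) : ℝ) * Gf k l) *
    (C.rho v * (1 - C.rho v) ^ (k + l - 1))) := by linarith
  have h4 := le_of_mul_le_mul_left h3 hw
  rw [← sub_le_iff_le_add, le_div_iff₀ hp]
  linarith

end Cfg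
end OStar

namespace OStar
open Finset

lemma e_lo : (2.7182 : ℝ) < Real.exp 1 := by have := Real.exp_one_gt_d9; linarith
lemma e_hi : Real.exp 1 < (2.7183 : ℝ) := by have := Real.exp_one_lt_d9; linarith
lemma ie_lo : (0.3678 : ℝ) < 1 / Real.exp 1 := by
  rw [lt_div_iff₀ (Real.exp_pos 1)]; have := e_hi; linarith
lemma ie_hi : 1 / Real.exp 1 < (0.3679 : ℝ) := by
  rw [div_lt_iff₀ (Real.exp_pos 1)]; have := e_lo; linarith

lemma conv_comb {c d u : ℝ} (h1 : c ≤ u) (h2 : u ≤ d) :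
    ∃ a b : ℝ, 0 ≤ a ∧ 0 ≤ b ∧ a + b = 1 ∧ u = a * c + b * d := by
  rcases h1.eq_or_lt with h | h
  · exact ⟨1, 0, by norm_num, le_rfl, by norm_num, by linarith⟩
  · have hd : 0 < d - c := by linarith
    refine ⟨(d - u) / (d - c), (u - c) / (d - c), ?_, ?_, ?_, ?_⟩
    · exact div_nonneg (by linarith) hd.le
    · exact div_nonneg (by linarith) hd.le
    · field_simp; ring
    · field_simp; ring

lemma pow_conv (n : ℕ) {a b x y : ℝ} (ha : 0 ≤ a) (hb : 0 ≤ b) (hab : a + b = 1)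
    (hx : 0 ≤ x) (hy : 0 ≤ y) : (a * x + b * y) ^ n ≤ a * x ^ n + b * y ^ n := by
  have := (convexOn_pow n).2 (Set.mem_Ici.2 hx) (Set.mem_Ici.2 hy) ha hb hab
  simpa using this

lemma one_sub_le_exp2 {x : ℝ} (h0 : 0 ≤ x) (h1 : x < 1) : 1 - x ≤ Real.exp (-x - x ^ 2 / 2) := by
  have h := Real.hasSum_pow_div_log_of_abs_lt_one (x := x) (by rw [abs_of_nonneg h0]; exact h1)
  have h2 := sum_le_hasSum (range 2) (fun i _ => by positivity) h
  norm_num [Finset.sum_range_succ] at h2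
  rw [← Real.exp_log (show 0 < 1 - x by linarith)]
  apply Real.exp_le_exp.2; linarith

/-- `(1-1/m)^m ≤ e⁻¹(1 - 1/(2m+1))` -/
lemma one_sub_inv_pow {m : ℕ} (hm : 2 ≤ m) :
    (1 - 1 / (m : ℝ)) ^ m ≤ 1 / Real.exp 1 * (1 - 1 / (2 * m + 1)) := by
  have hm' : (2 : ℝ) ≤ m := by exact_mod_cast hm
  have hx1 : 1 / (m : ℝ) < 1 := by rw [div_lt_one (by linarith)]; linarith
  have h := one_sub_le_exp2 (x := 1 / (m : ℝ)) (by positivity) hx1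
  have h0 : 0 ≤ 1 - 1 / (m : ℝ) := by linarith
  have h1 : (1 - 1 / (m : ℝ)) ^ m ≤ Real.exp (-1 + -(1 / (2 * m))) := by
    calc _ ≤ Real.exp (-(1 / (m:ℝ)) - (1 / (m:ℝ)) ^ 2 / 2) ^ m := pow_le_pow_left₀ h0 h m
      _ = _ := by rw [← Real.exp_nat_mul]; congr 1; field_simp; ring
  rw [Real.exp_add, Real.exp_neg, Real.exp_neg] at h1
  refine h1.trans ?_
  rw [one_div (Real.exp 1)]
  refine mul_le_mul_of_nonneg_left ?_ (by positivity)
  have h2 := Real.add_one_le_exp (1 / (2 * (m : ℝ)))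
  have h3 : 0 < 1 / (2 * (m : ℝ)) + 1 := by positivity
  calc (Real.exp (1 / (2 * m)))⁻¹ ≤ (1 / (2 * (m : ℝ)) + 1)⁻¹ := inv_anti₀ h3 h2
    _ = _ := by field_simp; ring

lemma m_pow_m2 {m : ℕ} (hm : 6 ≤ m) : 36 * (m : ℝ) ^ 2 ≤ (m : ℝ) ^ (m - 2) := by
  have hm' : (6 : ℝ) ≤ m := by exact_mod_cast hm
  calc 36 * (m : ℝ) ^ 2 ≤ (m : ℝ) ^ 2 * (m : ℝ) ^ 2 := by gcongr; nlinarith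
    _ = (m : ℝ) ^ 4 := by ring
    _ ≤ _ := pow_le_pow_right₀ (by linarith) (by omega)

lemma m_pow_m1 {m : ℕ} (hm : 6 ≤ m) : 36 * (m : ℝ) ^ 3 ≤ (m : ℝ) ^ (m - 1) := by
  have := m_pow_m2 hm
  have hm' : (6 : ℝ) ≤ m := by exact_mod_cast hm
  have e : (m : ℝ) ^ (m - 1) = (m : ℝ) ^ (m - 2) * m := by
    rw [← pow_succ]; congr 1; omega
  rw [e]
  nlinarith

lemma two_pow_ge {m : ℕ} (hm : 6 ≤ m) : (32 / 3 : ℝ) * m ≤ 2 ^ m := by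
  induction m, hm using Nat.le_induction with
  | base => norm_num
  | succ n hn ih =>
    have : (6 : ℝ) ≤ n := by exact_mod_cast hn
    rw [pow_succ]; push_cast; linarith

namespace Cfg
variable {k l : ℕ} {V : Type*} [Fintype V] (C : Cfg k l V)

/-- large vertices -/
def X (v : V) : Prop := 1 / 2 ≤ C.rho v
/-- small vertices -/
def Y (v : V) : Prop := ¬ C.X v
/-- measure of the large vertices -/
noncomputable def al : ℝ := mu C.w C.X

lemma rhoX {x : V} (hx : C.X x) : 1 - 1 / ((k + l : ℕ) : ℝ) < C.rho x := by
  by_contra hcon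
  push Not at hcon
  have hm := C.hm
  have h6 := C.mm6
  set m : ℕ := k + l with hmdef
  unfold X at hx
  have hlag := C.lagrange' x
  have hsc : C.sc x / Gf k l ≤ C.rho x ^ m := by
    rw [div_le_iff₀ (Gf_pos k l), mul_comm]; exact C.sc_le' x
  set u := 1 - C.rho x with hu
  have hu1 : 1 / (m : ℝ) ≤ u := by linarith
  have hu2 : u ≤ 1 / 2 := by linarith
  have hr : C.rho x = 1 - u := by rw [hu]; ring
  rw [hr] at hsc hlag
  have hu0 : 0 ≤ u := le_trans (by positivity) hu1
  have h1 : (1 - u) * u ^ (m - 1) ≤ 1 / 4 * u ^ (m - 2) := by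
    rw [show m - 1 = (m - 2) + 1 by omega, pow_succ]
    have : 0 ≤ u ^ (m - 2) := by positivity
    nlinarith [sq_nonneg (u - 1 / 2)]
  obtain ⟨a, b, ha, hb, hab, hu3⟩ := conv_comb hu1 hu2
  have h2 : u ^ (m - 2) ≤ a * (1 / (m : ℝ)) ^ (m - 2) + b * (1 / 2) ^ (m - 2) := by
    conv_lhs => rw [hu3]
    exact pow_conv _ ha hb hab (by positivity) (by norm_num)
  have h3 : (1 - u) ^ m ≤ a * (1 - 1 / (m : ℝ)) ^ m + b * (1 / 2) ^ m := by
    have : 1 - u = a * (1 - 1 / (m : ℝ)) + b * (1 / 2) := by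
      rw [hu3]; linear_combination (-1 : ℝ) * hab
    rw [this]
    refine pow_conv _ ha hb hab ?_ (by norm_num)
    rw [sub_nonneg, div_le_one (by linarith)]; linarith
  have h4 := one_sub_inv_pow (m := m) (by omega)
  have he1 := e_lo
  have he2 := e_hi
  have hs := C.sg_ge'
  have hi1 := ie_lo
  have hi2 := ie_hi
  set e := Real.exp 1 with he
  set ie := 1 / e with hie
  have hme : 0 ≤ e * (m : ℝ) := by positivity
  have h5 : C.sg ≤ a * ((1 - 1 / (m : ℝ)) ^ m + e * m * (1 / 4) * (1 / (m : ℝ)) ^ (m - 2))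
      + b * ((1 / 2) ^ m + e * m * (1 / 4) * (1 / 2) ^ (m - 2)) := by
    have t1 := mul_le_mul_of_nonneg_left h1 hme
    have t2 := mul_le_mul_of_nonneg_left h2 (by positivity : 0 ≤ e * (m : ℝ) * (1 / 4))
    linarith
  have h6' : e * m * (1 / 4) * (1 / (m : ℝ)) ^ (m - 2) < ie * (1 / (2 * m + 1)) := by
    rw [div_pow, one_pow]
    have q := m_pow_m2 hm
    have qp : (0:ℝ) < 36 * (m : ℝ) ^ 2 := by positivity
    have : 1 / (m : ℝ) ^ (m - 2) ≤ 1 / (36 * (m : ℝ) ^ 2) := one_div_le_one_div_of_le qp q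
    calc e * m * (1 / 4) * (1 / (m : ℝ) ^ (m - 2)) ≤ e * m * (1 / 4) * (1 / (36 * (m : ℝ) ^ 2)) := by
          gcongr
      _ = e / (144 * m) := by field_simp; norm_num
      _ < 0.36 * (1 / (2 * m + 1)) := by
          rw [mul_one_div, div_lt_div_iff₀ (by positivity) (by positivity)]; nlinarith
      _ ≤ _ := by gcongr; linarith
  have h7 : (1 / 2 : ℝ) ^ m + e * m * (1 / 4) * (1 / 2) ^ (m - 2) < ie := by
    have : (1 / 2 : ℝ) ^ m = (1 / 2) ^ (m - 2) * (1 / 4) := by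
      conv_lhs => rw [show m = (m - 2) + 2 by omega, pow_add]
      norm_num
    have e2 : e * m * (1 / 4) * (1 / 2 : ℝ) ^ (m - 2) = e * m * (1/2)^m := by rw [this]; ring
    rw [e2, div_pow, one_pow]
    have q := two_pow_ge hm
    have qp : (0:ℝ) < 2 ^ m := by positivity
    have : (1 + e * m) * (1 / 2 ^ m) < ie := by
      rw [mul_one_div, div_lt_iff₀ qp]
      nlinarith
    linarith
  have h8 : C.sg < ie := by
    have t1 : (1 - 1 / (m : ℝ)) ^ m + e * m * (1 / 4) * (1 / (m : ℝ)) ^ (m - 2) < ie := by linarith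
    rcases ha.eq_or_lt with h | h
    · have hb1 : b = 1 := by linarith
      rw [← h, hb1] at h5; linarith
    · have := mul_lt_mul_of_pos_left t1 h
      have := mul_le_mul_of_nonneg_left h7.le hb
      nlinarith
  linarith

lemma nadjX {x : V} (hx : C.X x) : mu C.w (fun u => ¬ adj C.A x u) ≤ 1 / ((k + l : ℕ) : ℝ) := by
  have h1 := C.rhoX hx
  have h2 := C.mu_add_not (adj C.A x)
  unfold rho at h1
  linarith

lemma sc_X {x : V} (hx : C.X x) :
    Gf k l * (C.sg - Real.exp 1 / ((k + l : ℕ) : ℝ) ^ (k + l - 2)) ≤ C.sc x := by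
  have h1 := C.rhoX hx
  have hm := C.hm
  have h6 := C.mm6
  have hlag := C.lagrange' x
  have hr1 := C.rho_le x
  have hr0 := C.rho_nn x
  set m : ℕ := k + l with hmdef
  have h2 : C.rho x * (1 - C.rho x) ^ (m - 1) ≤ 1 * (1 / (m:ℝ)) ^ (m - 1) := by
    gcongr
    linarith
  have h3 : Real.exp 1 * (m:ℝ) * (1 * (1 / (m:ℝ)) ^ (m - 1)) = Real.exp 1 / (m:ℝ) ^ (m - 2) := by
    rw [show m - 1 = (m - 2) + 1 by omega, div_pow, one_pow, pow_succ]; field_simp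
  have h4 : Real.exp 1 * (m:ℝ) * (C.rho x * (1 - C.rho x) ^ (m - 1)) ≤ Real.exp 1 / (m:ℝ) ^ (m - 2) := by
    rw [← h3]; exact mul_le_mul_of_nonneg_left h2 (by positivity)
  have h5 : C.sg - Real.exp 1 / (m:ℝ) ^ (m - 2) ≤ C.sc x / Gf k l := by linarith
  rw [le_div_iff₀ (Gf_pos k l)] at h5
  linarith

lemma tau1 (C : Cfg k l V) : Real.exp 1 / ((k + l : ℕ) : ℝ) ^ (k + l - 2) ≤
    0.0756 / ((k + l : ℕ) : ℝ) ^ 2 := by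
  have h6 := C.mm6
  have q := m_pow_m2 C.hm
  have := e_hi
  rw [div_le_div_iff₀ (by positivity) (by positivity)]
  nlinarith [sq_nonneg ((k + l : ℕ) : ℝ)]

lemma tau2 (C : Cfg k l V) : Real.exp 1 / ((k + l : ℕ) : ℝ) ^ (k + l - 1) ≤
    0.0756 / ((k + l : ℕ) : ℝ) ^ 3 := by
  have h6 := C.mm6
  have q := m_pow_m1 C.hm
  have := e_hi
  have h3 : 0 ≤ ((k + l : ℕ) : ℝ) ^ 3 := by positivity
  rw [div_le_div_iff₀ (by positivity) (by positivity)]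
  nlinarith

open scoped Classical in
lemma al_mul : C.al * (C.sg - Real.exp 1 / ((k + l : ℕ) : ℝ) ^ (k + l - 2)) * (((k + l : ℕ) : ℝ) + 1) ≤ C.sg := by
  set τ := Real.exp 1 / ((k + l : ℕ) : ℝ) ^ (k + l - 2)
  have h : C.al * (Gf k l * (C.sg - τ)) ≤ C.t := by
    rw [t_eq]
    unfold al mu
    rw [Finset.sum_mul]
    refine Finset.sum_le_sum fun v _ => ?_
    split_ifs with hv
    · exact mul_le_mul_of_nonneg_left (C.sc_X hv) (C.w0 v)
    · rw [zero_mul]; exact mul_nonneg (C.w0 v) (C.sc_nonneg v)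
  have h2 := C.t_sg
  have hp := Gf_pos k l
  have h0 : (0:ℝ) ≤ ((k + l : ℕ) : ℝ) + 1 := by positivity
  have h3 := mul_le_mul_of_nonneg_left h h0
  rw [h2] at h3
  have : Gf k l * (C.al * (C.sg - τ) * (((k + l : ℕ) : ℝ) + 1)) ≤ Gf k l * C.sg := by linarith
  exact le_of_mul_le_mul_left this hp

lemma al_nn : 0 ≤ C.al := C.mu_nn _

lemma al_le : C.al ≤ 1.01 / (((k + l : ℕ) : ℝ) + 1) := by
  have h := C.al_mul
  have h1 := C.tau1
  have h6 := C.mm6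
  have hs := C.sg_ge'
  have := ie_lo
  have ha := C.al_nn
  set τ := Real.exp 1 / ((k + l : ℕ) : ℝ) ^ (k + l - 2)
  set m : ℝ := ((k + l : ℕ) : ℝ)
  have h2 : τ ≤ 0.0021 := h1.trans (by rw [div_le_iff₀ (by positivity)]; nlinarith)
  rw [le_div_iff₀ (by positivity)]
  have h3 : (C.al * (m + 1)) * (C.sg - 0.0021) ≤ C.sg := by
    have : C.al * (m+1) * (C.sg - 0.0021) ≤ C.al * (m+1) * (C.sg - τ) := by gcongr
    linarith
  have h4 : 0 < C.sg - 0.0021 := by linarith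
  by_contra hc
  push Not at hc
  have := mul_lt_mul_of_pos_right hc h4
  linarith

lemma al_le' : C.al ≤ 1 / ((k + l : ℕ) : ℝ) := by
  have h := C.al_mul
  have h1 := C.tau1
  have h6 := C.mm6
  have hs := C.sg_ge'
  have := ie_lo
  have ha := C.al_nn
  set τ := Real.exp 1 / ((k + l : ℕ) : ℝ) ^ (k + l - 2)
  set m : ℝ := ((k + l : ℕ) : ℝ)
  have h2 : τ * (m + 1) ≤ C.sg := by
    have : 0.0756 / m ^ 2 * (m + 1) ≤ 0.36 := by
      rw [div_mul_eq_mul_div, div_le_iff₀ (by positivity)]; nlinarith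
    have : τ * (m + 1) ≤ 0.0756 / m ^ 2 * (m + 1) := by gcongr
    linarith
  rw [le_div_iff₀ (by positivity)]
  by_contra hc
  push Not at hc
  have hs0 : 0 < C.sg := by linarith
  have h3 : C.al * (C.sg * m) ≤ C.al * ((C.sg - τ) * (m + 1)) := by
    refine mul_le_mul_of_nonneg_left ?_ ha
    nlinarith
  nlinarith

lemma rhoY {y : V} (hy : C.Y y) : C.rho y < 1 / 2 := not_le.1 hy

lemma mu_Y : mu C.w C.Y = 1 - C.al := by
  have := C.mu_add_not C.X
  unfold al
  have h2 : mu C.w C.Y = mu C.w (fun u => ¬ C.X u) := rfl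
  linarith

open scoped Classical in
/-- general lower bound for `al` from a bound on the degrees in `Y` -/
lemma al_lower {r : ℝ} (hr : ∀ y, C.Y y → C.rho y ≤ r) :
    (1 - C.al) * (C.sg - r ^ (k + l)) * (((k + l : ℕ) : ℝ) + 1) ≤ ((k + l : ℕ) : ℝ) * C.sg := by
  have h1 : (1 - C.al) * (C.sg * Gf k l) ≤ (1 - C.al) * (Gf k l * r ^ (k + l)) + ((k + l : ℕ) : ℝ) * C.t := by
    rw [← C.sum_M, ← C.mu_Y]
    unfold mu
    rw [Finset.sum_mul, Finset.sum_mul, ← Finset.sum_add_distrib]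
    refine Finset.sum_le_sum fun v _ => ?_
    split_ifs with hv
    · have h1 := C.lagrange v
      rw [C.t_sg] at h1
      have h2 := C.sc_le' v
      have h3 : C.rho v ^ (k + l) ≤ r ^ (k + l) := pow_le_pow_left₀ (C.rho_nn v) (hr v hv) _
      have h4 := mul_le_mul_of_nonneg_left h3 (Gf_nonneg k l)
      have h5 := mul_le_mul_of_nonneg_left (h2.trans h4) (C.w0 v)
      linarith
    · have := C.M_nonneg v; linarith
  have h2 := C.t_sg
  have hp := Gf_pos k l
  set m : ℝ := ((k + l : ℕ) : ℝ)
  have h0 : (0:ℝ) ≤ m + 1 := by positivity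
  have h3 := mul_le_mul_of_nonneg_left h1 h0
  have : Gf k l * ((1 - C.al) * (C.sg - r ^ (k + l)) * (m + 1)) ≤ Gf k l * (m * C.sg) := by
    have : (m + 1) * (m * C.t) = m * (C.sg * Gf k l) := by rw [← h2]; ring
    nlinarith
  exact le_of_mul_le_mul_left this hp

lemma al_ge : 2 / (3 * (((k + l : ℕ) : ℝ) + 1)) ≤ C.al := by
  have h := C.al_lower (r := 1 / 2) (fun y hy => (C.rhoY hy).le)
  have h6 := C.mm6
  have hs := C.sg_ge'
  have hi := ie_lo
  have q := two_pow_ge C.hm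
  have ha := C.al_le'
  have ha0 := C.al_nn
  set m : ℝ := ((k + l : ℕ) : ℝ)
  rw [div_pow, one_pow] at h
  have q2 : (m + 1) * (1 / 2 ^ (k + l)) ≤ 7 / 64 := by
    rw [mul_one_div, div_le_div_iff₀ (by positivity) (by norm_num)]; nlinarith
  set z : ℝ := 1 / 2 ^ (k + l)
  have hz : 0 ≤ z := by positivity
  rw [div_le_iff₀ (by positivity)]
  have : (1 - C.al) * (C.sg * (m + 1) - 7 / 64) ≤ m * C.sg := by
    have : (1 - C.al) * (C.sg * (m + 1) - 7 / 64) ≤ (1 - C.al) * (C.sg * (m + 1) - (m+1) * z) := by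
      have h1 : C.al ≤ 1 := C.mu_le_one _
      apply mul_le_mul_of_nonneg_left _ (by linarith); linarith
    linarith
  -- sg (1 - al (m+1)) ≤ 7/64
  have h9 : C.sg * (1 - C.al * (m + 1)) ≤ 7 / 64 := by nlinarith
  by_contra hc
  push Not at hc
  have : C.sg * (1/3) ≤ C.sg * (1 - C.al * (m + 1)) :=
    mul_le_mul_of_nonneg_left (by linarith) (by linarith)
  linarith

lemma al_pos : 0 < C.al := lt_of_lt_of_le (by positivity) C.al_ge

open scoped Classical in
lemma CgenK {K : ℝ} (hKo : (k:ℝ) * Gf (k - 1) l ≤ K) (hKi : (l:ℝ) * Gf k (l - 1) ≤ K) (c : V) (R : (Fin (k + l) → V) → Prop) (S : V → Prop) (B : V → V → Prop)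
    (hR : ∀ f, R f → star k l C.A c f)
    (hB : ∀ j f, R f → S (f j) → ∀ i, i ≠ j → B (f j) (f i)) :
    ∑ j, Lf C.w (fun f => R f ∧ S (f j)) ≤
      K *
        ∑ x, if S x ∧ adj C.A c x then C.w x *
          mu C.w (fun u => adj C.A c u ∧ ¬ adj C.A x u ∧ B x u) ^ (k + l - 1) else 0 := by
  set s : V → ℝ := fun x => mu C.w (fun u => adj C.A c u ∧ ¬ adj C.A x u ∧ B x u) with hs
  have h1 : ∀ j, Lf C.w (fun f => R f ∧ S (f j)) ≤
      ∑ x, if S x ∧ ((lab k l j ∧ C.A c x) ∨ (¬ lab k l j ∧ C.A x c)) then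
        C.w x * (gj k l j * s x ^ (k + l - 1)) else 0 := by
    intro j
    refine Lf_lab_one (w := C.w) C.w0 (R := fun f => R f ∧ S (f j)) j
      (S := fun x => S x ∧ ((lab k l j ∧ C.A c x) ∨ (¬ lab k l j ∧ C.A x c)))
      (Up := fun x u => C.A c u ∧ ¬ adj C.A x u ∧ B x u)
      (Uq := fun x u => C.A u c ∧ ¬ adj C.A x u ∧ B x u)
      (s := s) ?_ ?_
    · rintro f ⟨hf, hv⟩
      have hst := hR f hf
      refine ⟨⟨hv, ?_⟩, ?_⟩
      · by_cases hj : lab k l j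
        · left; exact ⟨hj, (hst.1 j).1 hj⟩
        · right; exact ⟨hj, (hst.1 j).2 hj⟩
      · intro i hi
        have h3 : ¬ adj C.A (f j) (f i) := C.star_nadj hst j i
        exact ⟨fun h => ⟨(hst.1 i).1 h, h3, hB j f hf hv i hi⟩,
          fun h => ⟨(hst.1 i).2 h, h3, hB j f hf hv i hi⟩⟩
    · intro x _
      exact C.mu_AA c _
  refine (Finset.sum_le_sum fun j _ => h1 j).trans ?_
  rw [Finset.sum_comm, Finset.mul_sum]
  refine Finset.sum_le_sum fun x _ => ?_
  have hs0 : 0 ≤ s x := C.mu_nn _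
  have hwx := C.w0 x
  by_cases hz : S x
  swap
  · simp [hz]
  by_cases ha : C.A c x
  · have ha' : ¬ C.A x c := C.asym _ _ ha
    have e1 : ∀ j, (if S x ∧ ((lab k l j ∧ C.A c x) ∨ (¬ lab k l j ∧ C.A x c)) then
        C.w x * (gj k l j * s x ^ (k + l - 1)) else 0) =
        if lab k l j then C.w x * (Gf (k - 1) l * s x ^ (k + l - 1)) else 0 := by
      intro j; by_cases hj : lab k l j <;> simp [hz, ha, ha', hj, gj]
    simp_rw [e1]
    rw [sum_lab]
    have h4 := hKo
    rw [if_pos ⟨hz, Or.inl ha⟩]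
    have h5 : 0 ≤ C.w x * s x ^ (k + l - 1) := by positivity
    have := mul_le_mul_of_nonneg_right h4 h5
    calc _ = (k : ℝ) * Gf (k - 1) l * (C.w x * s x ^ (k + l - 1)) := by ring
      _ ≤ _ := this
  · by_cases hb : C.A x c
    · have e1 : ∀ j, (if S x ∧ ((lab k l j ∧ C.A c x) ∨ (¬ lab k l j ∧ C.A x c)) then
          C.w x * (gj k l j * s x ^ (k + l - 1)) else 0) =
          if lab k l j then 0 else C.w x * (Gf k (l - 1) * s x ^ (k + l - 1)) := by
        intro j; by_cases hj : lab k l j <;> simp [hz, ha, hb, hj, gj]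
      simp_rw [e1]
      rw [sum_lab]
      have h4 := hKi
      rw [if_pos ⟨hz, Or.inr hb⟩]
      have h5 : 0 ≤ C.w x * s x ^ (k + l - 1) := by positivity
      have := mul_le_mul_of_nonneg_right h4 h5
      calc _ = (l : ℝ) * Gf k (l - 1) * (C.w x * s x ^ (k + l - 1)) := by ring
        _ ≤ _ := this
    · simp [adj, ha, hb]

open scoped Classical in
lemma Cgen (c : V) (R : (Fin (k + l) → V) → Prop) (S : V → Prop) (B : V → V → Prop)
    (hR : ∀ f, R f → star k l C.A c f)
    (hB : ∀ j f, R f → S (f j) → ∀ i, i ≠ j → B (f j) (f i)) :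
    ∑ j, Lf C.w (fun f => R f ∧ S (f j)) ≤
      (Real.exp 1 * ((k + l : ℕ) : ℝ) * Gf k l) *
        ∑ x, if S x ∧ adj C.A c x then C.w x *
          mu C.w (fun u => adj C.A c u ∧ ¬ adj C.A x u ∧ B x u) ^ (k + l - 1) else 0 :=
  C.CgenK (Gf_stepo C.hk) (Gf_stepi C.hl) c R S B hR hB

/-- out-degree into `Y` -/
noncomputable def PP (x : V) : ℝ := mu C.w (fun u => C.A x u ∧ C.Y u)
/-- in-degree from `Y` -/
noncomputable def QQ (x : V) : ℝ := mu C.w (fun u => C.A u x ∧ C.Y u)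
/-- measure of `Y` missed by `x` -/
noncomputable def miss (x : V) : ℝ := mu C.w (fun u => C.Y u ∧ ¬ adj C.A x u)

lemma PP_nn (x : V) : 0 ≤ C.PP x := C.mu_nn _
lemma QQ_nn (x : V) : 0 ≤ C.QQ x := C.mu_nn _
lemma miss_nn (x : V) : 0 ≤ C.miss x := C.mu_nn _

lemma PQm (x : V) : C.PP x + C.QQ x + C.miss x = 1 - C.al := by
  rw [← C.mu_Y, mu_split C.Y (adj C.A x), mu_split (fun u => C.Y u ∧ adj C.A x u) (fun u => C.A x u)]
  unfold PP QQ miss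
  congr 2
  · exact mu_congr fun u => by unfold adj; tauto
  · refine mu_congr fun u => ?_
    have := C.asym x u
    unfold adj; tauto

lemma PQ_ge' {x : V} (hx : C.X x) :
    Gf k l * (C.sg - Real.exp 1 / ((k + l : ℕ) : ℝ) ^ (k + l - 2)
      - Real.exp 1 / ((k + l : ℕ) : ℝ) ^ (k + l - 1)) ≤ C.PP x ^ k * C.QQ x ^ l := by
  classical
  have h1 := C.sc_X hx
  have hm := C.hm
  have h6 := C.mm6
  have hG := Gf_pos k l
  have hal := C.al_le'
  have hal0 := C.al_nn
  have h2 : C.sc x ≤ C.PP x ^ k * C.QQ x ^ l + ∑ j, Lf C.w (fun f => star k l C.A x f ∧ C.X (f j)) := by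
    unfold sc
    rw [Lf_split _ (fun f => ∀ i, C.Y (f i))]
    refine add_le_add ?_ ?_
    · exact Lf_lab C.w0 fun f hf i => ⟨fun hi => ⟨(hf.1.1 i).1 hi, hf.2 i⟩,
        fun hi => ⟨(hf.1.1 i).2 hi, hf.2 i⟩⟩
    · refine Lf_union C.w0 univ ?_
      rintro f ⟨hf, hn⟩
      push Not at hn
      obtain ⟨i, hi⟩ := hn
      exact ⟨i, mem_univ _, hf, not_not.1 hi⟩
  have h3 := C.Cgen x (star k l C.A x) C.X (fun _ _ => True) (fun _ h => h) (by simp)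
  set m : ℕ := k + l with hmdef
  have h4 : (∑ x', if C.X x' ∧ adj C.A x x' then C.w x' *
          mu C.w (fun u => adj C.A x u ∧ ¬ adj C.A x' u ∧ True) ^ (m - 1) else 0)
      ≤ C.al * (1 / (m:ℝ)) ^ (m - 1) := by
    unfold al mu
    rw [Finset.sum_mul]
    refine Finset.sum_le_sum fun x' _ => ?_
    have hp : (0:ℝ) ≤ (1 / (m:ℝ)) ^ (m - 1) := by positivity
    by_cases hX : C.X x'
    · rw [if_pos hX]
      split_ifs
      · refine mul_le_mul_of_nonneg_left ?_ (C.w0 _)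
        refine pow_le_pow_left₀ (C.mu_nn _) ?_ _
        exact (mu_mono C.w0 (by tauto)).trans (C.nadjX hX)
      · exact mul_nonneg (C.w0 _) hp
    · rw [if_neg hX, if_neg (by tauto), zero_mul]
  have h5 : (Real.exp 1 * (m : ℝ) * Gf k l) * (C.al * (1 / (m:ℝ)) ^ (m - 1))
      ≤ (Real.exp 1 * (m : ℝ) * Gf k l) * (1 / (m:ℝ) * (1 / (m:ℝ)) ^ (m - 1)) := by gcongr
  have h6 : (Real.exp 1 * (m : ℝ) * Gf k l) * (1 / (m:ℝ) * (1 / (m:ℝ)) ^ (m - 1))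
      = Gf k l * (Real.exp 1 / (m:ℝ) ^ (m - 1)) := by
    rw [div_pow, one_pow]; field_simp
  have h7 := mul_le_mul_of_nonneg_left h4 (by positivity : 0 ≤ Real.exp 1 * (m : ℝ) * Gf k l)
  have := h3.trans h7
  linarith

lemma PQ_ge {x : V} (hx : C.X x) : 0.36 * Gf k l ≤ C.PP x ^ k * C.QQ x ^ l := by
  refine le_trans ?_ (C.PQ_ge' hx)
  rw [mul_comm]
  refine mul_le_mul_of_nonneg_left ?_ (Gf_nonneg k l)
  have h1 := C.tau1
  have h2 := C.tau2
  have hs := C.sg_ge'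
  have hi := ie_lo
  have h6 := C.mm6
  have h3 : 0.0756 / ((k + l : ℕ) : ℝ) ^ 2 ≤ 0.0021 := by
    rw [div_le_iff₀ (by positivity)]; nlinarith
  have h4 : 0.0756 / ((k + l : ℕ) : ℝ) ^ 3 ≤ 0.0021 := by
    rw [div_le_iff₀ (by positivity)]
    have : (216:ℝ) ≤ ((k + l : ℕ) : ℝ) ^ 3 := by
      calc (216:ℝ) = 6 ^ 3 := by norm_num
        _ ≤ _ := by gcongr
    linarith
  linarith

end Cfg
end OStar

namespace OStar
open Finset

open scoped Classical in
/-- measure of a set of ordered pairs -/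
noncomputable def mu2 {V : Type*} [Fintype V] (w : V → ℝ) (S : V → V → Prop) : ℝ :=
  ∑ u, ∑ v, if S u v then w u * w v else 0

section mu2
variable {V : Type*} [Fintype V] {w : V → ℝ}

lemma mu2_nonneg (hw : ∀ v, 0 ≤ w v) (S : V → V → Prop) : 0 ≤ mu2 w S := by
  classical
  refine Finset.sum_nonneg fun u _ => Finset.sum_nonneg fun v _ => ?_
  have := mul_nonneg (hw u) (hw v)
  split_ifs <;> simp [this]

lemma mu2_mono (hw : ∀ v, 0 ≤ w v) {S S' : V → V → Prop} (h : ∀ u v, S u v → S' u v) :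
    mu2 w S ≤ mu2 w S' := by
  classical
  refine Finset.sum_le_sum fun u _ => Finset.sum_le_sum fun v _ => ?_
  have := mul_nonneg (hw u) (hw v)
  by_cases h1 : S u v
  · simp [h1, h u v h1]
  · simp only [h1, if_false]; split_ifs <;> simp [this]

lemma mu2_congr {S S' : V → V → Prop} (h : ∀ u v, S u v ↔ S' u v) : mu2 w S = mu2 w S' := by
  have : S = S' := funext fun u => funext fun v => propext (h u v)
  rw [this]

lemma mu2_split (S R : V → V → Prop) :
    mu2 w S = mu2 w (fun u v => S u v ∧ R u v) + mu2 w (fun u v => S u v ∧ ¬ R u v) := by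
  classical
  unfold mu2
  rw [← Finset.sum_add_distrib]
  refine Finset.sum_congr rfl fun u _ => ?_
  rw [← Finset.sum_add_distrib]
  refine Finset.sum_congr rfl fun v _ => ?_
  by_cases h1 : S u v <;> by_cases h2 : R u v <;> simp [h1, h2]

lemma mu2_swap (S : V → V → Prop) : mu2 w S = mu2 w (fun u v => S v u) := by
  classical
  unfold mu2
  rw [Finset.sum_comm]
  refine Finset.sum_congr rfl fun u _ => Finset.sum_congr rfl fun v _ => ?_
  simp only [mul_comm]

lemma mu2_union (hw : ∀ v, 0 ≤ w v) {S R R' : V → V → Prop} (h : ∀ u v, S u v → R u v ∨ R' u v) :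
    mu2 w S ≤ mu2 w R + mu2 w R' := by
  rw [mu2_split S R]
  refine add_le_add (mu2_mono hw (by tauto)) (mu2_mono hw fun u v h1 => ?_)
  rcases h u v h1.1 with h2 | h2
  · exact absurd h2 h1.2
  · exact h2

lemma mu2_prod (S R : V → Prop) : mu2 w (fun u v => S u ∧ R v) = mu w S * mu w R := by
  classical
  unfold mu2 mu
  rw [Finset.sum_mul_sum]
  refine Finset.sum_congr rfl fun u _ => Finset.sum_congr rfl fun v _ => ?_
  by_cases h1 : S u <;> by_cases h2 : R v <;> simp [h1, h2]

open scoped Classical in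
lemma mu2_fst (S : V → Prop) (R : V → V → Prop) :
    mu2 w (fun u v => S u ∧ R u v) = ∑ u, if S u then w u * mu w (R u) else 0 := by
  unfold mu2 mu
  refine Finset.sum_congr rfl fun u _ => ?_
  by_cases h1 : S u
  · simp only [h1, true_and, if_true, Finset.mul_sum]
    refine Finset.sum_congr rfl fun v _ => ?_
    split_ifs <;> simp
  · simp [h1]

lemma mu2_fst_le (hw : ∀ v, 0 ≤ w v) (S : V → Prop) (R : V → V → Prop) {b : ℝ}
    (h : ∀ u, S u → mu w (R u) ≤ b) : mu2 w (fun u v => S u ∧ R u v) ≤ b * mu w S := by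
  classical
  rw [mu2_fst]; unfold mu; rw [Finset.mul_sum]
  refine Finset.sum_le_sum fun u _ => ?_
  split_ifs with h1
  · rw [mul_comm]; exact mul_le_mul_of_nonneg_right (h u h1) (hw u)
  · simp

end mu2

section pat
variable {k l : ℕ} {V : Type*} [Fintype V] {w : V → ℝ}

lemma pat_two (hw : ∀ v, 0 ≤ w v) {R : (Fin (k + l) → V) → Prop} {Sp Sq : V → Prop}
    {T : V → V → Prop} (a b : Fin (k + l)) (hab : a ≠ b)
    (h : ∀ f, R f → (∀ i, (lab k l i → Sp (f i)) ∧ (¬ lab k l i → Sq (f i))) ∧ T (f a) (f b)) :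
    Lf w R * ((if lab k l a then mu w Sp else mu w Sq) * (if lab k l b then mu w Sp else mu w Sq)) ≤
      mu2 w (fun u v => ((lab k l a → Sp u) ∧ (¬ lab k l a → Sq u)) ∧
        ((lab k l b → Sp v) ∧ (¬ lab k l b → Sq v)) ∧ T u v) * (mu w Sp ^ k * mu w Sq ^ l) := by
  classical
  have h1 := Lf_two hw (R := R) a b hab
    (S := fun u v => ((lab k l a → Sp u) ∧ (¬ lab k l a → Sq u)) ∧
        ((lab k l b → Sp v) ∧ (¬ lab k l b → Sq v)) ∧ T u v)
    (U := fun _ _ i v => (lab k l i → Sp v) ∧ (¬ lab k l i → Sq v))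
    (fun f hf => ⟨⟨(h f hf).1 a, (h f hf).1 b, (h f hf).2⟩, fun i _ _ => (h f hf).1 i⟩)
  set p := mu w Sp with hp
  set q := mu w Sq with hq
  have hp0 : 0 ≤ p := mu_nonneg hw _
  have hq0 : 0 ≤ q := mu_nonneg hw _
  have e1 : ∀ i : Fin (k + l), mu w (fun v => (lab k l i → Sp v) ∧ (¬ lab k l i → Sq v)) =
      if lab k l i then p else q := by
    intro i; by_cases hi : lab k l i <;> simp [hi, hp, hq]
  set pr : ℝ := ∏ i ∈ (univ.erase a).erase b, (if lab k l i then p else q) with hpr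
  have e2 : Lf w R ≤ mu2 w (fun u v => ((lab k l a → Sp u) ∧ (¬ lab k l a → Sq u)) ∧
        ((lab k l b → Sp v) ∧ (¬ lab k l b → Sq v)) ∧ T u v) * pr := by
    refine h1.trans (le_of_eq ?_)
    unfold mu2
    rw [Finset.sum_mul]
    refine Finset.sum_congr rfl fun u _ => ?_
    rw [Finset.sum_mul]
    refine Finset.sum_congr rfl fun v _ => ?_
    rw [Finset.prod_congr rfl fun i _ => e1 i, ← hpr]
    split_ifs <;> simp
  have hb : b ∈ univ.erase a := by simp [hab.symm]
  have e3 : (if lab k l a then p else q) * ((if lab k l b then p else q) * pr) = p ^ k * q ^ l := by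
    rw [← prod_lab, ← Finset.mul_prod_erase univ _ (Finset.mem_univ a),
      ← Finset.mul_prod_erase _ _ hb]
  have e4 : 0 ≤ (if lab k l a then p else q) * (if lab k l b then p else q) := by
    split_ifs <;> positivity
  have := mul_le_mul_of_nonneg_right e2 e4
  refine this.trans (le_of_eq ?_)
  rw [← e3]; ring

lemma pat_pp (hk : 2 ≤ k) (hw : ∀ v, 0 ≤ w v) {R : (Fin (k + l) → V) → Prop} {Sp Sq : V → Prop}
    {T : V → V → Prop}
    (h : ∀ f, R f → (∀ i, (lab k l i → Sp (f i)) ∧ (¬ lab k l i → Sq (f i))) ∧ ∀ i j, T (f i) (f j)) :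
    Lf w R * (mu w Sp * mu w Sp) ≤
      mu2 w (fun u v => Sp u ∧ Sp v ∧ T u v) * (mu w Sp ^ k * mu w Sq ^ l) := by
  have := pat_two (T := T) hw (R := R) (Sp := Sp) (Sq := Sq) ⟨0, by omega⟩ ⟨1, by omega⟩ (by simp)
    (fun f hf => ⟨(h f hf).1, (h f hf).2 _ _⟩)
  have h0 : lab k l ⟨0, by omega⟩ := by show 0 < k; omega
  have h1 : lab k l ⟨1, by omega⟩ := by show 1 < k; omega
  simpa [h0, h1] using this

lemma pat_pq (hk : 1 ≤ k) (hl : 1 ≤ l) (hw : ∀ v, 0 ≤ w v) {R : (Fin (k + l) → V) → Prop}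
    {Sp Sq : V → Prop} {T : V → V → Prop}
    (h : ∀ f, R f → (∀ i, (lab k l i → Sp (f i)) ∧ (¬ lab k l i → Sq (f i))) ∧ ∀ i j, T (f i) (f j)) :
    Lf w R * (mu w Sp * mu w Sq) ≤
      mu2 w (fun u v => Sp u ∧ Sq v ∧ T u v) * (mu w Sp ^ k * mu w Sq ^ l) := by
  have := pat_two (T := T) hw (R := R) (Sp := Sp) (Sq := Sq) ⟨0, by omega⟩ ⟨k, by omega⟩
    (by simp; omega) (fun f hf => ⟨(h f hf).1, (h f hf).2 _ _⟩)
  have h0 : lab k l ⟨0, by omega⟩ := by show 0 < k; omega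
  have h1 : ¬ lab k l ⟨k, by omega⟩ := by show ¬ k < k; omega
  simpa [h0, h1] using this

lemma pat_qq (hl : 2 ≤ l) (hw : ∀ v, 0 ≤ w v) {R : (Fin (k + l) → V) → Prop}
    {Sp Sq : V → Prop} {T : V → V → Prop}
    (h : ∀ f, R f → (∀ i, (lab k l i → Sp (f i)) ∧ (¬ lab k l i → Sq (f i))) ∧ ∀ i j, T (f i) (f j)) :
    Lf w R * (mu w Sq * mu w Sq) ≤
      mu2 w (fun u v => Sq u ∧ Sq v ∧ T u v) * (mu w Sp ^ k * mu w Sq ^ l) := by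
  have := pat_two (T := T) hw (R := R) (Sp := Sp) (Sq := Sq) ⟨k, by omega⟩ ⟨k + 1, by omega⟩
    (by simp) (fun f hf => ⟨(h f hf).1, (h f hf).2 _ _⟩)
  have h0 : ¬ lab k l ⟨k, by omega⟩ := by show ¬ k < k; omega
  have h1 : ¬ lab k l ⟨k + 1, by omega⟩ := by show ¬ k + 1 < k; omega
  simpa [h0, h1] using this

end pat

namespace Cfg
variable {k l : ℕ} {V : Type*} [Fintype V] (C : Cfg k l V)

/-- stars with all leaves in `X` -/
noncomputable def T1 : ℝ := ∑ c, C.w c * Lf C.w (fun f => star k l C.A c f ∧ ∀ i, C.X (f i))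
/-- stars with mixed leaves -/
noncomputable def T2 : ℝ := ∑ c, C.w c *
  Lf C.w (fun f => star k l C.A c f ∧ (∃ i, C.X (f i)) ∧ ∃ j, C.Y (f j))
/-- stars at `x` with leaves in `Y` -/
noncomputable def AA (x : V) : ℝ := Lf C.w (fun f => star k l C.A x f ∧ ∀ i, C.Y (f i))

open scoped Classical in
/-- weighted sum over `X` -/
noncomputable def SX (g : V → ℝ) : ℝ := ∑ x, if C.X x then C.w x * g x else 0
open scoped Classical in
/-- weighted sum over `Y` -/
noncomputable def SY (g : V → ℝ) : ℝ := ∑ x, if C.Y x then C.w x * g x else 0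

lemma SX_mono {g h : V → ℝ} (H : ∀ x, C.X x → g x ≤ h x) : C.SX g ≤ C.SX h := by
  classical
  refine Finset.sum_le_sum fun x _ => ?_
  split_ifs with h1
  · exact mul_le_mul_of_nonneg_left (H x h1) (C.w0 x)
  · exact le_rfl

lemma SY_mono {g h : V → ℝ} (H : ∀ x, C.Y x → g x ≤ h x) : C.SY g ≤ C.SY h := by
  classical
  refine Finset.sum_le_sum fun x _ => ?_
  split_ifs with h1
  · exact mul_le_mul_of_nonneg_left (H x h1) (C.w0 x)
  · exact le_rfl

lemma SX_add (g h : V → ℝ) : C.SX (fun x => g x + h x) = C.SX g + C.SX h := by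
  classical
  unfold SX; rw [← Finset.sum_add_distrib]
  refine Finset.sum_congr rfl fun x _ => ?_
  split_ifs <;> ring

lemma SY_add (g h : V → ℝ) : C.SY (fun x => g x + h x) = C.SY g + C.SY h := by
  classical
  unfold SY; rw [← Finset.sum_add_distrib]
  refine Finset.sum_congr rfl fun x _ => ?_
  split_ifs <;> ring

lemma SX_smul (a : ℝ) (g : V → ℝ) : C.SX (fun x => a * g x) = a * C.SX g := by
  classical
  unfold SX; rw [Finset.mul_sum]
  refine Finset.sum_congr rfl fun x _ => ?_
  split_ifs <;> ring

lemma SY_smul (a : ℝ) (g : V → ℝ) : C.SY (fun x => a * g x) = a * C.SY g := by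
  classical
  unfold SY; rw [Finset.mul_sum]
  refine Finset.sum_congr rfl fun x _ => ?_
  split_ifs <;> ring

lemma SX_const (a : ℝ) : C.SX (fun _ => a) = C.al * a := by
  classical
  unfold SX al mu; rw [Finset.sum_mul]
  refine Finset.sum_congr rfl fun x _ => ?_
  split_ifs <;> ring

lemma SY_const (a : ℝ) : C.SY (fun _ => a) = (1 - C.al) * a := by
  classical
  rw [← C.mu_Y]
  unfold SY mu; rw [Finset.sum_mul]
  refine Finset.sum_congr rfl fun x _ => ?_
  split_ifs <;> ring

lemma SX_nn {g : V → ℝ} (H : ∀ x, C.X x → 0 ≤ g x) : 0 ≤ C.SX g := by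
  have := C.SX_mono (g := fun _ => 0) H
  rwa [SX_const, mul_zero] at this

lemma sum_XY (g : V → ℝ) : ∑ v, C.w v * g v = C.SX g + C.SY g := by
  classical
  unfold SX SY Y
  rw [← Finset.sum_add_distrib]
  refine Finset.sum_congr rfl fun x _ => ?_
  by_cases h : C.X x <;> simp [h]

lemma t_split : C.t ≤ C.T1 + C.T2 + (C.SX C.AA + C.SY C.AA) := by
  rw [← C.sum_XY, t_eq]
  unfold T1 T2 AA
  rw [← Finset.sum_add_distrib, ← Finset.sum_add_distrib]
  refine Finset.sum_le_sum fun c _ => ?_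
  rw [← mul_add, ← mul_add]
  refine mul_le_mul_of_nonneg_left ?_ (C.w0 c)
  unfold sc
  rw [Lf_split _ (fun f => ∀ i, C.X (f i)), Lf_split (fun f => star k l C.A c f ∧ ¬ ∀ i, C.X (f i))
    (fun f => ∃ i, C.X (f i)), ← add_assoc]
  refine add_le_add (add_le_add le_rfl (Lf_mono C.w0 ?_)) (Lf_mono C.w0 ?_)
  · rintro f ⟨⟨h1, h2⟩, h3⟩
    push Not at h2
    exact ⟨h1, h3, h2⟩
  · rintro f ⟨⟨h1, h2⟩, h3⟩
    push Not at h3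
    exact ⟨h1, h3⟩

lemma Gf_ge (k l : ℕ) : (1 / 2 : ℝ) ^ (k + l) ≤ Gf k l := by
  have := amgm k l (p := 1 / 2) (q := 1 / 2) (s := 1) (by norm_num) (by norm_num) (by norm_num)
  rw [one_pow, mul_one, ← pow_add] at this
  exact this

lemma T2_le : C.T2 ≤ 0.9 * Gf k l * C.SX C.miss := by
  classical
  have hm := C.hm
  have h6 := C.mm6
  have hG := Gf_ge k l
  set m : ℕ := k + l with hmdef
  set z : ℝ := (1 / (m:ℝ)) ^ (m - 2) with hz
  have hz0 : 0 ≤ z := by positivity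
  have h1 : ∀ c, Lf C.w (fun f => star k l C.A c f ∧ (∃ i, C.X (f i)) ∧ ∃ j, C.Y (f j)) ≤
      (m:ℝ) * (m - 1) * ∑ x, ∑ y, if C.X x ∧ C.Y y ∧ adj C.A c y ∧ ¬ adj C.A x y then C.w x * C.w y * z else 0 := by
    intro c
    set s : Finset (Fin m × Fin m) := univ.offDiag with hs
    have := Lf_union (w := C.w) C.w0 s
      (R := fun f => star k l C.A c f ∧ (∃ i, C.X (f i)) ∧ ∃ j, C.Y (f j))
      (R' := fun p f => star k l C.A c f ∧ C.X (f p.1) ∧ C.Y (f p.2)) (by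
        rintro f ⟨h1, ⟨i, hi⟩, ⟨j, hj⟩⟩
        refine ⟨(i, j), ?_, h1, hi, hj⟩
        rw [hs, mem_offDiag]
        refine ⟨mem_univ _, mem_univ _, ?_⟩
        intro hij
        have hij' : i = j := hij
        subst hij'
        exact hj hi)
    refine this.trans ?_
    have hcard : ((s.card : ℕ) : ℝ) = (m:ℝ) * (m - 1) := by
      rw [hs, offDiag_card, card_univ, Fintype.card_fin, Nat.cast_sub (by nlinarith)]
      push_cast; ring
    rw [← hcard, ← nsmul_eq_mul]
    refine Finset.sum_le_card_nsmul _ _ _ fun p hp => ?_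
    have hne : p.1 ≠ p.2 := (mem_offDiag.1 hp).2.2
    have h2 := Lf_two C.w0 (R := fun f => star k l C.A c f ∧ C.X (f p.1) ∧ C.Y (f p.2)) p.1 p.2 hne
      (S := fun x y => C.X x ∧ C.Y y ∧ adj C.A c y ∧ ¬ adj C.A x y)
      (U := fun x _ _ u => ¬ adj C.A x u) (by
        rintro f ⟨h1, h2, h3⟩
        exact ⟨⟨h2, h3, C.star_adj h1 _, C.star_nadj h1 _ _⟩, fun i _ _ => C.star_nadj h1 _ _⟩)
    refine h2.trans ?_
    refine Finset.sum_le_sum fun x _ => Finset.sum_le_sum fun y _ => ?_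
    split_ifs with hxy
    · refine mul_le_mul_of_nonneg_left ?_ (mul_nonneg (C.w0 _) (C.w0 _))
      rw [Finset.prod_const, Finset.card_erase_of_mem (by simp [hne.symm]), Finset.card_erase_of_mem (by simp),
        card_univ, Fintype.card_fin]
      rw [show k + l - 1 - 1 = m - 2 by omega]
      exact pow_le_pow_left₀ (C.mu_nn _) (C.nadjX hxy.1) _
    · exact le_rfl
  have h2 : C.T2 ≤ (m:ℝ) * (m - 1) * (∑ c, C.w c * ∑ x, ∑ y,
      if C.X x ∧ C.Y y ∧ adj C.A c y ∧ ¬ adj C.A x y then C.w x * C.w y * z else 0) := by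
    unfold T2
    rw [Finset.mul_sum]
    refine Finset.sum_le_sum fun c _ => ?_
    have := mul_le_mul_of_nonneg_left (h1 c) (C.w0 c)
    linarith
  have h3 : (∑ c, C.w c * ∑ x, ∑ y,
      if C.X x ∧ C.Y y ∧ adj C.A c y ∧ ¬ adj C.A x y then C.w x * C.w y * z else 0) ≤ z / 2 * C.SX C.miss := by
    unfold SX miss mu
    simp_rw [Finset.mul_sum]
    rw [Finset.sum_comm]
    refine Finset.sum_le_sum fun x _ => ?_
    by_cases hx : C.X x
    swap
    · simp [hx]
    rw [if_pos hx, Finset.sum_comm, Finset.mul_sum]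
    refine Finset.sum_le_sum fun y _ => ?_
    by_cases hy : C.Y y ∧ ¬ adj C.A x y
    swap
    · have : ∀ c, ¬ (C.X x ∧ C.Y y ∧ adj C.A c y ∧ ¬ adj C.A x y) := by tauto
      simp [this, hy]
    have : ∑ c, C.w c * (if C.X x ∧ C.Y y ∧ adj C.A c y ∧ ¬ adj C.A x y then C.w x * C.w y * z else 0)
        = C.rho y * (C.w x * C.w y * z) := by
      unfold rho mu
      rw [Finset.sum_mul]
      refine Finset.sum_congr rfl fun c _ => ?_
      have := C.adj_comm c y
      by_cases hc : adj C.A c y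
      · rw [if_pos ⟨hx, hy.1, hc, hy.2⟩, if_pos (this.1 hc)]
      · rw [if_neg (by tauto), if_neg (by tauto)]; simp
    rw [this, if_pos hy]
    have h5 := C.rhoY hy.1
    have h6 : 0 ≤ C.w x * C.w y * z := mul_nonneg (mul_nonneg (C.w0 _) (C.w0 _)) hz0
    nlinarith
  have hms : 0 ≤ C.SX C.miss := C.SX_nn fun x _ => C.miss_nn x
  have h4 : (m:ℝ) * (m - 1) * (z / 2) ≤ 0.9 * Gf k l := by
    have e1 : z = (1 / (m:ℝ)) ^ 2 * (1 / (m:ℝ)) ^ (m - 4) := by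
      rw [hz, ← pow_add]; congr 1; omega
    have e2 : (1 / (m:ℝ)) ^ (m - 4) ≤ (1 / 6) ^ (m - 4) := by gcongr
    have e3 : (1 / 6 : ℝ) ^ (m - 4) = (1 / 3) ^ (m - 4) * (1 / 2) ^ (m - 4) := by
      rw [← mul_pow]; norm_num
    have e4 : (1 / 3 : ℝ) ^ (m - 4) ≤ (1 / 3) ^ 2 :=
      pow_le_pow_of_le_one (by norm_num) (by norm_num) (by omega)
    have e5 : (1 / 2 : ℝ) ^ (m - 4) = 16 * (1 / 2) ^ m := by
      conv_rhs => rw [show m = (m - 4) + 4 by omega, pow_add]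
      ring
    have e6 : (m:ℝ) * (m - 1) * (1 / (m:ℝ)) ^ 2 ≤ 1 := by
      rw [div_pow, one_pow, mul_one_div, div_le_one (by positivity)]; nlinarith
    have e7 : (0:ℝ) ≤ (1 / 2) ^ m := by positivity
    have e8 : (1 / (m:ℝ)) ^ (m - 4) ≤ 16 / 9 * (1 / 2) ^ m := by
      rw [e3, e5] at e2
      have := mul_le_mul_of_nonneg_right e4 (by positivity : (0:ℝ) ≤ 16 * (1 / 2) ^ m)
      linarith
    have e9 : (0:ℝ) ≤ (1 / (m:ℝ)) ^ (m - 4) := by positivity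
    calc (m:ℝ) * (m - 1) * (z / 2) = ((m:ℝ) * (m - 1) * (1 / (m:ℝ)) ^ 2) * ((1 / (m:ℝ)) ^ (m - 4) / 2) := by
          rw [e1]; ring
      _ ≤ 1 * ((1 / (m:ℝ)) ^ (m - 4) / 2) := by gcongr
      _ ≤ _ := by linarith
  have hmm : (0:ℝ) ≤ (m:ℝ) * (m - 1) := by nlinarith
  calc C.T2 ≤ (m:ℝ) * (m - 1) * (z / 2 * C.SX C.miss) := h2.trans (mul_le_mul_of_nonneg_left h3 hmm)
    _ = ((m:ℝ) * (m - 1) * (z / 2)) * C.SX C.miss := by ring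
    _ ≤ _ := mul_le_mul_of_nonneg_right h4 hms

end Cfg
end OStar

namespace OStar
open Finset
namespace Cfg
variable {k l : ℕ} {V : Type*} [Fintype V] (C : Cfg k l V)

/-- absorb missing vertices by rescaling -/
lemma absorb {x : V} (hx : C.X x) : ∃ P' Q' : ℝ, 0 ≤ P' ∧ C.QQ x ≤ Q' ∧ P' + Q' = 1 - C.al ∧
    C.PP x ^ k * C.QQ x ^ l + 1.3 * Gf k l * C.miss x ≤ P' ^ k * Q' ^ l := by
  have hP := C.PP_nn x
  have hQ := C.QQ_nn x
  have hm := C.miss_nn x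
  have h1 := C.PQm x
  have h2 := C.PQ_ge hx
  have h6 := C.mm6
  have hal := C.al_pos
  have hG := Gf_pos k l
  have hk := C.hk
  have hS : 0 < C.PP x + C.QQ x := by
    rcases eq_or_lt_of_le hP with h | h
    · rw [← h, zero_pow (by omega)] at h2; nlinarith
    · linarith
  set s := C.miss x / (C.PP x + C.QQ x) with hs
  have hs0 : 0 ≤ s := by positivity
  have hsS : s * (C.PP x + C.QQ x) = C.miss x := by rw [hs]; field_simp
  have hsm : C.miss x ≤ s := by rw [← hsS]; nlinarith
  refine ⟨C.PP x * (1 + s), C.QQ x * (1 + s), by positivity, by nlinarith, by nlinarith, ?_⟩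
  have hb := one_add_mul_le_pow (show (-2:ℝ) ≤ s by linarith) (k + l)
  have he : (C.PP x * (1 + s)) ^ k * (C.QQ x * (1 + s)) ^ l =
      (1 + s) ^ (k + l) * (C.PP x ^ k * C.QQ x ^ l) := by
    rw [mul_pow, mul_pow, pow_add]; ring
  rw [he]
  set F := C.PP x ^ k * C.QQ x ^ l with hF
  have hF0 : 0 ≤ F := by positivity
  have h3 := mul_le_mul_of_nonneg_right hb hF0
  have h4 : 6 * s ≤ ((k + l : ℕ) : ℝ) * s := mul_le_mul_of_nonneg_right h6 hs0
  have h5 : 6 * s * (0.36 * Gf k l) ≤ ((k + l : ℕ) : ℝ) * s * F :=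
    mul_le_mul h4 h2 (by positivity) (by positivity)
  have h7 : Gf k l * C.miss x ≤ Gf k l * s := mul_le_mul_of_nonneg_left hsm hG.le
  have h8 : 0 ≤ Gf k l * s := by positivity
  nlinarith

lemma fin_avg {O : ℝ} {g : V → ℝ} (h : C.t ≤ C.SX g) (hg : ∀ x, C.X x → C.al * g x ≤ O) : C.t ≤ O := by
  have hal := C.al_pos
  have h1 := C.SX_mono (g := fun x => C.al * g x) (h := fun _ => O) hg
  rw [SX_smul, SX_const] at h1
  exact h.trans (le_of_mul_le_mul_left h1 hal)

lemma Gf_eq_pt (C : Cfg k l V) : Gf k l = ((k:ℝ) / (k + l)) ^ k * (1 - (k:ℝ) / (k + l)) ^ l := by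
  have hk : (0:ℝ) < k := by exact_mod_cast C.hk
  have : 1 - (k:ℝ) / (k + l) = l / (k + l) := by field_simp; ring
  rw [this, div_pow, div_pow]
  unfold Gf
  rw [pow_add]; field_simp

lemma al_lt_half : C.al ≤ 1 / 2 := by
  have := C.al_le'
  have h6 := C.mm6
  refine this.trans ?_
  exact one_div_le_one_div_of_le (by norm_num) (by linarith)

lemma fin_gt {O : ℝ} (hO : ∀ a d : ℝ, 0 ≤ a → a ≤ 1 / 2 → 0 ≤ d → d ≤ (k:ℝ) / (k + l) →
      a * (1 - a) ^ (k + l) * d ^ k * (1 - d) ^ l + Gf (k - 1) l * (1 - a) * a ^ (k + l) * (1 - d) ≤ O)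
    (h : C.t ≤ C.SX (fun x => C.PP x ^ k * C.QQ x ^ l + 1.3 * Gf k l * C.miss x
      + Gf (k - 1) l * C.al ^ (k + l - 1) * C.QQ x)) : C.t ≤ O := by
  refine C.fin_avg h fun x hx => ?_
  obtain ⟨P, Q, hP, hQ, hPQ, hle⟩ := C.absorb hx
  have hal := C.al_pos
  have hal2 := C.al_lt_half
  have hk : (0:ℝ) < k := by exact_mod_cast C.hk
  set a := C.al with ha
  set d := P / (1 - a) with hd
  have h1a : 0 < 1 - a := by linarith
  have hPd : P = (1 - a) * d := by rw [hd]; field_simp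
  have hQd : Q = (1 - a) * (1 - d) := by rw [mul_sub, ← hPd]; linarith
  have hQ0 : 0 ≤ Q := (C.QQ_nn x).trans hQ
  have hd0 : 0 ≤ d := by positivity
  have hd1 : 0 ≤ 1 - d := by
    by_contra hc
    push Not at hc
    nlinarith
  have hlam := Gf_nonneg (k - 1) l
  have key : a * (1 - a) ^ (k + l) * d ^ k * (1 - d) ^ l + Gf (k - 1) l * (1 - a) * a ^ (k + l) * (1 - d) ≤ O := by
    by_cases hc : d ≤ (k:ℝ) / (k + l)
    · exact hO a d hal.le hal2 hd0 hc
    · push Not at hc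
      refine le_trans (add_le_add ?_ ?_) (hO a ((k:ℝ) / (k + l)) hal.le hal2 (by positivity) le_rfl)
      · rw [mul_assoc _ (d ^ k), mul_assoc _ (((k:ℝ) / (k + l)) ^ k), ← C.Gf_eq_pt]
        refine mul_le_mul_of_nonneg_left ?_ (by positivity)
        have := amgm k l hd0 hd1 (show d + (1 - d) ≤ 1 by linarith)
        simpa using this
      · refine mul_le_mul_of_nonneg_left (by linarith) (by positivity)
  have hpw : a * a ^ (k + l - 1) = a ^ (k + l) := by
    rw [← pow_succ']; congr 1; have := C.hm; omega
  have e1 : P ^ k * Q ^ l = (1 - a) ^ (k + l) * d ^ k * (1 - d) ^ l := by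
    rw [hPd, hQd, mul_pow, mul_pow, pow_add]; ring
  calc a * (C.PP x ^ k * C.QQ x ^ l + 1.3 * Gf k l * C.miss x + Gf (k - 1) l * a ^ (k + l - 1) * C.QQ x)
      ≤ a * (P ^ k * Q ^ l + Gf (k - 1) l * a ^ (k + l - 1) * Q) := by
        refine mul_le_mul_of_nonneg_left ?_ hal.le
        refine add_le_add hle (mul_le_mul_of_nonneg_left hQ (by positivity))
    _ = a * (1 - a) ^ (k + l) * d ^ k * (1 - d) ^ l + Gf (k - 1) l * (1 - a) * a ^ (k + l) * (1 - d) := by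
        rw [e1, ← hpw, hQd]; ring
    _ ≤ O := key

lemma fin_eq {O : ℝ} (hO : ∀ a : ℝ, 0 ≤ a → a ≤ 1 →
      Gf k l * (a * (1 - a) ^ (k + l) + (1 - a) * a ^ (k + l)) ≤ O)
    (h : C.t ≤ C.SX (fun x => C.PP x ^ k * C.QQ x ^ l + 1.3 * Gf k l * C.miss x)
      + Gf k l * (1 - C.al) * C.al ^ (k + l)) : C.t ≤ O := by
  have hal := C.al_pos
  have hal2 := C.al_lt_half
  have h1 := C.SX_mono (g := fun x => C.PP x ^ k * C.QQ x ^ l + 1.3 * Gf k l * C.miss x)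
    (h := fun _ => Gf k l * (1 - C.al) ^ (k + l)) (fun x hx => by
      obtain ⟨P, Q, hP, hQ, hPQ, hle⟩ := C.absorb hx
      exact hle.trans (amgm k l hP ((C.QQ_nn x).trans hQ) hPQ.le))
  rw [SX_const] at h1
  have := hO C.al hal.le (by linarith)
  nlinarith
end Cfg
end OStar

namespace OStar
open Finset
section pat
variable {k l : ℕ} {V : Type*} [Fintype V] {w : V → ℝ}

lemma mu2_four (hw : ∀ v, 0 ≤ w v) {Sp Sq : V → Prop} {T : V → V → Prop} (hT : ∀ u v, T u v → T v u)
    (hd : ∀ u, Sp u → ¬ Sq u) :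
    mu2 w (fun u v => Sp u ∧ Sp v ∧ T u v) + 2 * mu2 w (fun u v => Sp u ∧ Sq v ∧ T u v)
      + mu2 w (fun u v => Sq u ∧ Sq v ∧ T u v) ≤
    mu2 w (fun u v => (Sp u ∨ Sq u) ∧ (Sp v ∨ Sq v) ∧ T u v) := by
  rw [mu2_split (fun u v => (Sp u ∨ Sq u) ∧ (Sp v ∨ Sq v) ∧ T u v) (fun u _ => Sp u),
    mu2_split (fun u v => ((Sp u ∨ Sq u) ∧ (Sp v ∨ Sq v) ∧ T u v) ∧ Sp u) (fun _ v => Sp v),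
    mu2_split (fun u v => ((Sp u ∨ Sq u) ∧ (Sp v ∨ Sq v) ∧ T u v) ∧ ¬ Sp u) (fun _ v => Sp v)]
  have h1 : mu2 w (fun u v => Sp u ∧ Sp v ∧ T u v) ≤
      mu2 w (fun u v => (((Sp u ∨ Sq u) ∧ (Sp v ∨ Sq v) ∧ T u v) ∧ Sp u) ∧ Sp v) :=
    mu2_mono hw (fun u v h => by tauto)
  have h2 : mu2 w (fun u v => Sp u ∧ Sq v ∧ T u v) ≤
      mu2 w (fun u v => (((Sp u ∨ Sq u) ∧ (Sp v ∨ Sq v) ∧ T u v) ∧ Sp u) ∧ ¬ Sp v) :=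
    mu2_mono hw (fun u v h => by have := hd v; tauto)
  have h3 : mu2 w (fun u v => Sp u ∧ Sq v ∧ T u v) ≤
      mu2 w (fun u v => (((Sp u ∨ Sq u) ∧ (Sp v ∨ Sq v) ∧ T u v) ∧ ¬ Sp u) ∧ Sp v) := by
    rw [mu2_swap]
    exact mu2_mono hw (fun u v h => by have := hd u; have := hT v u; tauto)
  have h4 : mu2 w (fun u v => Sq u ∧ Sq v ∧ T u v) ≤
      mu2 w (fun u v => (((Sp u ∨ Sq u) ∧ (Sp v ∨ Sq v) ∧ T u v) ∧ ¬ Sp u) ∧ ¬ Sp v) :=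
    mu2_mono hw (fun u v h => by have := hd u; have := hd v; tauto)
  linarith

lemma pat_all (hk : 2 ≤ k) (hl : 2 ≤ l) (hw : ∀ v, 0 ≤ w v) {R : (Fin (k + l) → V) → Prop}
    {Sp Sq : V → Prop} {T : V → V → Prop} (hT : ∀ u v, T u v → T v u) (hd : ∀ u, Sp u → ¬ Sq u)
    (h : ∀ f, R f → (∀ i, (lab k l i → Sp (f i)) ∧ (¬ lab k l i → Sq (f i))) ∧ ∀ i j, T (f i) (f j)) :
    Lf w R * (mu w Sp + mu w Sq) ^ 2 ≤
      mu2 w (fun u v => (Sp u ∨ Sq u) ∧ (Sp v ∨ Sq v) ∧ T u v) * (mu w Sp ^ k * mu w Sq ^ l) := by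
  have h1 := pat_pp hk hw h
  have h2 := pat_pq (by omega) (by omega) hw h
  have h3 := pat_qq hl hw h
  have h4 := mu2_four hw hT hd
  have hF : 0 ≤ mu w Sp ^ k * mu w Sq ^ l := by
    have := mu_nonneg hw Sp
    have := mu_nonneg hw Sq
    positivity
  have h5 := mul_le_mul_of_nonneg_right h4 hF
  nlinarith

end pat

namespace Cfg
variable {k l : ℕ} {V : Type*} [Fintype V] (C : Cfg k l V)

/-- adjacent pairs in `Y` -/
noncomputable def EY : ℝ := mu2 C.w (fun u v => C.Y u ∧ C.Y v ∧ adj C.A u v)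

lemma adj_symm {u v : V} (h : adj C.A u v) : adj C.A v u := h.symm

lemma NY_ge (x : V) : C.EY ≤ mu2 C.w (fun u v => (adj C.A x u ∧ C.Y u) ∧ (adj C.A x v ∧ C.Y v) ∧ adj C.A u v)
    + C.miss x := by
  have h1 : C.EY ≤ mu2 C.w (fun u v => (adj C.A x u ∧ C.Y u) ∧ (adj C.A x v ∧ C.Y v) ∧ adj C.A u v) +
      mu2 C.w (fun u v => (C.Y u ∧ ¬ adj C.A x u) ∧ adj C.A u v ∨ (C.Y v ∧ ¬ adj C.A x v) ∧ adj C.A v u) :=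
    mu2_union C.w0 (fun u v h => by have := h.2.2.symm; tauto)
  have h2 : mu2 C.w (fun u v => (C.Y u ∧ ¬ adj C.A x u) ∧ adj C.A u v ∨ (C.Y v ∧ ¬ adj C.A x v) ∧ adj C.A v u) ≤
      mu2 C.w (fun u v => (C.Y u ∧ ¬ adj C.A x u) ∧ adj C.A u v)
       + mu2 C.w (fun u v => (C.Y v ∧ ¬ adj C.A x v) ∧ adj C.A v u) :=
    mu2_union C.w0 (fun u v h => h)
  have h3 : mu2 C.w (fun u v => (C.Y u ∧ ¬ adj C.A x u) ∧ adj C.A u v) ≤ 1 / 2 * C.miss x :=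
    mu2_fst_le C.w0 _ _ (fun u hu => (C.rhoY hu.1).le)
  rw [mu2_swap (fun u v => (C.Y v ∧ ¬ adj C.A x v) ∧ adj C.A v u)] at h2
  linarith

lemma PQ_le_one (x : V) : C.PP x + C.QQ x ≤ 1 := by
  have := C.PQm x; have := C.miss_nn x; have := C.al_pos; linarith

lemma AA_le2 (hl : 2 ≤ l) {x : V} (hx : C.X x) :
    C.AA x ≤ C.PP x ^ k * C.QQ x ^ l + 0.36 * Gf k l * C.miss x - 0.36 * Gf k l * C.EY := by
  have hk : 2 ≤ k := hl.trans C.hlk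
  have h1 := pat_all hk hl C.w0 (R := fun f => star k l C.A x f ∧ ∀ i, C.Y (f i))
    (Sp := fun u => C.A x u ∧ C.Y u) (Sq := fun u => C.A u x ∧ C.Y u)
    (T := fun u v => ¬ adj C.A u v) (fun u v h h' => h h'.symm)
    (fun u h h' => C.asym _ _ h.1 h'.1)
    (fun f hf => ⟨fun i => ⟨fun hi => ⟨(hf.1.1 i).1 hi, hf.2 i⟩, fun hi => ⟨(hf.1.1 i).2 hi, hf.2 i⟩⟩,
      fun i j => C.star_nadj hf.1 i j⟩)
  have hP := C.PP_nn x
  have hQ := C.QQ_nn x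
  have hPQ := C.PQ_ge hx
  have hone := C.PQ_le_one x
  have hN := C.NY_ge x
  have hG := Gf_pos k l
  set N : V → Prop := fun u => adj C.A x u ∧ C.Y u with hNdef
  have hNS : ∀ u, (C.A x u ∧ C.Y u ∨ C.A u x ∧ C.Y u) ↔ N u := fun u => by
    simp only [hNdef, adj]; tauto
  have hsplit := mu2_split (w := C.w) (fun u v => N u ∧ N v) (adj C.A)
  rw [mu2_prod] at hsplit
  have hmuN : mu C.w N ≤ C.PP x + C.QQ x := mu_union C.w0 (fun u h => (hNS u).2 h)
  have hmuN' : C.PP x + C.QQ x ≤ mu C.w N := C.mu_AA x C.Y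
  have hmu : mu C.w N = C.PP x + C.QQ x := le_antisymm hmuN hmuN'
  have e1 : mu2 C.w (fun u v => (C.A x u ∧ C.Y u ∨ C.A u x ∧ C.Y u) ∧ (C.A x v ∧ C.Y v ∨ C.A v x ∧ C.Y v) ∧ ¬ adj C.A u v)
      = mu2 C.w (fun u v => (N u ∧ N v) ∧ ¬ adj C.A u v) :=
    mu2_congr (fun u v => by rw [hNS, hNS]; tauto)
  have e2 : mu2 C.w (fun u v => N u ∧ N v ∧ adj C.A u v) = mu2 C.w (fun u v => (N u ∧ N v) ∧ adj C.A u v) :=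
    mu2_congr (fun u v => by tauto)
  rw [e1] at h1
  have h1' : C.AA x * (C.PP x + C.QQ x) ^ 2 ≤ mu2 C.w (fun u v => (N u ∧ N v) ∧ ¬ adj C.A u v) *
    (C.PP x ^ k * C.QQ x ^ l) := h1
  change C.EY ≤ mu2 C.w (fun u v => N u ∧ N v ∧ adj C.A u v) + C.miss x at hN
  rw [e2] at hN
  rw [hmu] at hsplit
  set E := mu2 C.w (fun u v => (N u ∧ N v) ∧ adj C.A u v) with hE
  set NE := mu2 C.w (fun u v => (N u ∧ N v) ∧ ¬ adj C.A u v) with hNE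
  have hE0 : 0 ≤ E := mu2_nonneg C.w0 _
  set F := C.PP x ^ k * C.QQ x ^ l with hF
  set s := C.PP x + C.QQ x with hs
  have hspos : 0 < s := by
    rcases eq_or_lt_of_le hP with h | h
    · rw [hF, ← h, zero_pow (by omega)] at hPQ; nlinarith
    · linarith
  have h2 : C.AA x * s ^ 2 ≤ (F - 0.36 * Gf k l * E) * s ^ 2 := by
    have : NE = s ^ 2 - E := by nlinarith
    rw [this] at h1'
    have h3 : 0.36 * Gf k l * E * s ^ 2 ≤ E * F := by
      have : 0.36 * Gf k l * E ≤ F * E := mul_le_mul_of_nonneg_right hPQ hE0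
      have h4 : s ^ 2 ≤ 1 := by nlinarith
      have h5 : 0 ≤ 0.36 * Gf k l * E := by positivity
      nlinarith
    nlinarith
  have h3 := le_of_mul_le_mul_right h2 (by positivity)
  nlinarith

lemma half_pow (C : Cfg k l V) : (1 / 2 : ℝ) ^ (k + l - 1) ≤ 0.36 * C.al := by
  have h1 := C.al_ge
  have h2 := two_pow_ge C.hm
  have h6 := C.mm6
  have e : (2:ℝ) ^ (k + l) = 2 * 2 ^ (k + l - 1) := by
    rw [← pow_succ']; congr 1; have := C.hm; omega
  rw [e] at h2
  rw [one_div_pow]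
  have h3 : (0.36:ℝ) * (2 / (3 * (((k + l : ℕ) : ℝ) + 1))) ≤ 0.36 * C.al := by linarith
  refine le_trans ?_ h3
  rw [div_le_iff₀ (by positivity)]
  have h4 : (0.36:ℝ) * (2 / (3 * (((k + l : ℕ) : ℝ) + 1))) * (16 / 3 * ((k + l : ℕ) : ℝ)) ≤
    0.36 * (2 / (3 * (((k + l : ℕ) : ℝ) + 1))) * 2 ^ (k + l - 1) :=
    mul_le_mul_of_nonneg_left (by linarith) (by positivity)
  refine le_trans ?_ h4
  have : (0.36:ℝ) * (2 / (3 * (((k + l : ℕ) : ℝ) + 1))) * (16 / 3 * ((k + l : ℕ) : ℝ)) =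
    1.28 * ((k + l : ℕ) : ℝ) / (((k + l : ℕ) : ℝ) + 1) := by field_simp; ring
  rw [this, le_div_iff₀ (by positivity)]
  linarith

/-- number of neighbours in `Y` -/
noncomputable def bY (y : V) : ℝ := mu C.w (fun u => C.Y u ∧ adj C.A y u)

lemma AA_bY (y : V) : C.AA y ≤ Gf k l * C.bY y ^ (k + l) := by
  have h1 : C.AA y ≤ C.PP y ^ k * C.QQ y ^ l := Lf_lab C.w0 fun f hf i =>
    ⟨fun hi => ⟨(hf.1.1 i).1 hi, hf.2 i⟩, fun hi => ⟨(hf.1.1 i).2 hi, hf.2 i⟩⟩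
  refine h1.trans (amgm k l (C.PP_nn y) (C.QQ_nn y) ?_)
  refine (C.mu_AA y C.Y).trans (le_of_eq (mu_congr fun u => by tauto))

lemma SY_bY : C.SY C.bY = C.EY := by
  unfold EY
  rw [mu2_fst C.Y (fun u v => C.Y v ∧ adj C.A u v)]
  rfl

lemma bY_le (y : V) : C.bY y ≤ C.rho y := mu_mono C.w0 (fun u h => h.2)

lemma bY_nn (y : V) : 0 ≤ C.bY y := C.mu_nn _

lemma AD2 (hl : 2 ≤ l) : C.SX C.AA + C.SY C.AA ≤
    C.SX (fun x => C.PP x ^ k * C.QQ x ^ l + 0.36 * Gf k l * C.miss x) := by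
  have h1 := C.SX_mono (g := C.AA) (fun x hx => C.AA_le2 hl hx)
  have e : (fun x => C.PP x ^ k * C.QQ x ^ l + 0.36 * Gf k l * C.miss x - 0.36 * Gf k l * C.EY)
    = (fun x => (C.PP x ^ k * C.QQ x ^ l + 0.36 * Gf k l * C.miss x) + (- (0.36 * Gf k l * C.EY))) := by
    ext x; ring
  rw [e, SX_add C _ (fun _ => - (0.36 * Gf k l * C.EY)), SX_const] at h1
  have hG := Gf_pos k l
  have h2 := C.SY_mono (g := C.AA) (h := fun y => (Gf k l * (1 / 2) ^ (k + l - 1)) * C.bY y) (fun y hy => by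
    refine (C.AA_bY y).trans ?_
    rw [mul_assoc]
    refine mul_le_mul_of_nonneg_left ?_ hG.le
    have hb := C.bY_nn y
    have : C.bY y ^ (k + l) = C.bY y ^ (k + l - 1) * C.bY y := by
      rw [← pow_succ]; congr 1; have := C.hm; omega
    rw [this]
    refine mul_le_mul_of_nonneg_right (pow_le_pow_left₀ hb ?_ _) hb
    exact (C.bY_le y).trans (C.rhoY hy).le)
  rw [SY_smul, SY_bY] at h2
  have hE : 0 ≤ C.EY := mu2_nonneg C.w0 _
  have h3 := mul_le_mul_of_nonneg_right C.half_pow (mul_nonneg hG.le hE)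
  nlinarith

end Cfg
end OStar

namespace OStar
open Finset

lemma bern_mul (n : ℕ) {a e : ℝ} (ha : 0 < a) (he : 0 ≤ e) (hea : e ≤ a) :
    (a - e) ^ n * (a + n * e) ≤ a ^ (n + 1) := by
  have h1 : 1 + (n:ℝ) * (e / a) ≤ (1 + e / a) ^ n :=
    one_add_mul_le_pow (by have : 0 ≤ e / a := by positivity
                           linarith) n
  have h2 : 0 ≤ 1 - e / a := by
    rw [sub_nonneg, div_le_one ha]; exact hea
  have h3 : (1 - e / a) ^ n * (1 + n * (e / a)) ≤ 1 := by
    refine (mul_le_mul_of_nonneg_left h1 (by positivity)).trans ?_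
    rw [← mul_pow]
    refine pow_le_one₀ (by positivity) ?_
    have : 0 ≤ (e / a) ^ 2 := by positivity
    nlinarith
  have e1 : (a - e) ^ n * (a + n * e) = a ^ (n + 1) * ((1 - e / a) ^ n * (1 + n * (e / a))) := by
    have : a - e = a * (1 - e / a) := by field_simp
    rw [this, mul_pow, pow_succ]; field_simp
  rw [e1]
  have : 0 < a ^ (n + 1) := by positivity
  nlinarith

namespace Cfg
variable {k l : ℕ} {V : Type*} [Fintype V] (C : Cfg k l V)

/-- neighbours in `X` -/
noncomputable def eX (x : V) : ℝ := mu C.w (fun u => C.X u ∧ adj C.A x u)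
/-- stars at `c` with all leaves in `X` -/
noncomputable def LX (c : V) : ℝ := Lf C.w (fun f => star k l C.A c f ∧ ∀ i, C.X (f i))

lemma T1_eq : C.T1 = C.SX C.LX + C.SY C.LX := by rw [← C.sum_XY]; rfl

lemma eX_nn (x : V) : 0 ≤ C.eX x := C.mu_nn _
lemma eX_le (x : V) : C.eX x ≤ C.al := mu_mono C.w0 (fun _ h => h.1)
lemma nX_eq (x : V) : mu C.w (fun u => C.X u ∧ ¬ adj C.A x u) = C.al - C.eX x := by
  unfold al eX; rw [mu_split C.X (adj C.A x)]; ring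

lemma LX_nn (c : V) : 0 ≤ C.LX c := Lf_nonneg C.w0 _

lemma LX_pq (c : V) : C.LX c ≤ mu C.w (fun u => C.A c u ∧ C.X u) ^ k * mu C.w (fun u => C.A u c ∧ C.X u) ^ l :=
  Lf_lab C.w0 fun f hf i =>
    ⟨fun hi => ⟨(hf.1.1 i).1 hi, hf.2 i⟩, fun hi => ⟨(hf.1.1 i).2 hi, hf.2 i⟩⟩

lemma gh_le (c : V) : mu C.w (fun u => C.A c u ∧ C.X u) + mu C.w (fun u => C.A u c ∧ C.X u) ≤ C.eX c :=
  (C.mu_AA c C.X).trans (le_of_eq (mu_congr fun _ => by tauto))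

lemma LX_e (c : V) : C.LX c ≤ Gf k l * C.eX c ^ (k + l) :=
  (C.LX_pq c).trans (amgm k l (C.mu_nn _) (C.mu_nn _) (C.gh_le c))

/-- adjacent pairs in `X` -/
noncomputable def EX : ℝ := mu2 C.w (fun u v => C.X u ∧ C.X v ∧ adj C.A u v)

lemma SX_eX : C.SX C.eX = C.EX := by
  unfold EX
  rw [mu2_fst C.X (fun u v => C.X v ∧ adj C.A u v)]
  rfl

lemma LX_NA (hl : 2 ≤ l) (c : V) : C.LX c ≤ Gf k l * C.al ^ (k + l - 2) * (C.al ^ 2 - C.EX) := by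
  have hk : 2 ≤ k := hl.trans C.hlk
  have hm := C.hm
  have h1 := pat_all hk hl C.w0 (R := fun f => star k l C.A c f ∧ ∀ i, C.X (f i))
    (Sp := fun u => C.A c u ∧ C.X u) (Sq := fun u => C.A u c ∧ C.X u)
    (T := fun u v => ¬ adj C.A u v) (fun u v h h' => h h'.symm)
    (fun u h h' => C.asym _ _ h.1 h'.1)
    (fun f hf => ⟨fun i => ⟨fun hi => ⟨(hf.1.1 i).1 hi, hf.2 i⟩, fun hi => ⟨(hf.1.1 i).2 hi, hf.2 i⟩⟩,
      fun i j => C.star_nadj hf.1 i j⟩)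
  have hsplit := mu2_split (w := C.w) (fun u v => C.X u ∧ C.X v) (adj C.A)
  rw [mu2_prod] at hsplit
  have e2 : C.EX = mu2 C.w (fun u v => (C.X u ∧ C.X v) ∧ adj C.A u v) :=
    mu2_congr (fun u v => by tauto)
  rw [← e2] at hsplit
  have h2 : mu2 C.w (fun u v => (C.A c u ∧ C.X u ∨ C.A u c ∧ C.X u) ∧ (C.A c v ∧ C.X v ∨ C.A v c ∧ C.X v)
      ∧ ¬ adj C.A u v) ≤ mu2 C.w (fun u v => (C.X u ∧ C.X v) ∧ ¬ adj C.A u v) :=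
    mu2_mono C.w0 (fun u v h => by tauto)
  have hNE : mu2 C.w (fun u v => (C.X u ∧ C.X v) ∧ ¬ adj C.A u v) = C.al ^ 2 - C.EX := by
    unfold al; linarith
  rw [hNE] at h2
  have hg := C.mu_nn (fun u => C.A c u ∧ C.X u)
  have hh := C.mu_nn (fun u => C.A u c ∧ C.X u)
  have hpq := C.LX_pq c
  have hgh := (C.gh_le c).trans (C.eX_le c)
  have hG := Gf_pos k l
  have hNE0 : 0 ≤ C.al ^ 2 - C.EX := by rw [← hNE]; exact mu2_nonneg C.w0 _
  change C.LX c * _ ≤ _ at h1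
  set g := mu C.w (fun u => C.A c u ∧ C.X u)
  set h := mu C.w (fun u => C.A u c ∧ C.X u)
  have hal := C.al_pos
  rcases eq_or_lt_of_le (add_nonneg hg hh) with h0 | h0
  · have : g = 0 := by linarith
    rw [this, zero_pow (by omega), zero_mul] at hpq
    exact hpq.trans (by positivity)
  · have h3 := amgm k l hg hh (le_refl (g + h))
    have h4 : C.LX c * (g + h) ^ 2 ≤ (Gf k l * C.al ^ (k + l - 2) * (C.al ^ 2 - C.EX)) * (g + h) ^ 2 := by
      calc _ ≤ (C.al ^ 2 - C.EX) * (Gf k l * (g + h) ^ (k + l)) :=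
            h1.trans (mul_le_mul h2 h3 (by positivity) hNE0)
        _ = (C.al ^ 2 - C.EX) * (Gf k l * ((g + h) ^ (k + l - 2) * (g + h) ^ 2)) := by
            rw [← pow_add]; congr 3; omega
        _ ≤ (C.al ^ 2 - C.EX) * (Gf k l * (C.al ^ (k + l - 2) * (g + h) ^ 2)) := by
            refine mul_le_mul_of_nonneg_left ?_ hNE0
            refine mul_le_mul_of_nonneg_left ?_ hG.le
            refine mul_le_mul_of_nonneg_right (pow_le_pow_left₀ h0.le hgh _) (by positivity)
        _ = _ := by ring
    exact le_of_mul_le_mul_right h4 (by positivity)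

lemma T1_eqcase (hl : 2 ≤ l) : C.T1 ≤ Gf k l * (1 - C.al) * C.al ^ (k + l) := by
  have hG := Gf_pos k l
  have hal := C.al_pos
  have hm := C.hm
  have h1 := C.SX_mono (g := C.LX) (h := fun x => (Gf k l * C.al ^ (k + l - 1)) * C.eX x) (fun x hx => by
    refine (C.LX_e x).trans ?_
    rw [mul_assoc]
    refine mul_le_mul_of_nonneg_left ?_ hG.le
    have : C.eX x ^ (k + l) = C.eX x ^ (k + l - 1) * C.eX x := by
      rw [← pow_succ]; congr 1; omega
    rw [this]
    exact mul_le_mul_of_nonneg_right (pow_le_pow_left₀ (C.eX_nn x) (C.eX_le x) _) (C.eX_nn x))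
  rw [SX_smul, SX_eX] at h1
  have h2 := C.SY_mono (g := C.LX) (fun x _ => C.LX_NA hl x)
  rw [SY_const] at h2
  rw [T1_eq]
  have e1 : C.al ^ (k + l - 1) = C.al ^ (k + l - 2) * C.al := by rw [← pow_succ]; congr 1; omega
  have e2 : C.al ^ (k + l) = C.al ^ (k + l - 2) * C.al ^ 2 := by rw [← pow_add]; congr 1; omega
  rw [e1] at h1
  rw [e2]
  have hE : 0 ≤ C.EX := mu2_nonneg C.w0 _
  have h3 : 0 ≤ Gf k l * C.al ^ (k + l - 2) * C.EX * (1 - 2 * C.al) :=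
    mul_nonneg (by positivity) (by linarith [C.al_lt_half])
  nlinarith

open scoped Classical in
lemma LX_one (c : V) : C.LX c ≤ ∑ x, if C.X x ∧ C.A c x then
    C.w x * (Gf (k - 1) l * (C.al - C.eX x) ^ (k + l - 1)) else 0 := by
  have hk := C.hk
  have hl := C.hl
  have h := Lf_lab_one C.w0 (k := k) (l := l) (R := fun f => star k l C.A c f ∧ ∀ i, C.X (f i))
    ⟨0, by omega⟩ (S := fun x => C.X x ∧ C.A c x)
    (Up := fun x u => C.A c u ∧ C.X u ∧ ¬ adj C.A x u) (Uq := fun x u => C.A u c ∧ C.X u ∧ ¬ adj C.A x u)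
    (s := fun x => C.al - C.eX x) (fun f hf => by
      have h0 : lab k l ⟨0, by omega⟩ := hk
      refine ⟨⟨hf.2 _, (hf.1.1 _).1 h0⟩, fun i _ => ⟨fun hi => ⟨(hf.1.1 i).1 hi, hf.2 i, C.star_nadj hf.1 _ _⟩,
        fun hi => ⟨(hf.1.1 i).2 hi, hf.2 i, C.star_nadj hf.1 _ _⟩⟩⟩)
    (fun x _ => by
      rw [← C.nX_eq]
      refine (C.mu_AA c _).trans (mu_mono C.w0 fun u hu => hu.2))
  have h0 : gj k l ⟨0, by omega⟩ = Gf (k - 1) l := by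
    unfold gj; rw [if_pos]; exact hk
  rw [h0] at h
  unfold LX
  convert h

open scoped Classical in
lemma T1_one (Z : V → Prop) : (∑ c, if Z c then C.w c * C.LX c else 0) ≤
    C.SX (fun x => Gf (k - 1) l * ((C.al - C.eX x) ^ (k + l - 1) * mu C.w (fun c => Z c ∧ C.A c x))) := by
  have h := sum_mu_swap (w := C.w) Z (fun c x => C.X x ∧ C.A c x)
    (fun x => Gf (k - 1) l * (C.al - C.eX x) ^ (k + l - 1))
  refine le_trans (Finset.sum_le_sum fun c _ => ?_) (h.le.trans (le_of_eq ?_))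
  · split_ifs
    · refine mul_le_mul_of_nonneg_left ((C.LX_one c).trans (le_of_eq ?_)) (C.w0 c)
      refine Finset.sum_congr rfl fun x _ => ?_
      congr
    · exact le_rfl
  · unfold SX
    refine Finset.sum_congr rfl fun x _ => ?_
    by_cases hx : C.X x
    · simp only [hx, if_true, true_and]; ring
    · simp [hx, mu]

lemma QQ_low {x : V} (hx : C.X x) : 0.36 * l ≤ Real.exp 1 * ((k + l : ℕ) : ℝ) * C.QQ x := by
  have h := C.PQ_ge hx
  have hk := C.hk
  have hl := C.hl
  have hkp : (0:ℝ) < k := by exact_mod_cast hk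
  have hlp : (0:ℝ) < l := by exact_mod_cast hl
  have hQ := C.QQ_nn x
  have hP := C.PP_nn x
  have hone := C.PQ_le_one x
  have h1 : 0.36 * Gf k l ≤ C.QQ x ^ l := by
    refine h.trans ?_
    have : C.PP x ^ k ≤ 1 := pow_le_one₀ hP (by linarith)
    exact mul_le_of_le_one_left (by positivity) this
  by_contra hc
  push Not at hc
  -- (m/k)^k ≤ e^l
  have h2 : (((k + l : ℕ) : ℝ) / k) ^ k ≤ Real.exp 1 ^ l := by
    have h3 : ((k + l : ℕ) : ℝ) / k ≤ Real.exp (l / k) := by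
      have := Real.add_one_le_exp ((l:ℝ) / k)
      refine le_trans (le_of_eq ?_) this
      push_cast; field_simp; ring
    calc _ ≤ Real.exp (l / k) ^ k := pow_le_pow_left₀ (by positivity) h3 _
      _ = Real.exp 1 ^ l := by
        rw [← Real.exp_nat_mul, ← Real.exp_nat_mul]; congr 1; field_simp
  set m : ℝ := ((k + l : ℕ) : ℝ) with hm
  have hmk : (k:ℝ) + l = m := by rw [hm]; push_cast; ring
  have hmp : 0 < m := by rw [← hmk]; positivity
  have h4 : (Real.exp 1 * m * C.QQ x) ^ l < (0.36 * l) ^ l :=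
    pow_lt_pow_left₀ hc (by have := Real.exp_pos 1; positivity) (by omega)
  have h5 : (0.36 * (l:ℝ)) ^ l ≤ 0.36 * (l:ℝ) ^ l := by
    rw [mul_pow]
    refine mul_le_mul_of_nonneg_right ?_ (by positivity)
    exact pow_le_of_le_one (by norm_num) (by norm_num) (by omega)
  have h6 : (Real.exp 1 * m * C.QQ x) ^ l = Real.exp 1 ^ l * m ^ l * C.QQ x ^ l := by
    rw [mul_pow, mul_pow]
  rw [h6] at h4
  have h7 : Real.exp 1 ^ l * m ^ l * (0.36 * Gf k l) ≤ Real.exp 1 ^ l * m ^ l * C.QQ x ^ l :=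
    mul_le_mul_of_nonneg_left h1 (by have := Real.exp_pos 1; positivity)
  have h8 : m ^ l * Gf k l = (k:ℝ) ^ k * (l:ℝ) ^ l / m ^ k := by
    unfold Gf; rw [hmk, pow_add]; field_simp
  rw [div_pow] at h2
  have h9 : (l:ℝ) ^ l ≤ Real.exp 1 ^ l * (m ^ l * Gf k l) := by
    rw [h8]
    have h10 := mul_le_mul_of_nonneg_right h2 (show 0 ≤ (k:ℝ) ^ k * (l:ℝ) ^ l / m ^ k by positivity)
    refine le_trans (le_of_eq ?_) h10
    field_simp
  nlinarith

lemma T1_gt (hl : 2 ≤ l) : C.T1 ≤ C.SX (fun x => Gf (k - 1) l * C.al ^ (k + l - 1) * C.QQ x) := by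
  classical
  have h := C.T1_one (fun _ => True)
  simp only [if_true, true_and] at h
  refine le_trans h (C.SX_mono fun x hx => ?_)
  rw [mul_assoc]
  refine mul_le_mul_of_nonneg_left ?_ (Gf_nonneg _ _)
  have h1 : mu C.w (fun c => C.A c x) ≤ C.QQ x + C.eX x :=
    mu_union C.w0 (fun c hc => by
      by_cases hX : C.X c
      · exact Or.inr ⟨hX, Or.inr hc⟩
      · exact Or.inl ⟨hc, hX⟩)
  have hm := C.hm
  have h6 := C.mm6
  have he := C.eX_nn x
  have hea := C.eX_le x
  have hal := C.al_pos
  have hal' := C.al_le'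
  have hlow := C.QQ_low hx
  have h2 := bern_mul (k + l - 1) hal he hea
  have hc : ((k + l - 1 : ℕ) : ℝ) = ((k + l : ℕ) : ℝ) - 1 := by
    rw [Nat.cast_sub (by omega)]; simp
  have e1 : k + l - 1 + 1 = k + l := by omega
  rw [hc, e1] at h2
  set m : ℝ := ((k + l : ℕ) : ℝ) with hmdef
  have hl2 : (2:ℝ) ≤ l := by exact_mod_cast hl
  have hQ := C.QQ_nn x
  have h3 : C.al ≤ (m - 1) * C.QQ x := by
    have h4 : 0.72 ≤ 2.7183 * (m * C.QQ x) := by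
      have := mul_le_mul_of_nonneg_right e_hi.le (show 0 ≤ m * C.QQ x by positivity)
      nlinarith
    have h5 : C.al ≤ 1 / 6 := hal'.trans (one_div_le_one_div_of_le (by norm_num) h6)
    nlinarith
  have h4 : (C.QQ x + C.eX x) * C.al ≤ C.QQ x * (C.al + (m - 1) * C.eX x) := by nlinarith
  have hp : 0 ≤ (C.al - C.eX x) ^ (k + l - 1) := pow_nonneg (by linarith) _
  have h5 : ((C.al - C.eX x) ^ (k + l - 1) * (C.QQ x + C.eX x)) * C.al ≤ (C.al ^ (k + l - 1) * C.QQ x) * C.al := by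
    have e2 : C.al ^ (k + l) = C.al ^ (k + l - 1) * C.al := by rw [← pow_succ, e1]
    rw [e2] at h2
    calc _ = (C.al - C.eX x) ^ (k + l - 1) * ((C.QQ x + C.eX x) * C.al) := by ring
      _ ≤ (C.al - C.eX x) ^ (k + l - 1) * (C.QQ x * (C.al + (m - 1) * C.eX x)) :=
        mul_le_mul_of_nonneg_left h4 hp
      _ = C.QQ x * ((C.al - C.eX x) ^ (k + l - 1) * (C.al + (m - 1) * C.eX x)) := by ring
      _ ≤ C.QQ x * (C.al ^ (k + l - 1) * C.al) := mul_le_mul_of_nonneg_left h2 hQ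
      _ = _ := by ring
  refine (mul_le_mul_of_nonneg_left h1 hp).trans ?_
  exact le_of_mul_le_mul_right h5 hal

theorem main_l2_gt (hl : 2 ≤ l) {O : ℝ} (hO : ∀ a d : ℝ, 0 ≤ a → a ≤ 1 / 2 → 0 ≤ d → d ≤ (k:ℝ) / (k + l) →
      a * (1 - a) ^ (k + l) * d ^ k * (1 - d) ^ l + Gf (k - 1) l * (1 - a) * a ^ (k + l) * (1 - d) ≤ O) :
    C.t ≤ O := by
  refine C.fin_gt hO ?_
  have h1 := C.t_split
  have h2 := C.T2_le
  have h3 := C.AD2 hl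
  have h4 := C.T1_gt hl
  have hG := Gf_pos k l
  have h5 : 0 ≤ C.SX C.miss := C.SX_nn fun x _ => C.miss_nn x
  rw [SX_add, SX_add, SX_smul C (1.3 * Gf k l)]
  rw [SX_add, SX_smul C (0.36 * Gf k l)] at h3
  have := mul_nonneg hG.le h5
  nlinarith

theorem main_l2_eq (hl : 2 ≤ l) {O : ℝ} (hO : ∀ a : ℝ, 0 ≤ a → a ≤ 1 →
      Gf k l * (a * (1 - a) ^ (k + l) + (1 - a) * a ^ (k + l)) ≤ O) :
    C.t ≤ O := by
  refine C.fin_eq hO ?_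
  have h1 := C.t_split
  have h2 := C.T2_le
  have h3 := C.AD2 hl
  have h4 := C.T1_eqcase hl
  have hG := Gf_pos k l
  have h5 : 0 ≤ C.SX C.miss := C.SX_nn fun x _ => C.miss_nn x
  rw [SX_add, SX_smul C (1.3 * Gf k l)]
  rw [SX_add, SX_smul C (0.36 * Gf k l)] at h3
  have := mul_nonneg hG.le h5
  nlinarith

end Cfg
end OStar

namespace OStar
open Finset

lemma Gf_zero (k : ℕ) : Gf k 0 = 1 := by
  unfold Gf
  have := pow_self_pos k
  simp only [Nat.cast_zero, add_zero, pow_zero, mul_one]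
  exact div_self this.ne'

lemma Gf1_step {k : ℕ} (hk : 1 ≤ k) : ((k:ℝ) + 1) * Gf k 1 ≤ k * Gf (k - 1) 1 := by
  have hk' : (0:ℝ) < k := by exact_mod_cast hk
  have h := amgm (k - 1) 1 (p := (k:ℝ) / (k + 1)) (q := 1 / ((k:ℝ) + 1)) (s := 1) (by positivity) (by positivity)
    (by rw [← add_div, div_self (by positivity)])
  rw [one_pow, mul_one, pow_one] at h
  have h2 := mul_le_mul_of_nonneg_left h hk'.le
  refine le_trans (le_of_eq ?_) h2
  unfold Gf
  obtain ⟨n, rfl⟩ : ∃ n, k = n + 1 := ⟨k - 1, by omega⟩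
  have : ((n + 1 : ℕ) : ℝ) + 1 ≠ 0 := by positivity
  rw [div_pow]
  simp only [Nat.add_sub_cancel, Nat.cast_one, one_pow, mul_one]
  field_simp
  ring

lemma kGf1 {k : ℕ} (hk : 5 ≤ k) : (k:ℝ) * Gf (k - 1) 1 ≤ 0.4096 := by
  induction k, hk using Nat.le_induction with
  | base => unfold Gf; norm_num
  | succ n hn ih =>
    have := Gf1_step (k := n) (by omega)
    have h : ((n + 1 : ℕ):ℝ) * Gf (n + 1 - 1) 1 = ((n:ℝ) + 1) * Gf n 1 := by
      rw [Nat.add_sub_cancel]; push_cast; rfl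
    rw [h]
    linarith

lemma beta_an {m : ℕ} (hm : 6 ≤ m) {b : ℝ} (h1 : 1 / (m:ℝ) ≤ b) (h2 : b ≤ 1 / 2)
    (ht : Real.exp 1 / (m:ℝ) ^ (m - 1) ≤ 0.0756 / (m:ℝ) ^ 3) :
    (1 - b) ^ m + Real.exp 1 * m * b ^ m + 0.0756 * ((m:ℝ) - 1) / m * b + (1 / 2) ^ m < 1 / Real.exp 1 := by
  have hm' : (6:ℝ) ≤ m := by exact_mod_cast hm
  have hm0 : (0:ℝ) < m := by linarith
  have he := e_hi
  have he0 := Real.exp_pos 1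
  have hie := ie_lo
  obtain ⟨x, y, hx, hy, hxy, hb⟩ := conv_comb h1 h2
  have hi : 1 / (m:ℝ) ≤ 1 / 6 := by gcongr
  have hi0 : 0 < 1 / (m:ℝ) := by positivity
  have p1 := pow_conv m hx hy hxy (x := 1 - 1 / (m:ℝ)) (y := 1 / 2) (by linarith) (by norm_num)
  have p2 := pow_conv m hx hy hxy (x := 1 / (m:ℝ)) (y := 1 / 2) (by positivity) (by norm_num)
  have e1 : x * (1 - 1 / (m:ℝ)) + y * (1 / 2) = 1 - b := by
    rw [hb]; have : x = 1 - y := by linarith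
    rw [this]; ring
  rw [e1] at p1
  rw [← hb] at p2
  have h2p := two_pow_ge hm
  have hh : (1 / 2 : ℝ) ^ m = 1 / 2 ^ m := by rw [div_pow, one_pow]
  have hp : (0:ℝ) < 2 ^ m := by positivity
  have q1 : (1 / 2 : ℝ) ^ m * m ≤ 3 / 32 := by
    rw [hh, div_mul_eq_mul_div, div_le_iff₀ hp]; linarith
  have q2 : (1 / 2 : ℝ) ^ m ≤ 1 / 64 := by
    calc (1 / 2 : ℝ) ^ m ≤ (1 / 2) ^ 6 := pow_le_pow_of_le_one (by norm_num) (by norm_num) hm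
      _ = _ := by norm_num
  -- value at 1/m
  have c1 : (1 - 1 / (m:ℝ)) ^ m + Real.exp 1 * m * (1 / (m:ℝ)) ^ m + 0.0756 * ((m:ℝ) - 1) / m * (1 / m) + (1 / 2) ^ m
      < 1 / Real.exp 1 := by
    have a1 := one_sub_inv_pow (m := m) (by omega)
    have a2 : Real.exp 1 * m * (1 / (m:ℝ)) ^ m = Real.exp 1 / (m:ℝ) ^ (m - 1) := by
      obtain ⟨n, rfl⟩ : ∃ n, m = n + 1 := ⟨m - 1, by omega⟩
      simp only [Nat.add_sub_cancel]
      rw [div_pow, one_pow]; field_simp; ring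
    rw [a2]
    have a3 : (1 / 2 : ℝ) ^ m ≤ 3 / 32 / m := by rw [le_div_iff₀ hm0]; exact q1
    have a4 : 0.0756 / (m:ℝ) ^ 3 + 0.0756 * ((m:ℝ) - 1) / m * (1 / m) + 3 / 32 / m < 0.3678 * (1 / (2 * m + 1)) := by
      rw [show 0.0756 / (m:ℝ) ^ 3 + 0.0756 * ((m:ℝ) - 1) / m * (1 / m) + 3 / 32 / m
        = (0.0756 + 0.0756 * (m - 1) * m + 3 / 32 * m ^ 2) / m ^ 3 by field_simp,
        show (0.3678:ℝ) * (1 / (2 * m + 1)) = 0.3678 / (2 * m + 1) by ring,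
        div_lt_div_iff₀ (by positivity) (by positivity)]
      nlinarith [mul_nonneg (sub_nonneg.2 hm') (sq_nonneg (m:ℝ)), mul_nonneg (sub_nonneg.2 hm') hm0.le]
    have a5 : 0.3678 * (1 / (2 * (m:ℝ) + 1)) ≤ 1 / Real.exp 1 * (1 / (2 * m + 1)) := by
      apply mul_le_mul_of_nonneg_right hie.le; positivity
    linarith
  have c2 : (1 / 2 : ℝ) ^ m + Real.exp 1 * m * (1 / 2) ^ m + 0.0756 * ((m:ℝ) - 1) / m * (1 / 2) + (1 / 2) ^ m
      < 1 / Real.exp 1 := by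
    have a1 : Real.exp 1 * m * (1 / 2) ^ m ≤ 2.7183 * (3 / 32) := by
      rw [mul_assoc, mul_comm (m:ℝ)]
      apply mul_le_mul he.le q1 (by positivity) (by norm_num)
    have a2 : 0.0756 * ((m:ℝ) - 1) / m ≤ 0.0756 := by
      rw [div_le_iff₀ hm0]; linarith
    linarith
  have hc : 0 ≤ Real.exp 1 * m := by positivity
  have p3 := mul_le_mul_of_nonneg_left p2 hc
  set G := 0.0756 * ((m:ℝ) - 1) / m
  set E := Real.exp 1 * m
  set H := (1 / 2 : ℝ) ^ m
  have key : (1 - b) ^ m + E * b ^ m + G * b + H ≤ x * ((1 - 1 / (m:ℝ)) ^ m + E * (1 / (m:ℝ)) ^ m + G * (1 / m) + H)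
      + y * (H + E * H + G * (1 / 2) + H) := by
    have : G * b = x * (G * (1 / m)) + y * (G * (1 / 2)) := by rw [hb]; ring
    have : H = x * H + y * H := by rw [← add_mul, hxy, one_mul]
    linarith
  refine lt_of_le_of_lt key ?_
  rcases hx.eq_or_lt with h | h
  · subst h
    have : y = 1 := by linarith
    subst this; linarith
  · nlinarith

namespace Cfg
variable {k : ℕ} {V : Type*} [Fintype V] (C : Cfg k 1 V)

lemma k5 (C : Cfg k 1 V) : 5 ≤ k := by have := C.hm; omega

lemma K1o (C : Cfg k 1 V) : (k:ℝ) * Gf (k - 1) 1 ≤ 1 := by have := kGf1 C.k5; linarith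

lemma K1i (C : Cfg k 1 V) : ((1:ℕ):ℝ) * Gf k (1 - 1) ≤ 1 := by simp [Gf_zero]

lemma rho_eb (y : V) : C.rho y = C.eX y + C.bY y := by
  classical
  unfold rho eX bY
  rw [mu_split _ C.X]
  congr 1
  · exact mu_congr fun u => and_comm
  · exact mu_congr fun u => and_comm

/-- contribution at a `Y`-vertex of stars centered in `X` -/
lemma MY1 (v : V) : ∑ j, ∑ c, C.w c * Lf C.w (fun f => (star k 1 C.A c f ∧ C.X c) ∧ f j = v) ≤
    C.w v * (Gf k 1 * (1 - C.bY v) ^ (k + 1)) := by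
  classical
  refine (C.MgenK C.K1o C.K1i v (fun c f => star k 1 C.A c f ∧ C.X c) C.X (fun _ _ => True)
    (fun c f h => h.1) (fun c f h => h.2) (fun _ _ _ _ _ _ _ => trivial)).trans ?_
  rw [mul_one]
  apply mul_le_mul_of_nonneg_left _ (C.w0 v)
  have hn : 0 ≤ 1 - C.rho v := by have := C.rho_le v; linarith
  have h1 : (∑ c, if C.X c ∧ adj C.A c v then C.w c * mu C.w (fun u => adj C.A c u ∧ ¬ adj C.A v u ∧ True) ^ (k + 1 - 1) else 0)
      ≤ C.eX v * (1 - C.rho v) ^ k := by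
    unfold eX mu
    rw [Finset.sum_mul]
    refine Finset.sum_le_sum fun c _ => ?_
    by_cases h : C.X c ∧ adj C.A c v
    · rw [if_pos h, if_pos ⟨h.1, C.adj_symm h.2⟩]
      apply mul_le_mul_of_nonneg_left _ (C.w0 c)
      apply pow_le_pow_left₀ (C.mu_nn _)
      have := C.mu_add_not (adj C.A v)
      refine (mu_mono C.w0 (S' := fun u => ¬ adj C.A v u) fun u hu => hu.2.1).trans ?_
      unfold rho; linarith
    · rw [if_neg h, if_neg (fun h' => h ⟨h'.1, C.adj_symm h'.2⟩)]
      simp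
  have h2 := amgm k 1 (p := 1 - C.rho v) (q := C.eX v) (s := 1 - C.bY v) hn (C.mu_nn _)
    (by rw [C.rho_eb]; linarith)
  convert h1.trans ?_ using 1
  rw [mul_comm]; simpa using h2

lemma MY2 (v : V) (hv : C.Y v) (hmaxv : ∀ y, C.Y y → C.bY y ≤ C.bY v) :
    ∑ j, ∑ c, C.w c * Lf C.w (fun f => (star k 1 C.A c f ∧ C.Y c ∧ ∀ i, C.Y (f i)) ∧ f j = v) ≤
    C.w v * C.bY v ^ (k + 1) := by
  classical
  refine (C.MgenK C.K1o C.K1i v (fun c f => star k 1 C.A c f ∧ C.Y c ∧ ∀ i, C.Y (f i)) C.Y (fun _ u => C.Y u)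
    (fun c f h => h.1) (fun c f h => h.2.1) (fun _ _ _ h _ i _ => h.2.2 i)).trans ?_
  rw [mul_one]
  apply mul_le_mul_of_nonneg_left _ (C.w0 v)
  have h1 : (∑ c, if C.Y c ∧ adj C.A c v then C.w c * mu C.w (fun u => adj C.A c u ∧ ¬ adj C.A v u ∧ C.Y u) ^ (k + 1 - 1) else 0)
      ≤ C.bY v * (C.bY v) ^ k := by
    nth_rewrite 1 [bY]
    unfold mu
    rw [Finset.sum_mul]
    refine Finset.sum_le_sum fun c _ => ?_
    by_cases h : C.Y c ∧ adj C.A c v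
    · rw [if_pos h, if_pos ⟨h.1, C.adj_symm h.2⟩]
      apply mul_le_mul_of_nonneg_left _ (C.w0 c)
      apply pow_le_pow_left₀ (C.mu_nn _)
      refine (mu_mono C.w0 (S' := fun u => C.Y u ∧ adj C.A c u) fun u hu => ⟨hu.2.2, hu.1⟩).trans ?_
      exact hmaxv c h.1
    · rw [if_neg h, if_neg (fun h' => h ⟨h'.1, C.adj_symm h'.2⟩)]
      simp
  rw [pow_succ' (C.bY v)]
  convert h1 using 1

lemma MY3 (v : V) (hv : C.Y v) :
    ∑ j, ∑ c, C.w c * Lf C.w (fun f => (star k 1 C.A c f ∧ C.Y c ∧ ∃ i, C.X (f i)) ∧ f j = v) ≤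
    C.w v * (((k + 1 : ℕ):ℝ) * k * C.al * C.bY v * (1 / ((k + 1 : ℕ):ℝ)) ^ (k - 1)) := by
  classical
  set B := (1 / ((k + 1 : ℕ):ℝ)) ^ (k - 1) with hB
  have hB0 : 0 ≤ B := by positivity
  have hj : ∀ j : Fin (k + 1), ∑ c, C.w c * Lf C.w (fun f => (star k 1 C.A c f ∧ C.Y c ∧ ∃ i, C.X (f i)) ∧ f j = v)
      ≤ C.bY v * (k * (C.w v * C.al * B)) := by
    intro j
    have hbe : C.bY v = ∑ c, if C.Y c ∧ adj C.A v c then C.w c else 0 := by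
      unfold bY mu; congr! 
    rw [hbe, Finset.sum_mul]
    refine Finset.sum_le_sum fun c _ => ?_
    by_cases h : C.Y c ∧ adj C.A v c
    · rw [if_pos h]
      apply mul_le_mul_of_nonneg_left _ (C.w0 c)
      have h1 : Lf C.w (fun f => (star k 1 C.A c f ∧ C.Y c ∧ ∃ i, C.X (f i)) ∧ f j = v) ≤
          ∑ i ∈ univ.erase j, Lf C.w (fun f => star k 1 C.A c f ∧ f j = v ∧ C.X (f i)) := by
        apply Lf_union C.w0
        rintro f ⟨⟨h1, h2, i, hi⟩, h4⟩
        refine ⟨i, ?_, h1, h4, hi⟩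
        rw [mem_erase]
        refine ⟨?_, mem_univ _⟩
        rintro rfl
        rw [h4] at hi
        exact hv hi
      refine h1.trans ?_
      have h2 : ∀ i ∈ univ.erase j, Lf C.w (fun f => star k 1 C.A c f ∧ f j = v ∧ C.X (f i)) ≤ C.w v * C.al * B := by
        intro i hi
        have hij : j ≠ i := (ne_of_mem_erase hi).symm
        refine (Lf_two C.w0 j i hij (S := fun x y => x = v ∧ C.X y) (U := fun _ y _ u => ¬ adj C.A y u) ?_).trans ?_
        · rintro f ⟨h1, h2, h3⟩
          exact ⟨⟨h2, h3⟩, fun i' _ _ => C.star_nadj h1 _ _⟩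
        · rw [Finset.sum_eq_single v]
          · have hae : C.al = ∑ y, if C.X y then C.w y else 0 := by
              unfold al mu; congr! 
            rw [hae, mul_assoc, Finset.sum_mul, Finset.mul_sum]
            refine Finset.sum_le_sum fun y _ => ?_
            by_cases hy : C.X y
            · rw [if_pos ⟨rfl, hy⟩, if_pos hy, Finset.prod_const, mul_assoc]
              apply mul_le_mul_of_nonneg_left _ (C.w0 _)
              apply mul_le_mul_of_nonneg_left _ (C.w0 _)
              have hc : ((univ.erase j).erase i).card = k - 1 := by
                rw [card_erase_of_mem hi, card_erase_of_mem (mem_univ _), card_univ, Fintype.card_fin]; omega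
              rw [hc, hB]
              exact pow_le_pow_left₀ (C.mu_nn _) (C.nadjX hy) _
            · simp [hy]
          · intro b _ hb; simp [hb]
          · simp
      refine (Finset.sum_le_sum h2).trans ?_
      rw [Finset.sum_const, card_erase_of_mem (mem_univ _), card_univ, Fintype.card_fin, nsmul_eq_mul]
      simp
    · rw [if_neg h, zero_mul]
      have : Lf C.w (fun f => (star k 1 C.A c f ∧ C.Y c ∧ ∃ i, C.X (f i)) ∧ f j = v) = 0 := by
        unfold Lf
        apply Finset.sum_eq_zero
        intro f _
        rw [if_neg]
        rintro ⟨⟨h1, h2, -⟩, h3⟩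
        apply h
        refine ⟨h2, ?_⟩
        have := C.star_adj h1 j
        rw [h3] at this
        exact this.symm
      rw [this]; simp
  refine (Finset.sum_le_sum fun j _ => hj j).trans (le_of_eq ?_)
  rw [Finset.sum_const, card_univ, Fintype.card_fin, nsmul_eq_mul]
  ring

lemma M_splitY (v : V) : C.M v ≤
    ∑ j, ∑ c, C.w c * Lf C.w (fun f => (star k 1 C.A c f ∧ C.X c) ∧ f j = v) +
    ∑ j, ∑ c, C.w c * Lf C.w (fun f => (star k 1 C.A c f ∧ C.Y c ∧ ∀ i, C.Y (f i)) ∧ f j = v) +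
    ∑ j, ∑ c, C.w c * Lf C.w (fun f => (star k 1 C.A c f ∧ C.Y c ∧ ∃ i, C.X (f i)) ∧ f j = v) := by
  classical
  unfold M
  rw [← Finset.sum_add_distrib, ← Finset.sum_add_distrib]
  refine Finset.sum_le_sum fun j _ => ?_
  rw [← Finset.sum_add_distrib, ← Finset.sum_add_distrib]
  refine Finset.sum_le_sum fun c _ => ?_
  rw [← mul_add, ← mul_add]
  apply mul_le_mul_of_nonneg_left _ (C.w0 c)
  by_cases hc : C.X c
  · have := Lf_mono C.w0 (R := fun f => star k 1 C.A c f ∧ f j = v) (R' := fun f => (star k 1 C.A c f ∧ C.X c) ∧ f j = v)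
      (fun f h => ⟨⟨h.1, hc⟩, h.2⟩)
    have a := Lf_nonneg C.w0 (fun f => (star k 1 C.A c f ∧ C.Y c ∧ ∀ i, C.Y (f i)) ∧ f j = v)
    have b := Lf_nonneg C.w0 (fun f => (star k 1 C.A c f ∧ C.Y c ∧ ∃ i, C.X (f i)) ∧ f j = v)
    linarith
  · have a := Lf_nonneg C.w0 (fun f => (star k 1 C.A c f ∧ C.X c) ∧ f j = v)
    rw [Lf_split (R := fun f => star k 1 C.A c f ∧ f j = v) (Q := fun f => ∀ i, C.Y (f i))]
    have b := Lf_mono C.w0 (R := fun f => (star k 1 C.A c f ∧ f j = v) ∧ ∀ i, C.Y (f i)) (R' := fun f => (star k 1 C.A c f ∧ C.Y c ∧ ∀ i, C.Y (f i)) ∧ f j = v)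
      (fun f h => ⟨⟨h.1.1, hc, h.2⟩, h.1.2⟩)
    have b' := Lf_mono C.w0 (R := fun f => (star k 1 C.A c f ∧ f j = v) ∧ ¬ ∀ i, C.Y (f i)) (R' := fun f => (star k 1 C.A c f ∧ C.Y c ∧ ∃ i, C.X (f i)) ∧ f j = v)
      (fun f h => ⟨⟨h.1.1, hc, by
        obtain ⟨i, hi⟩ := not_forall.1 h.2
        exact ⟨i, not_not.1 hi⟩⟩, h.1.2⟩)
    linarith

lemma inv_l0 (C : Cfg k 1 V) : 1 ≤ Real.exp 1 * ((k + 1 : ℕ):ℝ) * Gf k 1 := by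
  have := Gf_stepi (k := k) (l := 1) le_rfl
  simpa [Gf_zero] using this

theorem bY_small {y : V} (hy : C.Y y) : C.bY y ≤ 1 / ((k + 1 : ℕ):ℝ) := by
  classical
  by_contra hcon
  push Not at hcon
  obtain ⟨v, hv, hmaxv⟩ := Finset.exists_max_image (univ.filter C.Y) C.bY ⟨y, by simp [hy]⟩
  have hv' : C.Y v := by simpa using hv
  have hmaxv' : ∀ y, C.Y y → C.bY y ≤ C.bY v := fun y hy => hmaxv y (by simp [hy])
  set b := C.bY v with hb
  have hb1 : 1 / ((k + 1 : ℕ):ℝ) ≤ b := hcon.le.trans (hmaxv' y hy)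
  have hb2 : b ≤ 1 / 2 := (C.bY_le v).trans (C.rhoY hv').le
  have hb0 : 0 ≤ b := C.bY_nn v
  have h1 := C.lagrange v
  have h2 := C.M_splitY v
  have h3 := C.MY1 v
  have h4 := C.MY2 v hv' hmaxv'
  have h5 := C.MY3 v hv'
  have hs := C.sc_le' v
  have hmm := C.mm6
  have hw := C.wpos v
  set m : ℝ := ((k + 1 : ℕ):ℝ) with hm
  have hr : C.rho v ^ (k + 1) ≤ (1 / 2) ^ (k + 1) := pow_le_pow_left₀ (C.rho_nn v) (C.rhoY hv').le _
  have g0 := Gf_pos k 1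
  have hs' : C.sc v ≤ Gf k 1 * (1 / 2) ^ (k + 1) := hs.trans (mul_le_mul_of_nonneg_left hr g0.le)
  have h6 : (m + 1) * C.t ≤ Gf k 1 * (1 / 2) ^ (k + 1) + Gf k 1 * (1 - b) ^ (k + 1) + b ^ (k + 1)
      + m * k * C.al * b * (1 / m) ^ (k - 1) := by
    have : C.w v * ((m + 1) * C.t) ≤ C.w v * (Gf k 1 * (1 / 2) ^ (k + 1) + Gf k 1 * (1 - b) ^ (k + 1) + b ^ (k + 1)
      + m * k * C.al * b * (1 / m) ^ (k - 1)) := by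
      have := mul_le_mul_of_nonneg_left hs' hw.le
      nlinarith
    exact le_of_mul_le_mul_left this hw
  have h7 := C.t_sg
  have hinv := C.inv_l0
  have hal := C.al_le'
  have t1 := C.tau1
  have t2 := C.tau2
  have e0 := Real.exp_pos 1
  have hm0 : 0 < m := by linarith
  have hk : (k:ℝ) = m - 1 := by rw [hm]; push_cast; ring
  rw [show k + 1 - 2 = k - 1 by omega] at t1
  have i1 : b ^ (k + 1) ≤ Gf k 1 * (Real.exp 1 * m * b ^ (k + 1)) := by
    have := mul_le_mul_of_nonneg_right hinv (pow_nonneg hb0 (k + 1))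
    linarith
  have i2 : m * k * C.al * b * (1 / m) ^ (k - 1) ≤ Gf k 1 * (0.0756 * (m - 1) / m * b) := by
    have j1 : m * C.al ≤ 1 := by rw [le_div_iff₀ hm0] at hal; linarith
    have j0 : 0 ≤ (k:ℝ) * b * (1 / m) ^ (k - 1) := by positivity
    have j2 : m * k * C.al * b * (1 / m) ^ (k - 1) ≤ k * b * (1 / m) ^ (k - 1) := by
      have := mul_le_mul_of_nonneg_right j1 j0
      linarith
    have j3 : (k:ℝ) * b * (1 / m) ^ (k - 1) ≤ (Real.exp 1 * m * Gf k 1) * (k * b * (1 / m) ^ (k - 1)) := by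
      have := mul_le_mul_of_nonneg_right hinv j0
      linarith
    have j4 : (Real.exp 1 * m * Gf k 1) * (k * b * (1 / m) ^ (k - 1)) = (Gf k 1 * m * k * b) * (Real.exp 1 / m ^ (k - 1)) := by
      rw [div_pow, one_pow]; ring
    have j5 : (Gf k 1 * m * k * b) * (Real.exp 1 / m ^ (k - 1)) ≤ (Gf k 1 * m * k * b) * (0.0756 / m ^ 2) :=
      mul_le_mul_of_nonneg_left t1 (by positivity)
    have j6 : (Gf k 1 * m * k * b) * (0.0756 / m ^ 2) = Gf k 1 * (0.0756 * (m - 1) / m * b) := by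
      rw [hk]; field_simp
    linarith
  have h8 : Gf k 1 * C.sg ≤ Gf k 1 * ((1 - b) ^ (k + 1) + Real.exp 1 * m * b ^ (k + 1) + 0.0756 * (m - 1) / m * b + (1 / 2) ^ (k + 1)) := by
    linarith
  have h9 := le_of_mul_le_mul_left h8 g0
  have h10 := beta_an C.hm hb1 hb2 t2
  have h11 := C.sg_ge'
  linarith

end Cfg
end OStar

namespace OStar
open Finset

lemma r_pow {m : ℕ} (hm : 6 ≤ m) : (m:ℝ) ^ 2 * (m + 1) * (0.311:ℝ) ^ m ≤ 0.2281 := by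
  induction m, hm using Nat.le_induction with
  | base => norm_num
  | succ n hn ih =>
    have hn' : (6:ℝ) ≤ n := by exact_mod_cast hn
    have hp : (0:ℝ) < 0.311 ^ n := by positivity
    have : (((n + 1 : ℕ):ℝ) ^ 2 * (((n + 1 : ℕ):ℝ) + 1)) * 0.311 ≤ (n:ℝ) ^ 2 * (n + 1) := by
      push_cast
      nlinarith [mul_nonneg (sub_nonneg.2 hn') (sq_nonneg (n:ℝ)), mul_nonneg (sub_nonneg.2 hn') (sub_nonneg.2 hn')]
    calc _ = (((n + 1 : ℕ):ℝ) ^ 2 * (((n + 1 : ℕ):ℝ) + 1)) * 0.311 * 0.311 ^ n := by rw [pow_succ]; ring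
      _ ≤ (n:ℝ) ^ 2 * (n + 1) * 0.311 ^ n := mul_le_mul_of_nonneg_right this hp.le
      _ ≤ _ := ih

lemma u_low {u m : ℝ} (hm : 6 ≤ m) (hu : 0 ≤ u) (h : 1 - 0.8601 / m ^ 2 ≤ u * Real.exp (1 - u)) : 0.5 ≤ u := by
  by_contra hc
  push Not at hc
  have h1 : Real.exp (1 - u) ≤ 2.7183 / (1 + u) := by
    rw [Real.exp_sub]
    have := Real.add_one_le_exp u
    have e1 := e_hi
    gcongr
    linarith
  have h2 : u * Real.exp (1 - u) ≤ u * (2.7183 / (1 + u)) := mul_le_mul_of_nonneg_left h1 hu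
  have h3 : u * (2.7183 / (1 + u)) ≤ 2.7183 / 3 := by
    rw [← mul_div_assoc, div_le_div_iff₀ (by linarith) (by norm_num)]; linarith
  have h4 : 0.8601 / m ^ 2 ≤ 0.8601 / 36 := by gcongr; nlinarith
  norm_num at h3 h4 h
  linarith

lemma u_high {u m : ℝ} (hm : 6 ≤ m) (h : 1 - 0.8601 / m ^ 2 ≤ u * Real.exp (1 - u)) : u ≤ 1 + 1.5 / m := by
  by_contra hc
  push Not at hc
  have hm0 : 0 < m := by linarith
  set s := 1.5 / m with hs
  have hs0 : 0 < s := by positivity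
  have hs1 : s ≤ 0.25 := by rw [hs, div_le_iff₀ hm0]; linarith
  obtain ⟨v, rfl⟩ : ∃ v, u = 1 + v := ⟨u - 1, by ring⟩
  have hv : s < v := by linarith
  have hv0 : 0 < v := hs0.trans hv
  set ξ := 0.8601 / m ^ 2 with hξ
  have hξ2 : ξ = 0.8601 / 2.25 * s ^ 2 := by rw [hξ, hs]; field_simp; norm_num
  have h1 : Real.exp (1 - (1 + v)) ≤ 1 / (1 + v + v ^ 2 / 2) := by
    rw [show 1 - (1 + v) = -v by ring, Real.exp_neg, ← one_div]
    have := Real.quadratic_le_exp_of_nonneg hv0.le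
    gcongr
  have h2 : (1 + v) * Real.exp (1 - (1 + v)) ≤ (1 + v) * (1 / (1 + v + v ^ 2 / 2)) :=
    mul_le_mul_of_nonneg_left h1 (by linarith)
  have h3 := h.trans h2
  rw [← mul_div_assoc, mul_one, le_div_iff₀ (by positivity)] at h3
  have h4 : s ^ 2 * (1 + v) ≤ v ^ 2 * (1 + s) := by nlinarith [mul_pos hs0 hv0]
  have hξ0 : 0 < ξ := by positivity
  have hξ1 : ξ ≤ 0.0239 := by rw [hξ2]; nlinarith
  have h5 : (1 - ξ) * v ^ 2 ≤ 2 * ξ * (1 + v) := by nlinarith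
  have h6 : (1 - ξ) * (s ^ 2 * (1 + v)) ≤ 2 * ξ * (1 + v) * (1 + s) := by
    have a := mul_le_mul_of_nonneg_left h4 (by linarith : 0 ≤ 1 - ξ)
    have b := mul_le_mul_of_nonneg_right h5 (by linarith : 0 ≤ 1 + s)
    linarith
  have h7 : (1 - ξ) * s ^ 2 ≤ 2 * ξ * (1 + s) := by
    have : (1 + v) * ((1 - ξ) * s ^ 2) ≤ (1 + v) * (2 * ξ * (1 + s)) := by linarith
    exact le_of_mul_le_mul_left this (by linarith)
  have h8 : s ^ 2 * (1 - ξ) ≤ s ^ 2 * (2 * (0.8601 / 2.25) * (1 + s)) := by rw [hξ2] at h7 ⊢; linarith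
  have h9 := le_of_mul_le_mul_left h8 (by positivity)
  norm_num at h9 hs1 hξ1
  linarith

namespace Cfg
variable {k : ℕ} {V : Type*} [Fintype V] (C : Cfg k 1 V)

lemma rhoY311 {y : V} (hy : C.Y y) : C.rho y ≤ 0.311 := by
  have h1 := C.bY_small hy
  have h2 := C.eX_le y
  have h3 := C.al_le
  have hm := C.mm6
  rw [C.rho_eb]
  have h4 : 1.01 / (((k + 1 : ℕ):ℝ) + 1) ≤ 1.01 / 7 := by gcongr; linarith
  have h5 : 1 / ((k + 1 : ℕ):ℝ) ≤ 1 / 6 := by gcongr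
  have h6 := h3.trans h4
  have h7 := h1.trans h5
  norm_num at h6 h7 ⊢
  linarith

lemma al1 : 1 - 0.6203 / ((k + 1 : ℕ):ℝ) ^ 2 ≤ C.al * (((k + 1 : ℕ):ℝ) + 1) := by
  have h := C.al_lower (r := 0.311) (fun y hy => C.rhoY311 hy)
  have hr := r_pow C.hm
  have hm := C.mm6
  have hs := C.sg_ge'
  have e0 := Real.exp_pos 1
  have e1 := e_hi
  have ha := C.al_nn
  set m : ℝ := ((k + 1 : ℕ):ℝ)
  have hp : (0:ℝ) < 0.311 ^ (k + 1) := by positivity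
  have hs0 : 0 < C.sg := lt_of_lt_of_le (by positivity) hs
  rw [div_le_iff₀ e0] at hs
  -- sg * (1 - α(m+1)) ≤ (m+1) r^m
  have h1 : C.sg * (1 - C.al * (m + 1)) ≤ (m + 1) * 0.311 ^ (k + 1) := by
    have : 0 ≤ C.al * (m + 1) * 0.311 ^ (k + 1) := by positivity
    linarith
  have h2 : (m + 1) * 0.311 ^ (k + 1) ≤ 0.2281 / m ^ 2 := by
    rw [le_div_iff₀ (by positivity)]; linarith
  have h3 : 0.2281 / m ^ 2 ≤ C.sg * (0.6203 / m ^ 2) := by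
    have : 0.2281 ≤ C.sg * 0.6203 := by nlinarith
    calc 0.2281 / m ^ 2 ≤ (C.sg * 0.6203) / m ^ 2 := by gcongr
      _ = _ := by ring
  have h4 : C.sg * (1 - C.al * (m + 1)) ≤ C.sg * (0.6203 / m ^ 2) := by linarith
  have := le_of_mul_le_mul_left h4 hs0
  linarith

lemma u_exp {x : V} (hx : C.X x) : 1 - 0.8601 / ((k + 1 : ℕ):ℝ) ^ 2 ≤
    ((((k + 1 : ℕ):ℝ) + 1) * C.QQ x) * Real.exp (1 - (((k + 1 : ℕ):ℝ) + 1) * C.QQ x) := by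
  have h := C.PQ_ge' hx
  have h1 := C.al1
  have h2 := C.PQm x
  have hs := C.sg_ge'
  have hs2 := C.sg_ge
  have t1 := C.tau1
  have t2 := C.tau2
  have hm := C.mm6
  have hP := C.PP_nn x
  have hQ := C.QQ_nn x
  have hM := C.miss_nn x
  have e0 := Real.exp_pos 1
  have e1 := e_hi
  have hk : (k:ℝ) = ((k + 1 : ℕ):ℝ) - 1 := by push_cast; ring
  set T1 := Real.exp 1 / ((k + 1 : ℕ):ℝ) ^ (k + 1 - 2)
  set T2 := Real.exp 1 / ((k + 1 : ℕ):ℝ) ^ (k + 1 - 1)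
  have hG : Gf k 1 = (k:ℝ) ^ k / ((k + 1 : ℕ):ℝ) ^ (k + 1) := by unfold Gf; push_cast; simp
  set m : ℝ := ((k + 1 : ℕ):ℝ)
  set P := C.PP x
  set Q := C.QQ x
  have hm0 : 0 < m := by linarith
  have hk0 : (0:ℝ) < k := by linarith
  set η := 0.6203 / m ^ 2 with hη
  have hT : T1 + T2 ≤ 0.0882 / m ^ 2 := by
    have : 0.0756 / m ^ 3 ≤ 0.0126 / m ^ 2 := by
      rw [div_le_div_iff₀ (by positivity) (by positivity)]; nlinarith [pow_pos hm0 2, pow_pos hm0 3]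
    have : 0.0756 / m ^ 2 + 0.0126 / m ^ 2 = 0.0882 / m ^ 2 := by ring
    linarith
  set u := (m + 1) * Q with hu
  have hu0 : 0 ≤ u := by positivity
  -- P^k bound
  have p1 : (m + 1) * P / k ≤ Real.exp ((1 + η - u) / k) := by
    have a : (m + 1) * P / k ≤ (1 + η - u) / k + 1 := by
      rw [div_le_iff₀ hk0, add_mul ((1 + η - u) / (k:ℝ)), div_mul_cancel₀ _ hk0.ne']
      nlinarith
    exact a.trans (Real.add_one_le_exp _)
  have p2 : ((m + 1) * P / k) ^ k ≤ Real.exp (1 + η - u) := by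
    calc _ ≤ (Real.exp ((1 + η - u) / k)) ^ k := pow_le_pow_left₀ (by positivity) p1 _
      _ = _ := by rw [← Real.exp_nat_mul]; congr 1; field_simp
  -- lower bound
  have q0 : 0 < C.sg := lt_of_lt_of_le (by positivity) hs
  have q1 : 1 - 0.2398 / m ^ 2 ≤ (C.sg - T1 - T2) / C.sg := by
    rw [le_div_iff₀ q0]
    have a : 1 ≤ Real.exp 1 * C.sg := by rw [div_le_iff₀ e0] at hs; linarith
    have b : 0.0882 / m ^ 2 ≤ 0.2398 / m ^ 2 * C.sg := by
      have : (0.0882:ℝ) ≤ 0.2398 * C.sg := by nlinarith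
      calc 0.0882 / m ^ 2 ≤ (0.2398 * C.sg) / m ^ 2 := by gcongr
        _ = _ := by ring
    linarith
  have q2 : (k:ℝ) ^ k / (m + 1) ^ (k + 1) ≤ Gf k 1 * C.sg := by
    calc (k:ℝ) ^ k / (m + 1) ^ (k + 1) = Gf k 1 * (m ^ (k + 1) / (m + 1) ^ (k + 1)) := by
          rw [hG]; field_simp
      _ ≤ _ := mul_le_mul_of_nonneg_left hs2 (Gf_nonneg _ _)
  have hε : 0.2398 / m ^ 2 ≤ 0.2398 / 36 := by gcongr; nlinarith
  have q3 : (k:ℝ) ^ k / (m + 1) ^ (k + 1) * (1 - 0.2398 / m ^ 2) ≤ P ^ k * Q := by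
    calc _ ≤ Gf k 1 * C.sg * ((C.sg - T1 - T2) / C.sg) :=
          mul_le_mul q2 q1 (by norm_num at hε ⊢; linarith) (mul_nonneg (Gf_nonneg _ _) q0.le)
      _ = Gf k 1 * (C.sg - T1 - T2) := by field_simp
      _ ≤ _ := by simpa using h
  have q4 : 1 - 0.2398 / m ^ 2 ≤ ((m + 1) * P / k) ^ k * u := by
    have hc : (0:ℝ) < (m + 1) ^ (k + 1) / (k:ℝ) ^ k := by positivity
    have := mul_le_mul_of_nonneg_left q3 hc.le
    calc _ = (m + 1) ^ (k + 1) / (k:ℝ) ^ k * ((k:ℝ) ^ k / (m + 1) ^ (k + 1) * (1 - 0.2398 / m ^ 2)) := by field_simp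
      _ ≤ _ := this
      _ = _ := by rw [div_pow, mul_pow, hu]; ring
  have q5 : 1 - 0.2398 / m ^ 2 ≤ Real.exp (1 + η - u) * u := q4.trans (mul_le_mul_of_nonneg_right p2 hu0)
  have q6 : Real.exp (1 + η - u) = Real.exp η * Real.exp (1 - u) := by rw [← Real.exp_add]; congr 1; ring
  have q7 : (1 - η) * Real.exp η ≤ 1 := by
    have := Real.one_sub_le_exp_neg η
    calc _ ≤ Real.exp (-η) * Real.exp η := mul_le_mul_of_nonneg_right this (Real.exp_pos _).le
      _ = 1 := by rw [← Real.exp_add]; simp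
  have hη1 : η ≤ 0.6203 / 36 := by rw [hη]; gcongr; nlinarith
  have q8 : (1 - η) * (1 - 0.2398 / m ^ 2) ≤ u * Real.exp (1 - u) := by
    rw [q6] at q5
    have a := mul_le_mul_of_nonneg_left q5 (by norm_num at hη1 ⊢; linarith : 0 ≤ 1 - η)
    have b := mul_le_mul_of_nonneg_right q7 (by positivity : 0 ≤ u * Real.exp (1 - u))
    linarith
  have hη0 : 0 ≤ η := by positivity
  have : η + 0.2398 / m ^ 2 = 0.8601 / m ^ 2 := by rw [hη]; ring
  have : 0 ≤ η * (0.2398 / m ^ 2) := by positivity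
  linarith

lemma Q_low {x : V} (hx : C.X x) : 0.495 * C.al ≤ C.QQ x := by
  have h := u_low C.mm6 (by have := C.QQ_nn x; positivity) (C.u_exp hx)
  have h2 := C.al_le
  have hm := C.mm6
  rw [le_div_iff₀ (by positivity)] at h2
  have : (((k + 1 : ℕ):ℝ) + 1) * (0.495 * C.al) ≤ (((k + 1 : ℕ):ℝ) + 1) * C.QQ x := by
    norm_num at h2 h ⊢; linarith
  exact le_of_mul_le_mul_left this (by positivity)

lemma Q_high {x : V} (hx : C.X x) : (((k + 1 : ℕ):ℝ) + 1) * C.QQ x ≤ 1 + 1.5 / ((k + 1 : ℕ):ℝ) :=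
  u_high C.mm6 (C.u_exp hx)

end Cfg
end OStar

namespace OStar
open Finset
namespace Cfg
variable {k : ℕ} {V : Type*} [Fintype V] (C : Cfg k 1 V)

/-- half of lambda -/
noncomputable def dl (_C : Cfg k 1 V) : ℝ := Gf (k - 1) 1 / 2

lemma lam_le (C : Cfg k 1 V) : Gf (k - 1) 1 ≤ 0.08192 := by
  have h := kGf1 C.k5
  have : (5:ℝ) ≤ k := by exact_mod_cast C.k5
  have g := Gf_nonneg (k - 1) 1
  nlinarith

/-- out-weight into `X` -/
noncomputable def gX (y : V) : ℝ := mu C.w (fun u => C.A y u ∧ C.X u)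

/-- the exceptional set of `Y`-vertices -/
def QS (y : V) : Prop := C.Y y ∧ (1 - C.dl) * C.al ≤ C.gX y

noncomputable def qq : ℝ := mu C.w C.QS

noncomputable def GQ (x : V) : ℝ := mu C.w (fun c => C.QS c ∧ C.A c x)
noncomputable def Qst (x : V) : ℝ := mu C.w (fun c => (C.Y c ∧ ¬ C.QS c) ∧ C.A c x)

lemma GQ_Qst (x : V) : C.QQ x = C.GQ x + C.Qst x := by
  classical
  unfold QQ GQ Qst
  rw [mu_split _ C.QS]
  congr 1
  · exact mu_congr fun u => ⟨fun h => ⟨h.2, h.1.1⟩, fun h => ⟨⟨h.2, h.1.1⟩, h.1⟩⟩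
  · exact mu_congr fun u => by tauto

lemma GQ_nn (x : V) : 0 ≤ C.GQ x := C.mu_nn _
lemma Qst_nn (x : V) : 0 ≤ C.Qst x := C.mu_nn _
lemma qq_nn : 0 ≤ C.qq := C.mu_nn _
lemma GQ_le (x : V) : C.GQ x ≤ C.qq := mu_mono C.w0 fun _ h => h.1
lemma gX_nn (x : V) : 0 ≤ C.gX x := C.mu_nn _
lemma gX_le (x : V) : C.gX x ≤ C.al := mu_mono C.w0 fun _ h => h.2

open scoped Classical in
lemma sum_gX : (∑ c, if C.QS c then C.w c * C.gX c else 0) = C.SX C.GQ := by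
  have h := sum_mu_swap (w := C.w) C.QS (fun c x => C.A c x ∧ C.X x) (fun _ => 1)
  simp only [mul_one, one_mul] at h
  have h1 : (∑ c, if C.QS c then C.w c * C.gX c else 0) =
    ∑ c, if C.QS c then C.w c * (∑ x, if C.A c x ∧ C.X x then C.w x else 0) else 0 := by
    unfold gX mu; congr!
  rw [h1]
  refine Eq.trans ?_ (h.trans ?_)
  · congr!
  · unfold SX
    refine Finset.sum_congr rfl fun x _ => ?_
    by_cases hx : C.X x
    · rw [if_pos hx]; unfold GQ; congr 1; exact mu_congr fun c => by tauto
    · rw [if_neg hx]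
      have : mu C.w (fun c => C.QS c ∧ C.A c x ∧ C.X x) = 0 := by
        unfold mu; apply Finset.sum_eq_zero; intro c _; rw [if_neg]; tauto
      rw [this, mul_zero]

lemma q_le : C.qq * ((1 - C.dl) * C.al) ≤ C.SX C.GQ := by
  classical
  rw [← C.sum_gX]
  unfold qq mu
  rw [Finset.sum_mul]
  refine Finset.sum_le_sum fun c _ => ?_
  by_cases h : C.QS c
  · rw [if_pos h, if_pos h]; exact mul_le_mul_of_nonneg_left h.2 (C.w0 c)
  · simp [h]

lemma LX_QS {c : V} (hc : C.QS c) : C.LX c ≤ Gf (k - 1) 1 * C.al ^ k * C.gX c - 0.479 * Gf (k - 1) 1 * C.al ^ (k + 1) := by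
  have h1 := C.LX_pq c
  have h2 := (C.gh_le c).trans (C.eX_le c)
  have h3 := hc.2
  have hl := C.lam_le
  have hl0 := Gf_nonneg (k - 1) 1
  have ha := C.al_nn
  have hg0 := C.gX_nn c
  have hg1 := C.gX_le c
  change C.LX c ≤ C.gX c ^ k * _ ^ 1 at h1
  change C.gX c + _ ≤ _ at h2
  set g := C.gX c
  set h := mu C.w (fun u => C.A u c ∧ C.X u)
  have hh0 : 0 ≤ h := C.mu_nn _
  unfold dl at h3
  set L := Gf (k - 1) 1
  rw [pow_one] at h1
  obtain ⟨n, hn⟩ : ∃ n, k = n + 1 := ⟨k - 1, by have := C.k5; omega⟩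
  have hk : k = n + 1 := hn
  have hpw : ∀ z : ℝ, z ^ k = z ^ n * z := fun z => by rw [hk, pow_succ]
  have e1 : g ^ k ≤ C.al ^ n * g := by
    rw [hpw]; exact mul_le_mul_of_nonneg_right (pow_le_pow_left₀ hg0 hg1 n) hg0
  have hd : h ≤ L / 2 * C.al := by linarith
  have e2 : g ^ k * h ≤ (C.al ^ n * g) * (L / 2 * C.al) := mul_le_mul e1 hd hh0 (by positivity)
  have e3 : (C.al ^ n * g) * (L / 2 * C.al) = L / 2 * C.al ^ k * g := by rw [hpw]; ring
  have hp : 0 ≤ C.al ^ k := by positivity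
  have e4 : L / 2 * C.al ^ k * ((1 - L / 2) * C.al) ≤ L / 2 * C.al ^ k * g := mul_le_mul_of_nonneg_left h3 (by positivity)
  have e5 : 0.479 * L * C.al ^ (k + 1) ≤ L / 2 * C.al ^ k * ((1 - L / 2) * C.al) := by
    have : 0 ≤ L * C.al ^ (k + 1) := by positivity
    rw [pow_succ] at this ⊢
    nlinarith
  linarith

lemma T1_l1 : C.T1 ≤ C.SX (fun x => Gf (k - 1) 1 * ((C.al - C.eX x) ^ k * (C.Qst x + C.eX x)) + Gf (k - 1) 1 * C.al ^ k * C.GQ x)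
    - 0.479 * Gf (k - 1) 1 * C.al ^ (k + 1) * C.qq := by
  classical
  have h0 : C.T1 = (∑ c, if ¬ C.QS c then C.w c * C.LX c else 0) + ∑ c, if C.QS c then C.w c * C.LX c else 0 := by
    unfold T1
    rw [← Finset.sum_add_distrib]
    refine Finset.sum_congr rfl fun c _ => ?_
    by_cases h : C.QS c <;> simp [h, LX]
  have h1 := C.T1_one (fun c => ¬ C.QS c)
  have h2 : C.SX (fun x => Gf (k - 1) 1 * ((C.al - C.eX x) ^ (k + 1 - 1) * mu C.w (fun c => ¬ C.QS c ∧ C.A c x))) ≤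
      C.SX (fun x => Gf (k - 1) 1 * ((C.al - C.eX x) ^ k * (C.Qst x + C.eX x))) := by
    apply C.SX_mono
    intro x hx
    apply mul_le_mul_of_nonneg_left _ (Gf_nonneg _ _)
    rw [Nat.add_sub_cancel]
    apply mul_le_mul_of_nonneg_left _ (pow_nonneg (by have := C.eX_le x; linarith) _)
    apply mu_union C.w0
    intro c hc
    by_cases hX : C.X c
    · right; exact ⟨hX, Or.inr hc.2⟩
    · left; exact ⟨⟨hX, hc.1⟩, hc.2⟩
  have h3 : (∑ c, if C.QS c then C.w c * C.LX c else 0) ≤ Gf (k - 1) 1 * C.al ^ k * (∑ c, if C.QS c then C.w c * C.gX c else 0)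
      - 0.479 * Gf (k - 1) 1 * C.al ^ (k + 1) * C.qq := by
    unfold qq
    nth_rewrite 1 [mu]
    rw [Finset.mul_sum, Finset.mul_sum, ← Finset.sum_sub_distrib]
    refine Finset.sum_le_sum fun c _ => ?_
    by_cases h : C.QS c
    · simp only [if_pos h]
      have := mul_le_mul_of_nonneg_left (C.LX_QS h) (C.w0 c)
      linarith
    · simp [h]
  rw [C.sum_gX] at h3
  rw [C.SX_add, C.SX_smul (Gf (k - 1) 1 * C.al ^ k)]
  have h1' : (∑ c, if ¬ C.QS c then C.w c * C.LX c else 0) ≤ _ := le_trans (le_of_eq (by congr!)) h1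
  linarith

/-- bad adjacent pairs -/
def Wr (u v : V) : Prop := C.Y u ∧ C.Y v ∧ adj C.A u v ∧ ¬ (C.QS u ∧ C.QS v)

noncomputable def WW : ℝ := mu2 C.w C.Wr

lemma WW_nn : 0 ≤ C.WW := mu2_nonneg C.w0 _

lemma D2_le : (open scoped Classical in ∑ c, if C.QS c then C.w c * Lf C.w (fun f => star k 1 C.A c f ∧ ∀ i, C.QS (f i)) else 0)
    ≤ C.t * C.qq ^ (k + 1 + 1) := by
  classical
  have h := C.hmax (fun v => if C.QS v then C.w v else 0) (fun v => by split_ifs; exacts [C.w0 v, le_rfl])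
  refine le_trans (le_of_eq ?_) (h.trans (le_of_eq ?_))
  · unfold TT
    refine Finset.sum_congr rfl fun c _ => ?_
    by_cases hc : C.QS c
    · simp only [if_pos hc]
      congr 1
      unfold Lf
      refine Finset.sum_congr rfl fun f _ => ?_
      by_cases hs : star k 1 C.A c f
      · by_cases hf : ∀ i, C.QS (f i)
        · rw [if_pos ⟨hs, hf⟩, if_pos hs]
          exact Finset.prod_congr rfl fun i _ => by simp [hf i]
        · rw [if_neg (fun h => hf h.2), if_pos hs]
          obtain ⟨i, hi⟩ := not_forall.1 hf
          exact (Finset.prod_eq_zero (mem_univ i) (by simp [hi])).symm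
      · rw [if_neg hs, if_neg (fun h => hs h.1)]
    · simp [hc]
  · rfl

lemma D1_le : C.SY C.AA ≤ C.t * C.qq ^ (k + 1 + 1) + (1 / ((k + 1 : ℕ):ℝ)) ^ k * C.WW := by
  classical
  set B := (1 / ((k + 1 : ℕ):ℝ)) ^ k with hB
  have hB0 : 0 ≤ B := by positivity
  have h2 := C.D2_le
  have hW : (∑ c, if C.Y c then C.w c * mu C.w (C.Wr c) else 0) = C.WW := by
    rw [WW, ← mu2_fst]; exact mu2_congr fun u v => by unfold Wr; tauto
  refine le_trans ?_ (add_le_add h2 (le_of_eq (congrArg (fun z => B * z) hW)))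
  rw [Finset.mul_sum, ← Finset.sum_add_distrib]
  unfold SY
  refine Finset.sum_le_sum fun c _ => ?_
  by_cases hY : C.Y c
  swap
  · rw [if_neg hY, if_neg (fun h => hY h.1), if_neg hY]; simp
  rw [if_pos hY, if_pos hY]
  have hpow : ∀ S : V → Prop, (∀ u, S u → C.Y u ∧ adj C.A c u) → mu C.w S ^ k ≤ B := by
    intro S hS
    apply pow_le_pow_left₀ (C.mu_nn _)
    exact (mu_mono C.w0 hS).trans (C.bY_small hY)
  by_cases hQ : C.QS c
  · rw [if_pos hQ, mul_left_comm, ← mul_add]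
    apply mul_le_mul_of_nonneg_left _ (C.w0 c)
    unfold AA
    rw [Lf_split (R := fun f => star k 1 C.A c f ∧ ∀ i, C.Y (f i)) (Q := fun f => ∀ i, C.QS (f i))]
    apply add_le_add
    · exact Lf_mono C.w0 fun f h => ⟨h.1.1, h.2⟩
    · have a1 : Lf C.w (fun f => (star k 1 C.A c f ∧ ∀ i, C.Y (f i)) ∧ ¬ ∀ i, C.QS (f i)) ≤
          ∑ j, Lf C.w (fun f => (star k 1 C.A c f ∧ ∀ i, C.Y (f i)) ∧ (C.Y (f j) ∧ ¬ C.QS (f j))) := by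
        apply Lf_union C.w0
        rintro f ⟨h1, h2⟩
        obtain ⟨i, hi⟩ := not_forall.1 h2
        exact ⟨i, mem_univ _, h1, h1.2 i, hi⟩
      have a2 := C.CgenK C.K1o C.K1i c (fun f => star k 1 C.A c f ∧ ∀ i, C.Y (f i)) (fun u => C.Y u ∧ ¬ C.QS u)
        (fun _ u => C.Y u) (fun f h => h.1) (fun j f h _ i _ => h.2 i)
      refine a1.trans (a2.trans ?_)
      rw [one_mul]
      unfold mu
      rw [Finset.mul_sum]
      refine Finset.sum_le_sum fun x _ => ?_
      by_cases hx : (C.Y x ∧ ¬ C.QS x) ∧ adj C.A c x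
      · have hw : C.Wr c x := ⟨hY, hx.1.1, hx.2, fun h => hx.1.2 h.2⟩
        rw [if_pos hx, if_pos hw, mul_comm]
        apply mul_le_mul_of_nonneg_right _ (C.w0 x)
        exact hpow _ fun u hu => ⟨hu.2.2, hu.1⟩
      · rw [if_neg hx]
        exact mul_nonneg hB0 (by split_ifs; exacts [C.w0 x, le_rfl])
  · rw [if_neg hQ, zero_add, mul_left_comm]
    apply mul_le_mul_of_nonneg_left _ (C.w0 c)
    have a1 := C.AA_bY c
    have a2 : mu C.w (C.Wr c) = C.bY c := mu_congr fun u => by unfold Wr; tauto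
    rw [a2]
    refine a1.trans ?_
    have a3 : C.bY c ^ k ≤ B := hpow _ fun u h => h
    have hb := C.bY_nn c
    have g1 : Gf k 1 ≤ 1 := by
      have h1 := Gf1_step (k := k) C.hk
      have h2 := kGf1 C.k5
      have : (0:ℝ) ≤ k := by positivity
      have g := Gf_nonneg k 1
      nlinarith
    calc Gf k 1 * C.bY c ^ (k + 1) ≤ 1 * (B * C.bY c) := by
          rw [pow_succ]
          exact mul_le_mul g1 (mul_le_mul_of_nonneg_right a3 hb) (by positivity) (by norm_num)
      _ = _ := one_mul _

/-- edges in the neighbourhood other than in-in -/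
noncomputable def EP (x : V) : ℝ := mu2 C.w (fun u v => (C.A x u ∧ C.Y u) ∧ (C.A x v ∧ C.Y v) ∧ adj C.A u v)
  + 2 * mu2 C.w (fun u v => (C.A x u ∧ C.Y u) ∧ (C.A v x ∧ C.Y v) ∧ adj C.A u v)

lemma AA_le1 {x : V} (hx : C.X x) : C.AA x ≤ C.PP x ^ k * C.QQ x ^ 1 - 0.36 * Gf k 1 * C.EP x := by
  classical
  have hpp := pat_pp (k := k) (l := 1) (by have := C.k5; omega) C.w0
    (R := fun f => star k 1 C.A x f ∧ ∀ i, C.Y (f i)) (Sp := fun u => C.A x u ∧ C.Y u) (Sq := fun u => C.A u x ∧ C.Y u)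
    (T := fun u v => ¬ adj C.A u v)
    (fun f h => ⟨fun i => ⟨fun hi => ⟨(h.1.1 i).1 hi, h.2 i⟩, fun hi => ⟨(h.1.1 i).2 hi, h.2 i⟩⟩, fun i j => C.star_nadj h.1 i j⟩)
  have hpq := pat_pq (k := k) (l := 1) C.hk le_rfl C.w0
    (R := fun f => star k 1 C.A x f ∧ ∀ i, C.Y (f i)) (Sp := fun u => C.A x u ∧ C.Y u) (Sq := fun u => C.A u x ∧ C.Y u)
    (T := fun u v => ¬ adj C.A u v)
    (fun f h => ⟨fun i => ⟨fun hi => ⟨(h.1.1 i).1 hi, h.2 i⟩, fun hi => ⟨(h.1.1 i).2 hi, h.2 i⟩⟩, fun i j => C.star_nadj h.1 i j⟩)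
  change C.AA x * (C.PP x * C.PP x) ≤ _ * (C.PP x ^ k * C.QQ x ^ 1) at hpp
  change C.AA x * (C.PP x * C.QQ x) ≤ _ * (C.PP x ^ k * C.QQ x ^ 1) at hpq
  have s1 : mu2 C.w (fun u v => (C.A x u ∧ C.Y u) ∧ (C.A x v ∧ C.Y v) ∧ ¬ adj C.A u v) =
      C.PP x * C.PP x - mu2 C.w (fun u v => (C.A x u ∧ C.Y u) ∧ (C.A x v ∧ C.Y v) ∧ adj C.A u v) := by
    have := mu2_prod (w := C.w) (fun u => C.A x u ∧ C.Y u) (fun u => C.A x u ∧ C.Y u)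
    rw [mu2_split _ (fun u v => adj C.A u v)] at this
    unfold PP
    rw [← this]
    simp only [and_assoc]
    ring
  have s2 : mu2 C.w (fun u v => (C.A x u ∧ C.Y u) ∧ (C.A v x ∧ C.Y v) ∧ ¬ adj C.A u v) =
      C.PP x * C.QQ x - mu2 C.w (fun u v => (C.A x u ∧ C.Y u) ∧ (C.A v x ∧ C.Y v) ∧ adj C.A u v) := by
    have := mu2_prod (w := C.w) (fun u => C.A x u ∧ C.Y u) (fun u => C.A u x ∧ C.Y u)
    rw [mu2_split _ (fun u v => adj C.A u v)] at this
    unfold PP QQ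
    rw [← this]
    simp only [and_assoc]
    ring
  rw [s1] at hpp
  rw [s2] at hpq
  have hE : 0 ≤ C.EP x := by
    unfold EP
    have a := mu2_nonneg C.w0 (fun u v => (C.A x u ∧ C.Y u) ∧ (C.A x v ∧ C.Y v) ∧ adj C.A u v)
    have b := mu2_nonneg C.w0 (fun u v => (C.A x u ∧ C.Y u) ∧ (C.A v x ∧ C.Y v) ∧ adj C.A u v)
    linarith
  have hP := C.PP_nn x
  have hQ := C.QQ_nn x
  have h1 := C.PQ_le_one x
  have hge := C.PQ_ge hx
  have g0 := Gf_pos k 1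
  set p := C.PP x
  set q := C.QQ x
  set F := p ^ k * q ^ 1
  have hF : 0 < F := lt_of_lt_of_le (by positivity) hge
  have hp0 : 0 < p := by
    rcases hP.eq_or_lt with h | h
    · exfalso
      have : F = 0 := by
        change p ^ k * q ^ 1 = 0
        rw [← h, zero_pow (by have := C.k5; omega), zero_mul]
      linarith
    · exact h
  have key : C.AA x * (p * p + 2 * (p * q)) ≤ (p * p + 2 * (p * q) - C.EP x) * F := by
    unfold EP; linarith
  set S := p * p + 2 * (p * q)
  have hS0 : 0 < S := by positivity
  have hS1 : S ≤ 1 := by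
    change p * p + 2 * (p * q) ≤ 1
    nlinarith
  have k2 : 0.36 * Gf k 1 * C.EP x * S ≤ C.EP x * F := by
    have a : 0.36 * Gf k 1 * S ≤ F := by
      have : 0.36 * Gf k 1 * S ≤ 0.36 * Gf k 1 * 1 := mul_le_mul_of_nonneg_left hS1 (by positivity)
      linarith
    have := mul_le_mul_of_nonneg_left a hE
    linarith
  have : C.AA x * S ≤ (F - 0.36 * Gf k 1 * C.EP x) * S := by linarith
  exact le_of_mul_le_mul_right this hS0

lemma EP_ge (x : V) : mu2 C.w (fun u v => C.Wr u v ∧ ¬ (C.A u x ∧ C.A v x)) ≤ C.EP x + 2 / ((k + 1 : ℕ):ℝ) * C.miss x := by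
  classical
  have h1 : mu2 C.w (fun u v => C.Wr u v ∧ ¬ adj C.A x u) ≤ 1 / ((k + 1 : ℕ):ℝ) * C.miss x := by
    refine le_trans (mu2_mono C.w0 (S' := fun u v => (C.Y u ∧ ¬ adj C.A x u) ∧ (C.Y u ∧ C.Y v ∧ adj C.A u v)) ?_) (mu2_fst_le C.w0 _ _ ?_)
    · rintro u v ⟨⟨a, b, c, d⟩, e⟩; exact ⟨⟨a, e⟩, a, b, c⟩
    · rintro u ⟨hu, -⟩
      exact le_trans (mu_mono C.w0 fun v h => h.2) (C.bY_small hu)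
  have h2 : mu2 C.w (fun u v => C.Wr u v ∧ ¬ adj C.A x v) ≤ 1 / ((k + 1 : ℕ):ℝ) * C.miss x := by
    rw [mu2_swap]
    refine le_trans (mu2_mono C.w0 ?_) h1
    rintro u v ⟨⟨a, b, c, d⟩, e⟩
    exact ⟨⟨b, a, c.symm, fun h => d ⟨h.2, h.1⟩⟩, e⟩
  have h3 : mu2 C.w (fun u v => C.Wr u v ∧ ¬ (C.A u x ∧ C.A v x)) ≤
     (mu2 C.w (fun u v => C.Wr u v ∧ ¬ adj C.A x u) + mu2 C.w (fun u v => C.Wr u v ∧ ¬ adj C.A x v)) +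
     mu2 C.w (fun u v => (C.Wr u v ∧ ¬ (C.A u x ∧ C.A v x)) ∧ adj C.A x u ∧ adj C.A x v) := by
    refine (mu2_union C.w0 (R := fun u v => (C.Wr u v ∧ ¬ adj C.A x u) ∨ (C.Wr u v ∧ ¬ adj C.A x v)) 
      (R' := fun u v => (C.Wr u v ∧ ¬ (C.A u x ∧ C.A v x)) ∧ adj C.A x u ∧ adj C.A x v) ?_).trans ?_
    · intro u v h
      by_cases a : adj C.A x u
      · by_cases b : adj C.A x v
        · exact Or.inr ⟨h, a, b⟩
        · exact Or.inl (Or.inr ⟨h.1, b⟩)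
      · exact Or.inl (Or.inl ⟨h.1, a⟩)
    · gcongr
      exact mu2_union C.w0 fun u v h => h
  have h4 : mu2 C.w (fun u v => (C.Wr u v ∧ ¬ (C.A u x ∧ C.A v x)) ∧ adj C.A x u ∧ adj C.A x v) ≤ C.EP x := by
    unfold EP
    have hsw : mu2 C.w (fun u v => (C.A u x ∧ C.Y u) ∧ (C.A x v ∧ C.Y v) ∧ adj C.A u v) =
        mu2 C.w (fun u v => (C.A x u ∧ C.Y u) ∧ (C.A v x ∧ C.Y v) ∧ adj C.A u v) := by
      rw [mu2_swap]
      exact mu2_congr fun u v => by rw [C.adj_comm v u]; tauto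
    rw [two_mul]
    nth_rewrite 1 [← hsw]
    refine (mu2_union C.w0 (R := fun u v => (C.A x u ∧ C.Y u) ∧ (C.A x v ∧ C.Y v) ∧ adj C.A u v)
      (R' := fun u v => ((C.A u x ∧ C.Y u) ∧ (C.A x v ∧ C.Y v) ∧ adj C.A u v) ∨ ((C.A x u ∧ C.Y u) ∧ (C.A v x ∧ C.Y v) ∧ adj C.A u v)) ?_).trans ?_
    · rintro u v ⟨⟨⟨a, b, c, d⟩, e⟩, f | f, g | g⟩
      · left; exact ⟨⟨f, a⟩, ⟨g, b⟩, c⟩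
      · right; right; exact ⟨⟨f, a⟩, ⟨g, b⟩, c⟩
      · right; left; exact ⟨⟨f, a⟩, ⟨g, b⟩, c⟩
      · exact absurd ⟨f, g⟩ e
    · gcongr
      exact mu2_union C.w0 fun u v h => h
  have h5 : 2 / ((k + 1 : ℕ):ℝ) * C.miss x = 1 / ((k + 1 : ℕ):ℝ) * C.miss x + 1 / ((k + 1 : ℕ):ℝ) * C.miss x := by ring
  linarith

lemma SX_W : C.dl * C.al * C.WW ≤ C.SX (fun x => mu2 C.w (fun u v => C.Wr u v ∧ ¬ (C.A u x ∧ C.A v x))) := by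
  classical
  have h1 : C.SX (fun x => mu2 C.w (fun u v => C.Wr u v ∧ ¬ (C.A u x ∧ C.A v x))) =
      ∑ u, ∑ v, if C.Wr u v then C.w u * C.w v * mu C.w (fun x => C.X x ∧ ¬ (C.A u x ∧ C.A v x)) else 0 := by
    unfold SX mu2 mu
    refine Eq.trans (Finset.sum_congr rfl fun x _ => (?_ : _ = ∑ u, ∑ v,
      if C.X x ∧ C.Wr u v ∧ ¬(C.A u x ∧ C.A v x) then C.w x * (C.w u * C.w v) else 0)) ?_
    · by_cases hx : C.X x
      · simp only [hx, if_true, Finset.mul_sum, true_and]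
        refine Finset.sum_congr rfl fun u _ => Finset.sum_congr rfl fun v _ => ?_
        by_cases h : C.Wr u v ∧ ¬(C.A u x ∧ C.A v x)
        · rw [if_pos h, if_pos h]
        · rw [if_neg h, if_neg h, mul_zero]
      · simp [hx]
    rw [Finset.sum_comm]
    refine Finset.sum_congr rfl fun u _ => ?_
    rw [Finset.sum_comm]
    refine Finset.sum_congr rfl fun v _ => ?_
    by_cases hW : C.Wr u v
    · rw [if_pos hW, Finset.mul_sum]
      refine Finset.sum_congr rfl fun x _ => ?_
      by_cases h : C.X x ∧ ¬(C.A u x ∧ C.A v x)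
      · rw [if_pos h, if_pos ⟨h.1, hW, h.2⟩]; ring
      · rw [if_neg h, if_neg (fun h' => h ⟨h'.1, h'.2.2⟩), mul_zero]
    · simp [hW]
  rw [h1, WW, mu2, Finset.mul_sum]
  refine Finset.sum_le_sum fun u _ => ?_
  rw [Finset.mul_sum]
  refine Finset.sum_le_sum fun v _ => ?_
  by_cases hW : C.Wr u v
  · rw [if_pos hW, if_pos hW, mul_comm]
    apply mul_le_mul_of_nonneg_left _ (mul_nonneg (C.w0 u) (C.w0 v))
    have key : ∀ y, C.Y y → ¬ C.QS y → C.dl * C.al ≤ mu C.w (fun x => C.X x ∧ ¬ C.A y x) := by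
      intro y hy hq
      have a : C.gX y < (1 - C.dl) * C.al := by
        by_contra hc; exact hq ⟨hy, not_lt.1 hc⟩
      have b : C.al = C.gX y + mu C.w (fun x => C.X x ∧ ¬ C.A y x) := by
        unfold al gX; rw [mu_split _ (fun x => C.A y x)]
        congr 1; exact mu_congr fun u => and_comm
      linarith
    by_cases hu : C.QS u
    · have hv : ¬ C.QS v := fun h => hW.2.2.2 ⟨hu, h⟩
      exact (key v hW.2.1 hv).trans (mu_mono C.w0 fun x h => ⟨h.1, fun h' => h.2 h'.2⟩)
    · exact (key u hW.1 hu).trans (mu_mono C.w0 fun x h => ⟨h.1, fun h' => h.2 h'.1⟩)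
  · simp [hW]

lemma beta_small (C : Cfg k 1 V) : (1 / ((k + 1 : ℕ):ℝ)) ^ k ≤ 0.36 * Gf k 1 * (C.dl * C.al) := by
  have ha := C.al1
  have hm := C.mm6
  have hk5 := C.k5
  obtain ⟨n, hn⟩ : ∃ n, k = n + 1 := ⟨k - 1, by omega⟩
  have hn4 : 4 ≤ n := by omega
  set m : ℝ := ((k + 1 : ℕ):ℝ) with hmd
  have hnm : (n:ℝ) = m - 2 := by rw [hmd, hn]; push_cast; ring
  have hm0 : 0 < m := by linarith
  have hη : 0.6203 / m ^ 2 ≤ 0.6203 / 36 := by gcongr; nlinarith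
  have ha2 : 0.9827 ≤ C.al * (m + 1) := by norm_num at hη ha ⊢; linarith
  have e1 : Gf k 1 * C.dl = (n:ℝ) ^ n / (2 * m ^ (k + 1)) := by
    unfold dl Gf
    have : (k:ℝ) ≠ 0 := by have : 0 < k := by omega
                           positivity
    have h1 : (((k - 1 : ℕ):ℝ) + (1:ℕ)) = k := by rw [hn]; push_cast; simp
    have h2 : k - 1 + 1 = k := by omega
    have h3 : (k:ℝ) + (1:ℕ) = m := by rw [hmd]; push_cast; rfl
    have h4 : k - 1 = n := by omega
    rw [h1, h2, h3, h4]
    field_simp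
    simp
  have e2 : (m - 2) ^ 4 ≤ (n:ℝ) ^ n := by
    rw [← hnm]
    exact pow_le_pow_right₀ (by exact_mod_cast (by omega : 1 ≤ n)) hn4
  have e3 : m * (m + 1) ≤ 0.18 * 0.9827 * (m - 2) ^ 4 := by
    have : 0 ≤ m - 6 := by linarith
    obtain ⟨s, hs⟩ : ∃ s, m = s + 6 := ⟨m - 6, by ring⟩
    have hs0 : 0 ≤ s := by linarith
    rw [hs]
    have := pow_nonneg hs0 2
    have := pow_nonneg hs0 3
    have := pow_nonneg hs0 4
    nlinarith
  have e4 : m * (m + 1) ≤ 0.18 * (C.al * (m + 1)) * (n:ℝ) ^ n := by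
    have : 0 ≤ (m - 2) ^ 4 := by positivity
    calc m * (m + 1) ≤ 0.18 * 0.9827 * (m - 2) ^ 4 := e3
      _ ≤ 0.18 * (C.al * (m + 1)) * (n:ℝ) ^ n := by
        apply mul_le_mul _ e2 this (by linarith)
        linarith
  have e5 : m ≤ 0.18 * C.al * (n:ℝ) ^ n := by
    have : (m + 1) * m ≤ (m + 1) * (0.18 * C.al * (n:ℝ) ^ n) := by linarith
    exact le_of_mul_le_mul_left this (by linarith)
  have : 0.36 * Gf k 1 * (C.dl * C.al) = 0.36 * C.al * (Gf k 1 * C.dl) := by ring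
  rw [this, e1, div_pow, one_pow, ← mul_div_assoc, div_le_div_iff₀ (by positivity) (by positivity), pow_succ]
  have hp : 0 ≤ m ^ k := by positivity
  have := mul_le_mul_of_nonneg_right e5 hp
  linarith

lemma AD1 : C.SX C.AA + C.SY C.AA ≤ C.SX (fun x => C.PP x ^ k * C.QQ x ^ 1 + 0.12 * Gf k 1 * C.miss x) + C.t * C.qq ^ (k + 1 + 1) := by
  have h1 := C.D1_le
  have h2 := C.beta_small
  have h3 := C.SX_W
  have hm := C.mm6
  have g0 := Gf_pos k 1
  have h4 : C.SX C.AA + 0.36 * Gf k 1 * C.SX (fun x => mu2 C.w (fun u v => C.Wr u v ∧ ¬ (C.A u x ∧ C.A v x))) ≤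
      C.SX (fun x => C.PP x ^ k * C.QQ x ^ 1 + 0.12 * Gf k 1 * C.miss x) := by
    rw [← C.SX_smul, ← C.SX_add]
    apply C.SX_mono
    intro x hx
    have a := C.AA_le1 hx
    have b := mul_le_mul_of_nonneg_left (C.EP_ge x) (by positivity : 0 ≤ 0.36 * Gf k 1)
    have hm' := C.miss_nn x
    have c : 0.36 * Gf k 1 * (2 / ((k + 1 : ℕ):ℝ) * C.miss x) ≤ 0.12 * Gf k 1 * C.miss x := by
      have : 2 / ((k + 1 : ℕ):ℝ) ≤ 2 / 6 := by gcongr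
      have hh : 0 ≤ Gf k 1 * C.miss x := by positivity
      nlinarith
    linarith
  have h5 := mul_le_mul_of_nonneg_right h2 C.WW_nn
  have h6 := mul_le_mul_of_nonneg_left h3 (by positivity : 0 ≤ 0.36 * Gf k 1)
  linarith

end Cfg
end OStar

namespace OStar
open Finset
namespace Cfg
section
variable {k l : ℕ} {V : Type*} [Fintype V] (C : Cfg k l V)

lemma sc_up (x : V) : C.sc x ≤ C.PP x ^ k * C.QQ x ^ l + Gf k l * (Real.exp 1 / ((k + l : ℕ) : ℝ) ^ (k + l - 1)) := by
  classical
  have hm := C.hm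
  have h6 := C.mm6
  have hG := Gf_pos k l
  have hal := C.al_le'
  have hal0 := C.al_nn
  have h2 : C.sc x ≤ C.PP x ^ k * C.QQ x ^ l + ∑ j, Lf C.w (fun f => star k l C.A x f ∧ C.X (f j)) := by
    unfold sc
    rw [Lf_split _ (fun f => ∀ i, C.Y (f i))]
    refine add_le_add ?_ ?_
    · exact Lf_lab C.w0 fun f hf i => ⟨fun hi => ⟨(hf.1.1 i).1 hi, hf.2 i⟩,
        fun hi => ⟨(hf.1.1 i).2 hi, hf.2 i⟩⟩
    · refine Lf_union C.w0 univ ?_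
      rintro f ⟨hf, hn⟩
      push Not at hn
      obtain ⟨i, hi⟩ := hn
      exact ⟨i, mem_univ _, hf, not_not.1 hi⟩
  have h3 := C.Cgen x (star k l C.A x) C.X (fun _ _ => True) (fun _ h => h) (by simp)
  set m : ℕ := k + l with hmdef
  have h4 : (∑ x', if C.X x' ∧ adj C.A x x' then C.w x' *
          mu C.w (fun u => adj C.A x u ∧ ¬ adj C.A x' u ∧ True) ^ (m - 1) else 0)
      ≤ C.al * (1 / (m:ℝ)) ^ (m - 1) := by
    unfold al mu
    rw [Finset.sum_mul]
    refine Finset.sum_le_sum fun x' _ => ?_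
    have hp : (0:ℝ) ≤ (1 / (m:ℝ)) ^ (m - 1) := by positivity
    by_cases hX : C.X x'
    · rw [if_pos hX]
      split_ifs
      · refine mul_le_mul_of_nonneg_left ?_ (C.w0 _)
        refine pow_le_pow_left₀ (C.mu_nn _) ?_ _
        exact (mu_mono C.w0 (by tauto)).trans (C.nadjX hX)
      · exact mul_nonneg (C.w0 _) hp
    · rw [if_neg hX, if_neg (by tauto), zero_mul]
  have h5 : (Real.exp 1 * (m : ℝ) * Gf k l) * (C.al * (1 / (m:ℝ)) ^ (m - 1))
      ≤ (Real.exp 1 * (m : ℝ) * Gf k l) * (1 / (m:ℝ) * (1 / (m:ℝ)) ^ (m - 1)) := by gcongr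
  have h6 : (Real.exp 1 * (m : ℝ) * Gf k l) * (1 / (m:ℝ) * (1 / (m:ℝ)) ^ (m - 1))
      = Gf k l * (Real.exp 1 / (m:ℝ) ^ (m - 1)) := by
    rw [div_pow, one_pow]; field_simp
  have h7 := mul_le_mul_of_nonneg_left h4 (by positivity : 0 ≤ Real.exp 1 * (m : ℝ) * Gf k l)
  linarith
end

variable {k : ℕ} {V : Type*} [Fintype V] (C : Cfg k 1 V)

lemma l0_le (C : Cfg k 1 V) : Gf k 1 * ((k + 1 : ℕ):ℝ) ≤ (((k + 1 : ℕ):ℝ) - 1) * Gf (k - 1) 1 := by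
  have h := Gf1_step (k := k) C.hk
  push_cast; linarith

lemma l0_le' (C : Cfg k 1 V) : Gf k 1 ≤ 0.0683 := by
  have h := Gf1_step (k := k) C.hk
  have h2 := kGf1 C.k5
  have : (5:ℝ) ≤ k := by exact_mod_cast C.k5
  have g := Gf_nonneg k 1
  nlinarith

lemma sg_up : C.sg ≤ 0.5067 := by
  have hm := C.mm6
  have g0 := Gf_pos k 1
  have ha := C.al_le
  have ha0 := C.al_nn
  have ha1 := C.al_lt_half
  have hr := r_pow C.hm
  have t2 := C.tau2
  have ht : C.t = C.SX C.sc + C.SY C.sc := by rw [C.t_eq, C.sum_XY]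
  set m : ℝ := ((k + 1 : ℕ):ℝ) with hmd
  have hm0 : 0 < m := by linarith
  set τ := Real.exp 1 / m ^ (k + 1 - 1)
  have h1 : C.SX C.sc ≤ C.al * (Gf k 1 * ((1 - C.al) ^ (k + 1) + τ)) := by
    rw [← C.SX_const]
    apply C.SX_mono
    intro x hx
    have a := C.sc_up x
    have b := amgm k 1 (C.PP_nn x) (C.QQ_nn x) (s := 1 - C.al) (by have := C.PQm x; have := C.miss_nn x; linarith)
    rw [mul_add]; linarith
  have h2 : C.SY C.sc ≤ Gf k 1 * 0.311 ^ (k + 1) := by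
    have : C.SY C.sc ≤ C.SY (fun _ => Gf k 1 * 0.311 ^ (k + 1)) := by
      apply C.SY_mono
      intro y hy
      exact (C.sc_le' y).trans (mul_le_mul_of_nonneg_left (pow_le_pow_left₀ (C.rho_nn y) (C.rhoY311 hy) _) g0.le)
    rw [C.SY_const] at this
    have hp : 0 ≤ Gf k 1 * (0.311:ℝ) ^ (k + 1) := by positivity
    nlinarith
  have h3 : C.al * (1 - C.al) ^ (k + 1) ≤ 0.5 / (m + 1) := by
    have a := amgm 1 (k + 1) (p := C.al) (q := 1 - C.al) (s := 1) ha0 (by linarith) (by linarith)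
    rw [pow_one, one_pow, mul_one] at a
    refine a.trans ?_
    unfold Gf
    have b : 2 * m ^ (k + 1) ≤ (1 + m) ^ (k + 1) := by
      have c := one_add_mul_le_pow (a := 1 / m) (by have : 0 < 1 / m := by positivity
                                                    linarith) (k + 1)
      have d : 1 + ((k + 1 : ℕ):ℝ) * (1 / m) = 2 := by rw [← hmd]; field_simp; norm_num
      rw [d] at c
      have := mul_le_mul_of_nonneg_right c (by positivity : 0 ≤ m ^ (k + 1))
      rw [← mul_pow] at this
      have hh : (1 + 1 / m) * m = 1 + m := by
        have : m ≠ 0 := by positivity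
        rw [add_mul, one_mul, one_div, inv_mul_cancel₀ this]; ring
      rw [hh] at this; exact this
    have e : ((1:ℕ):ℝ) ^ 1 * m ^ (k + 1) / (((1:ℕ):ℝ) + m) ^ (1 + (k + 1)) = m ^ (k + 1) / ((1 + m) ^ (k + 1) * (1 + m)) := by
      rw [add_comm 1 (k + 1), pow_succ (((1:ℕ):ℝ) + m) (k + 1)]; simp
    rw [e, div_le_div_iff₀ (by positivity) (by positivity)]
    have := mul_le_mul_of_nonneg_right b (by linarith : 0 ≤ 1 + m)
    linarith
  have h4 : (m + 1) * 0.311 ^ (k + 1) ≤ 0.2281 / m ^ 2 := by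
    rw [le_div_iff₀ (by positivity)]; linarith
  have h5 : 0.2281 / m ^ 2 ≤ 0.2281 / 36 := by gcongr; nlinarith
  have h6 : 0.0756 / m ^ 3 ≤ 0.0756 / 216 := by
    gcongr
    calc (216:ℝ) = 6 ^ 3 := by norm_num
      _ ≤ _ := pow_le_pow_left₀ (by norm_num) hm 3
  rw [le_div_iff₀ (by linarith)] at ha h3
  have h8 : (m + 1) * C.t ≤ Gf k 1 * 0.5067 := by
    have a : (m + 1) * C.t ≤ Gf k 1 * ((m + 1) * (C.al * (1 - C.al) ^ (k + 1)) + (C.al * (m + 1)) * τ + (m + 1) * 0.311 ^ (k + 1)) := by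
      rw [ht]
      have := mul_le_mul_of_nonneg_left (add_le_add h1 h2) (by linarith : 0 ≤ m + 1)
      linarith
    refine a.trans (mul_le_mul_of_nonneg_left ?_ g0.le)
    have b : (C.al * (m + 1)) * τ ≤ 1.01 * (0.0756 / 216) :=
      mul_le_mul ha (t2.trans h6) (by positivity) (by norm_num)
    norm_num at b h5 h3 ⊢
    linarith
  have h9 := C.t_sg
  have : Gf k 1 * C.sg ≤ Gf k 1 * 0.5067 := by linarith
  exact le_of_mul_le_mul_left this g0

lemma t_up : C.t ≤ 0.0604 * Gf (k - 1) 1 := by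
  have h1 := C.sg_up
  have h2 := C.t_sg
  have h3 := C.l0_le
  have hm := C.mm6
  have g0 := Gf_pos k 1
  have l0 := Gf_pos (k - 1) 1
  set m : ℝ := ((k + 1 : ℕ):ℝ)
  have h4 : (m + 1) * C.t ≤ 0.5067 * Gf k 1 := by rw [h2]; exact mul_le_mul_of_nonneg_right h1 g0.le
  have h5 : m * ((m + 1) * C.t) ≤ 0.5067 * ((m - 1) * Gf (k - 1) 1) := by nlinarith
  have h6 : 0.5067 * (m - 1) ≤ 0.0604 * (m * (m + 1)) := by nlinarith
  have h7 : (m * (m + 1)) * C.t ≤ (m * (m + 1)) * (0.0604 * Gf (k - 1) 1) := by nlinarith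
  exact le_of_mul_le_mul_left h7 (by positivity)

lemma zpow_le {z : ℝ} (hz0 : 0 ≤ z) (hz : C.qq = z * C.al) : z ^ (k + 1) ≤ 6.63 := by
  have h1 := C.q_le
  have h2 : C.SX C.GQ ≤ C.SX (fun _ => (1 + 1.5 / ((k + 1 : ℕ):ℝ)) / (((k + 1 : ℕ):ℝ) + 1)) := by
    apply C.SX_mono
    intro x hx
    rw [le_div_iff₀ (by positivity)]
    have a := C.Q_high hx
    have b := C.GQ_Qst x
    have c := C.Qst_nn x
    have hm := C.mm6
    nlinarith
  rw [C.SX_const] at h2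
  have ha := C.al1
  have ha0 := C.al_pos
  have hm := C.mm6
  have hlk := kGf1 C.k5
  have hll := C.lam_le
  have hl0 := Gf_nonneg (k - 1) 1
  have hk : (k:ℝ) = ((k + 1 : ℕ):ℝ) - 1 := by push_cast; ring
  unfold dl at h1
  set L := Gf (k - 1) 1
  set m : ℝ := ((k + 1 : ℕ):ℝ) with hmd
  have hm0 : 0 < m := by linarith
  set η := 0.6203 / m ^ 2 with hη
  have hη0 : 0 ≤ η := by positivity
  have hmη : m * η ≤ 0.1034 := by
    have : m * η = 0.6203 / m := by rw [hη]; field_simp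
    rw [this, div_le_iff₀ hm0]; linarith
  have hη1 : η ≤ 0.0173 := by nlinarith
  have hmd' : m * (L / 2) ≤ 0.2458 := by rw [hk] at hlk; linarith
  rw [hz] at h1
  have h3 : z * (1 - L / 2) * (1 - η) ≤ 1 + 1.5 / m := by
    have a : C.al * (z * (1 - L / 2) * C.al) ≤ C.al * ((1 + 1.5 / m) / (m + 1)) := by linarith
    have b := le_of_mul_le_mul_left a ha0
    rw [le_div_iff₀ (by linarith)] at b
    have c : 0 ≤ z * (1 - L / 2) := mul_nonneg hz0 (by linarith)
    have d := mul_le_mul_of_nonneg_left ha c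
    linarith
  have h4 : (z * (1 - L / 2) * (1 - η)) ^ (k + 1) ≤ 4.482 := by
    have e0 : 0 ≤ z * (1 - L / 2) * (1 - η) := mul_nonneg (mul_nonneg hz0 (by linarith)) (by linarith)
    have e1 : 1 + 1.5 / m ≤ Real.exp (1.5 / m) := by have := Real.add_one_le_exp (1.5 / m); linarith
    calc _ ≤ (Real.exp (1.5 / m)) ^ (k + 1) := pow_le_pow_left₀ e0 (h3.trans e1) _
      _ = Real.exp 1.5 := by rw [← Real.exp_nat_mul]; congr 1; rw [← hmd]; field_simp
      _ ≤ 4.482 := by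
        have a : Real.exp 1.5 ^ 2 = Real.exp 1 ^ 3 := by
          rw [← Real.exp_nat_mul, ← Real.exp_nat_mul]; norm_num
        have b : Real.exp 1 ^ 3 ≤ 2.7183 ^ 3 := pow_le_pow_left₀ (Real.exp_pos 1).le e_hi.le 3
        have c := Real.exp_pos 1.5
        by_contra hc
        push Not at hc
        nlinarith
  have h5 : 0.7542 ≤ (1 - L / 2) ^ (k + 1) := by
    have := one_add_mul_le_pow (a := -(L / 2)) (by linarith) (k + 1)
    rw [← hmd] at this
    rw [sub_eq_add_neg]
    refine le_trans ?_ this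
    linarith
  have h6 : 0.8966 ≤ (1 - η) ^ (k + 1) := by
    have := one_add_mul_le_pow (a := -η) (by linarith) (k + 1)
    rw [← hmd] at this
    rw [sub_eq_add_neg]
    refine le_trans ?_ this
    linarith
  rw [mul_pow, mul_pow] at h4
  have hz' : 0 ≤ z ^ (k + 1) := pow_nonneg hz0 _
  have h7 : z ^ (k + 1) * (0.7542 * 0.8966) ≤ 4.482 := by
    refine le_trans ?_ h4
    rw [mul_assoc]
    apply mul_le_mul_of_nonneg_left _ hz'
    exact mul_le_mul h5 h6 (by norm_num) (by linarith)
  linarith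

lemma step6 : C.SX (fun x => Gf (k - 1) 1 * ((C.al - C.eX x) ^ k * (C.Qst x + C.eX x))) + C.t * C.qq ^ (k + 1 + 1) ≤
    C.SX (fun x => Gf (k - 1) 1 * C.al ^ k * C.Qst x) + 0.479 * Gf (k - 1) 1 * C.al ^ (k + 1) * C.qq := by
  have ht := C.t_up
  have ht0 := C.t_nonneg
  have hL := Gf_pos (k - 1) 1
  have ha := C.al_pos
  have hq := C.qq_nn
  have hk5 : (5:ℝ) ≤ k := by exact_mod_cast C.k5
  obtain ⟨z, hz⟩ : ∃ z, C.qq = z * C.al := ⟨C.qq / C.al, by field_simp⟩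
  have hz0 : 0 ≤ z := by
    by_contra hc
    push Not at hc
    nlinarith
  have hap : 0 < C.al ^ (k + 1) := by positivity
  have e1 : C.t * C.qq ^ (k + 1 + 1) = (C.t * (z ^ (k + 1) * z)) * (C.al ^ (k + 1) * C.al) := by
    rw [hz, mul_pow, pow_succ z, pow_succ C.al (k + 1)]; ring
  have e2 : 0.479 * Gf (k - 1) 1 * C.al ^ (k + 1) * C.qq = (0.479 * Gf (k - 1) 1 * z) * (C.al ^ (k + 1) * C.al) := by
    rw [hz]; ring
  rw [e1, e2]
  have hap2 : 0 < C.al ^ (k + 1) * C.al := by positivity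
  rcases le_or_gt z 0.2 with h2 | h2
  · have a1 : C.SX (fun x => Gf (k - 1) 1 * ((C.al - C.eX x) ^ k * (C.Qst x + C.eX x))) ≤ C.SX (fun x => Gf (k - 1) 1 * C.al ^ k * C.Qst x) := by
      apply C.SX_mono
      intro x hx
      rw [mul_assoc]
      apply mul_le_mul_of_nonneg_left _ hL.le
      have b1 := C.Q_low hx
      have b2 := C.GQ_Qst x
      have b3 := C.GQ_le x
      have b4 := C.eX_nn x
      have b5 := C.eX_le x
      have b6 := bern_mul k ha b4 b5
      have b7 : 0.295 * C.al ≤ C.Qst x := by rw [hz] at b3; nlinarith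
      have b8 : C.al * (C.Qst x + C.eX x) ≤ C.Qst x * (C.al + k * C.eX x) := by
        have : C.al ≤ C.Qst x * k := by nlinarith
        nlinarith
      have b9 : 0 ≤ (C.al - C.eX x) ^ k := pow_nonneg (by linarith) _
      have c1 := mul_le_mul_of_nonneg_left b8 b9
      have c2 := mul_le_mul_of_nonneg_left b6 (C.Qst_nn x)
      have c3 : C.al * ((C.al - C.eX x) ^ k * (C.Qst x + C.eX x)) ≤ C.al * (C.al ^ k * C.Qst x) := by
        rw [pow_succ] at c2; linarith
      exact le_of_mul_le_mul_left c3 ha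
    have a2 : z ^ (k + 1) ≤ 1 := pow_le_one₀ hz0 (by linarith)
    have a3 : C.t * (z ^ (k + 1) * z) ≤ 0.479 * Gf (k - 1) 1 * z := by
      have : C.t * z ^ (k + 1) ≤ 0.479 * Gf (k - 1) 1 := by
        have := mul_le_mul_of_nonneg_left a2 ht0
        linarith
      have := mul_le_mul_of_nonneg_right this hz0
      linarith
    have a4 := mul_le_mul_of_nonneg_right a3 hap2.le
    linarith
  · have g1 := C.l0_le'
    have a1 : C.SX (fun x => Gf (k - 1) 1 * ((C.al - C.eX x) ^ k * (C.Qst x + C.eX x))) ≤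
        C.SX (fun x => Gf (k - 1) 1 * C.al ^ k * C.Qst x + Gf (k - 1) 1 * (Gf k 1 * C.al ^ (k + 1))) := by
      apply C.SX_mono
      intro x hx
      have b4 := C.eX_nn x
      have b5 := C.eX_le x
      have b6 := amgm k 1 (p := C.al - C.eX x) (q := C.eX x) (s := C.al) (by linarith) b4 (by linarith)
      have b7 : (C.al - C.eX x) ^ k ≤ C.al ^ k := pow_le_pow_left₀ (by linarith) (by linarith) _
      have b8 := mul_le_mul_of_nonneg_right b7 (C.Qst_nn x)
      rw [pow_one] at b6
      have : (C.al - C.eX x) ^ k * (C.Qst x + C.eX x) ≤ C.al ^ k * C.Qst x + Gf k 1 * C.al ^ (k + 1) := by linarith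
      have := mul_le_mul_of_nonneg_left this hL.le
      linarith
    rw [C.SX_add, C.SX_const] at a1
    have a3 : Gf (k - 1) 1 * Gf k 1 + C.t * (z ^ (k + 1) * z) ≤ 0.479 * Gf (k - 1) 1 * z := by
      have c0 : 0 ≤ z ^ (k + 1) := pow_nonneg hz0 _
      have c1 : Gf (k - 1) 1 * Gf k 1 ≤ Gf (k - 1) 1 * 0.0683 := mul_le_mul_of_nonneg_left g1 hL.le
      have c2 : C.t * (z ^ (k + 1) * z) ≤ 0.0604 * Gf (k - 1) 1 * (z ^ (k + 1) * z) :=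
        mul_le_mul_of_nonneg_right ht (by positivity)
      have c3 : 0.0683 + 0.0604 * (z ^ (k + 1) * z) ≤ 0.479 * z := by
        rcases le_or_gt z 1 with h | h
        · have := pow_le_one₀ (n := k + 1) hz0 h
          nlinarith
        · have := C.zpow_le hz0 hz
          nlinarith
      have := mul_le_mul_of_nonneg_left c3 hL.le
      linarith
    have a4 := mul_le_mul_of_nonneg_right a3 hap2.le
    linarith

theorem main_l1 {O : ℝ} (hO : ∀ a d : ℝ, 0 ≤ a → a ≤ 1 / 2 → 0 ≤ d → d ≤ (k:ℝ) / (k + (1:ℕ)) →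
    a * (1 - a) ^ (k + 1) * d ^ k * (1 - d) ^ 1 + Gf (k - 1) 1 * (1 - a) * a ^ (k + 1) * (1 - d) ≤ O) : C.t ≤ O := by
  apply C.fin_gt hO
  have h1 := C.t_split
  have h2 := C.T2_le
  have h3 := C.T1_l1
  have h4 := C.AD1
  have h5 := C.step6
  have g0 := Gf_pos k 1
  have hm : 0 ≤ C.SX C.miss := C.SX_nn fun x _ => C.miss_nn x
  have e : (fun x => C.PP x ^ k * C.QQ x ^ 1 + 1.3 * Gf k 1 * C.miss x + Gf (k - 1) 1 * C.al ^ (k + 1 - 1) * C.QQ x) =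
    fun x => (C.PP x ^ k * C.QQ x ^ 1 + 1.3 * Gf k 1 * C.miss x) + (Gf (k - 1) 1 * C.al ^ k * C.Qst x + Gf (k - 1) 1 * C.al ^ k * C.GQ x) := by
    funext x; rw [C.GQ_Qst, Nat.add_sub_cancel]; ring
  rw [e, C.SX_add, C.SX_add, C.SX_add, C.SX_smul (1.3 * Gf k 1)]
  rw [C.SX_add] at h3
  rw [C.SX_add, C.SX_smul (0.12 * Gf k 1)] at h4
  have : 0 ≤ Gf k 1 * C.SX C.miss := by positivity
  linarith

end Cfg
end OStar

namespace OStar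
open Finset

lemma TT_smul (k l : ℕ) {V : Type} [Fintype V] (A : V → V → Prop) (w : V → ℝ) (s : ℝ) :
    TT k l A (fun v => s * w v) = s ^ (k + l + 1) * TT k l A w := by
  classical
  unfold TT Lf
  rw [mul_sum]
  refine sum_congr rfl fun c _ => ?_
  rw [mul_sum, mul_sum, mul_sum]
  refine sum_congr rfl fun f _ => ?_
  split_ifs
  · rw [prod_mul_distrib, prod_const, card_univ, Fintype.card_fin]; ring
  · simp

lemma TT_cont (k l : ℕ) {V : Type} [Fintype V] (A : V → V → Prop) : Continuous (fun w : V → ℝ => TT k l A w) := by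
  classical
  unfold TT Lf
  refine continuous_finsetSum _ fun c _ => ?_
  refine (continuous_apply c).mul ?_
  refine continuous_finsetSum _ fun f _ => ?_
  split_ifs
  · exact continuous_finsetProd _ fun i _ => continuous_apply _
  · exact continuous_const

lemma TT_ext (k l : ℕ) {V : Type} [Fintype V] (A : V → V → Prop) (P : V → Prop) [DecidablePred P]
    (u : {v // P v} → ℝ) :
    TT k l (fun a b : {v // P v} => A a.1 b.1) u = TT k l A (fun v => if h : P v then u ⟨v, h⟩ else 0) := by
  classical
  unfold TT
  refine Fintype.sum_of_injective (Subtype.val) Subtype.val_injective _ _ ?_ ?_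
  · intro v hv
    have : ¬ P v := fun h => hv ⟨⟨v, h⟩, rfl⟩
    simp [this]
  · rintro ⟨c, hc⟩
    simp only [hc, dif_pos]
    congr 1
    unfold Lf
    refine Fintype.sum_of_injective (fun f : Fin (k + l) → {v // P v} => fun i => (f i).1) ?_ _ _ ?_ ?_
    · intro f g h
      funext i
      exact Subtype.ext (congrFun h i)
    · intro f hf
      have : ∃ i, ¬ P (f i) := by
        by_contra hcon
        push Not at hcon
        exact hf ⟨fun i => ⟨f i, hcon i⟩, rfl⟩
      obtain ⟨i, hi⟩ := this
      have : ∏ j, (fun v => if h : P v then u ⟨v, h⟩ else 0) (f j) = 0 :=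
        prod_eq_zero (mem_univ i) (by simp [hi])
      rw [this]; simp
    · intro f
      have e : star k l (fun a b : {v // P v} => A a.1 b.1) ⟨c, hc⟩ f ↔ star k l A c (fun i => (f i).1) := Iff.rfl
      have e2 : ∏ j, (fun v => if h : P v then u ⟨v, h⟩ else 0) (f j).1 = ∏ j, u (f j) := by
        refine prod_congr rfl fun j _ => ?_
        simp [(f j).2]
      by_cases h : star k l A c (fun i => (f i).1)
      · rw [if_pos (e.2 h), if_pos h, e2]
      · rw [if_neg (fun h' => h (e.1 h')), if_neg h]

theorem TT_le {k l : ℕ} (hl : 1 ≤ l) (hlk : l ≤ k) (hm : 6 ≤ k + l) {O : ℝ}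
    (hC : ∀ (U : Type) [Fintype U] (C : Cfg k l U), C.t ≤ O)
    (hlow : Gf k l * (((k + l : ℕ) : ℝ) ^ (k + l) / ((k + l : ℕ) + 1 : ℝ) ^ (k + l + 1)) ≤ O)
    {V : Type} [Fintype V] (A : V → V → Prop) (asym : ∀ u v, A u v → ¬ A v u)
    (w : V → ℝ) (hw : ∀ v, 0 ≤ w v) : TT k l A w ≤ O * (∑ v, w v) ^ (k + l + 1) := by
  classical
  rcases isEmpty_or_nonempty V with hV | hV
  · unfold TT; simp
  obtain ⟨ws, hws, hmx⟩ := (isCompact_stdSimplex ℝ V).exists_isMaxOn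
    (by obtain ⟨v⟩ := hV; exact ⟨_, single_mem_stdSimplex ℝ v⟩) (TT_cont k l A).continuousOn
  have hmax : ∀ w : V → ℝ, (∀ v, 0 ≤ w v) → TT k l A w ≤ TT k l A ws * (∑ v, w v) ^ (k + l + 1) := by
    intro w hw
    set s := ∑ v, w v with hs
    have hs0 : 0 ≤ s := sum_nonneg fun v _ => hw v
    rcases hs0.eq_or_lt with h | h
    · have hz : ∀ v, w v = 0 := by
        intro v
        have := (sum_eq_zero_iff_of_nonneg (fun v _ => hw v)).1 (hs.symm.trans h.symm)
        exact this v (mem_univ v)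
      rw [← h]; unfold TT; simp [hz]
    · have hsim : (fun v => s⁻¹ * w v) ∈ stdSimplex ℝ V := by
        refine ⟨fun v => mul_nonneg (inv_nonneg.2 hs0) (hw v), ?_⟩
        rw [← mul_sum, ← hs, inv_mul_cancel₀ h.ne']
      have := hmx hsim
      simp only [Set.mem_setOf_eq] at this
      have e : w = fun v => s * (fun v => s⁻¹ * w v) v := by
        funext v; simp only; rw [← mul_assoc, mul_inv_cancel₀ h.ne', one_mul]
      rw [e, TT_smul, mul_comm]
      exact mul_le_mul_of_nonneg_right this (by positivity)
  have key : TT k l A ws ≤ O := by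
    rcases lt_or_ge (TT k l A ws) (Gf k l * (((k + l : ℕ) : ℝ) ^ (k + l) / ((k + l : ℕ) + 1 : ℝ) ^ (k + l + 1))) with h | h
    · exact h.le.trans hlow
    · have hex : (fun v => if h : 0 < ws v then (fun a : {v // 0 < ws v} => ws a.1) ⟨v, h⟩ else 0) = ws := by
        funext v
        split_ifs with h
        · rfl
        · exact le_antisymm (hws.1 v) (not_lt.1 h)
      have hTT : TT k l (fun a b : {v // 0 < ws v} => A a.1 b.1) (fun a => ws a.1) = TT k l A ws := by
        rw [TT_ext, hex]
      have hsum : ∀ u : {v // 0 < ws v} → ℝ, ∑ a, u a = ∑ v, if h : 0 < ws v then u ⟨v, h⟩ else 0 := by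
        intro u
        refine Fintype.sum_of_injective (Subtype.val) Subtype.val_injective _ _ ?_ ?_
        · intro v hv
          have : ¬ 0 < ws v := fun h => hv ⟨⟨v, h⟩, rfl⟩
          simp [this]
        · rintro ⟨c, hc⟩
          simp [hc]
      let C : Cfg k l {v // 0 < ws v} :=
        { A := fun a b => A a.1 b.1
          asym := fun u v => asym u.1 v.1
          w := fun a => ws a.1
          wpos := fun a => a.2
          wsum := by
            rw [hsum, ← hws.2]
            exact sum_congr rfl fun v _ => congrFun hex v
          hmax := by
            intro w' hw'
            rw [hTT, TT_ext, hsum]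
            apply hmax
            intro v
            split_ifs
            · exact hw' _
            · exact le_rfl
          ht := by rw [hTT]; exact h
          hl := hl
          hlk := hlk
          hm := hm }
      have := hC _ C
      have e : C.t = TT k l A ws := hTT
      rwa [e] at this
  exact (hmax w hw).trans (mul_le_mul_of_nonneg_right key (by have := sum_nonneg fun v (_ : v ∈ univ) => hw v; positivity))

lemma low_a (m : ℕ) : (1 / ((m:ℝ) + 1)) * (1 - 1 / ((m:ℝ) + 1)) ^ m = (m:ℝ) ^ m / ((m:ℝ) + 1) ^ (m + 1) := by
  have : (1 - 1 / ((m:ℝ) + 1)) = m / (m + 1) := by field_simp; ring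
  rw [this, div_pow, pow_succ]; field_simp

theorem TT_le_gt {k l : ℕ} (hl : 1 ≤ l) (hlk : l ≤ k) (hm : 6 ≤ k + l) {O : ℝ}
    (hO : ∀ a d : ℝ, 0 ≤ a → a ≤ 1 / 2 → 0 ≤ d → d ≤ (k:ℝ) / (k + l) →
      a * (1 - a) ^ (k + l) * d ^ k * (1 - d) ^ l + Gf (k - 1) l * (1 - a) * a ^ (k + l) * (1 - d) ≤ O)
    {V : Type} [Fintype V] (A : V → V → Prop) (asym : ∀ u v, A u v → ¬ A v u)
    (w : V → ℝ) (hw : ∀ v, 0 ≤ w v) : TT k l A w ≤ O * (∑ v, w v) ^ (k + l + 1) := by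
  refine TT_le hl hlk hm ?_ ?_ A asym w hw
  · intro U _ C
    rcases hl.eq_or_lt with h | h
    · subst h
      exact C.main_l1 hO
    · exact C.main_l2_gt h hO
  · have hkl : (0:ℝ) < (k:ℝ) + l := by have : (6:ℝ) ≤ (k:ℝ) + l := by exact_mod_cast hm
                                       linarith
    have h6 : (6:ℝ) ≤ ((k + l : ℕ):ℝ) := by exact_mod_cast hm
    have := hO (1 / (((k + l : ℕ):ℝ) + 1)) (k / (k + l)) (by positivity)
      (one_div_le_one_div_of_le (by norm_num) (by linarith)) (by positivity) le_rfl
    rw [low_a (k + l)] at this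
    have hd : 1 - (k:ℝ) / (k + l) = l / (k + l) := by field_simp; ring
    have h1 : (1 / (((k + l : ℕ):ℝ) + 1)) ≤ 1 := by rw [div_le_one (by positivity)]; linarith
    have h2 : 0 ≤ Gf (k - 1) l * (1 - 1 / (((k + l : ℕ):ℝ) + 1)) * (1 / (((k + l : ℕ):ℝ) + 1)) ^ (k + l) * (1 - (k:ℝ) / (k + l)) := by
      rw [hd]
      have := Gf_pos (k - 1) l
      have : 0 ≤ 1 - 1 / (((k + l : ℕ):ℝ) + 1) := by linarith
      positivity
    have h3 : Gf k l = ((k:ℝ) / (k + l)) ^ k * (1 - (k:ℝ) / (k + l)) ^ l := by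
      rw [hd, div_pow, div_pow]; unfold Gf; rw [pow_add]; field_simp
    rw [h3]
    linarith

theorem TT_le_eq {k l : ℕ} (hl : 2 ≤ l) (hlk : l ≤ k) (hm : 6 ≤ k + l) {O : ℝ}
    (hO : ∀ a : ℝ, 0 ≤ a → a ≤ 1 → Gf k l * (a * (1 - a) ^ (k + l) + (1 - a) * a ^ (k + l)) ≤ O)
    {V : Type} [Fintype V] (A : V → V → Prop) (asym : ∀ u v, A u v → ¬ A v u)
    (w : V → ℝ) (hw : ∀ v, 0 ≤ w v) : TT k l A w ≤ O * (∑ v, w v) ^ (k + l + 1) := by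
  refine TT_le (by omega) hlk hm ?_ ?_ A asym w hw
  · intro U _ C
    exact C.main_l2_eq hl hO
  · have h1 : (1 / (((k + l : ℕ):ℝ) + 1)) ≤ 1 := by
      rw [div_le_one (by positivity)]
      have : (0:ℝ) ≤ ((k + l : ℕ):ℝ) := by positivity
      linarith
    have := hO (1 / (((k + l : ℕ):ℝ) + 1)) (by positivity) h1
    rw [low_a (k + l)] at this
    refine le_trans (mul_le_mul_of_nonneg_left ?_ (Gf_nonneg k l)) this
    have : 0 ≤ (1 - 1 / (((k + l : ℕ):ℝ) + 1)) * (1 / (((k + l : ℕ):ℝ) + 1)) ^ (k + l) := by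
      have : 0 ≤ 1 - 1 / (((k + l : ℕ):ℝ) + 1) := by linarith
      positivity
    linarith
end OStar

namespace OStar
open Finset

/-- the type of a vertex of the star: center, out-leaf, in-leaf -/
def styp (k l : ℕ) (a : Fin (k + l + 1)) : Fin 3 := if a.val = 0 then 0 else if a.val ≤ k then 1 else 2

lemma styp_arc {k l : ℕ} (hk : 1 ≤ k) (hl : 1 ≤ l) (a b : Fin (k + l + 1)) :
    StarArc k l a b ↔ (styp k l a = 0 ∧ styp k l b = 1) ∨ (styp k l b = 0 ∧ styp k l a = 2) := by
  unfold StarArc styp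
  have z : ((0 : Fin 3) = 1) = False := by simp
  have z2 : ((0 : Fin 3) = 2) = False := by simp
  have z3 : ((1 : Fin 3) = 0) = False := by simp
  have z4 : ((1 : Fin 3) = 2) = False := by decide
  have z5 : ((2 : Fin 3) = 0) = False := by decide
  have z6 : ((2 : Fin 3) = 1) = False := by decide
  split_ifs <;> simp only [z, z2, z3, z4, z5, z6, true_and, and_true, false_and, and_false, or_true, true_or, or_false, false_or, iff_true, iff_false] <;> omega

lemma styp_out {k l : ℕ} (hk : 1 ≤ k) (hl : 1 ≤ l) (a : Fin (k + l + 1)) :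
    (∃ b, StarArc k l a b) ↔ styp k l a ≠ 1 := by
  constructor
  · rintro ⟨b, hb⟩ h
    rw [styp_arc hk hl] at hb
    rw [h] at hb; simp at hb
  · intro h
    unfold styp at h
    by_cases h0 : a.val = 0
    · exact ⟨⟨1, by omega⟩, Or.inl ⟨h0, by simp, by simpa using hk⟩⟩
    · by_cases h1 : a.val ≤ k
      · simp [h0, h1] at h
      · exact ⟨⟨0, by omega⟩, Or.inr ⟨rfl, by omega⟩⟩

lemma styp_in {k l : ℕ} (hk : 1 ≤ k) (hl : 1 ≤ l) (a : Fin (k + l + 1)) :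
    (∃ b, StarArc k l b a) ↔ styp k l a ≠ 2 := by
  constructor
  · rintro ⟨b, hb⟩ h
    rw [styp_arc hk hl] at hb
    rw [h] at hb; simp at hb
  · intro h
    unfold styp at h
    by_cases h0 : a.val = 0
    · exact ⟨⟨k + 1, by omega⟩, Or.inr ⟨h0, by simp⟩⟩
    · by_cases h1 : a.val ≤ k
      · exact ⟨⟨0, by omega⟩, Or.inl ⟨rfl, by omega⟩⟩
      · simp [h0, h1] at h

lemma aut_iff {k l : ℕ} (hk : 1 ≤ k) (hl : 1 ≤ l) (σ : Equiv.Perm (Fin (k + l + 1))) :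
    (∀ a b, StarArc k l a b ↔ StarArc k l (σ a) (σ b)) ↔ styp k l ∘ σ = styp k l := by
  constructor
  · intro h
    funext a
    have h1 : (∃ b, StarArc k l a b) ↔ ∃ b, StarArc k l (σ a) b := by
      constructor
      · rintro ⟨b, hb⟩; exact ⟨_, (h a b).1 hb⟩
      · rintro ⟨b, hb⟩; exact ⟨σ.symm b, (h _ _).2 (by simpa using hb)⟩
    have h2 : (∃ b, StarArc k l b a) ↔ ∃ b, StarArc k l b (σ a) := by
      constructor
      · rintro ⟨b, hb⟩; exact ⟨_, (h b a).1 hb⟩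
      · rintro ⟨b, hb⟩; exact ⟨σ.symm b, (h _ _).2 (by simpa using hb)⟩
    rw [styp_out hk hl, styp_out hk hl] at h1
    rw [styp_in hk hl, styp_in hk hl] at h2
    simp only [Function.comp_apply]
    generalize styp k l (σ a) = x at *
    generalize styp k l a = y at *
    revert x y
    decide
  · intro h a b
    rw [styp_arc hk hl, styp_arc hk hl]
    have ha := congrFun h a
    have hb := congrFun h b
    simp only [Function.comp_apply] at ha hb
    rw [ha, hb]

lemma card_aut {k l : ℕ} (hk : 1 ≤ k) (hl : 1 ≤ l) :
    Nat.card {σ : Equiv.Perm (Fin (k + l + 1)) // ∀ a b, StarArc k l a b ↔ StarArc k l (σ a) (σ b)} = k.factorial * l.factorial := by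
  classical
  rw [Nat.card_congr (Equiv.subtypeEquivRight (aut_iff hk hl)), Nat.card_eq_fintype_card,
    DomMulAct.stabilizer_card, Fin.prod_univ_three]
  have c0 : Fintype.card {a : Fin (k + l + 1) // styp k l a = 0} = 1 := by
    rw [Fintype.card_eq_one_iff]
    refine ⟨⟨0, by simp [styp]⟩, ?_⟩
    rintro ⟨a, ha⟩
    unfold styp at ha
    apply Subtype.ext
    split_ifs at ha with h1
    · exact Fin.ext h1
    all_goals simp at ha
  have c1 : Fintype.card {a : Fin (k + l + 1) // styp k l a = 1} = k := by
    refine Eq.trans ?_ (Fintype.card_fin k)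
    refine (Fintype.card_of_bijective (f := fun i : Fin k => (⟨⟨i.val + 1, by omega⟩, by
      unfold styp; simp⟩ : {a : Fin (k + l + 1) // styp k l a = 1})) ⟨?_, ?_⟩).symm
    · intro i j h
      simp at h
      exact Fin.ext h
    · rintro ⟨a, ha⟩
      unfold styp at ha
      split_ifs at ha with h1 h2
      · simp at ha
      · exact ⟨⟨a.val - 1, by omega⟩, Subtype.ext (Fin.ext (by simp; omega))⟩
      · simp at ha
  have c2 : Fintype.card {a : Fin (k + l + 1) // styp k l a = 2} = l := by
    refine Eq.trans ?_ (Fintype.card_fin l)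
    refine (Fintype.card_of_bijective (f := fun i : Fin l => (⟨⟨i.val + 1 + k, by omega⟩, by
      unfold styp; simp⟩ : {a : Fin (k + l + 1) // styp k l a = 2})) ⟨?_, ?_⟩).symm
    · intro i j h
      simp at h
      exact Fin.ext h
    · rintro ⟨a, ha⟩
      unfold styp at ha
      split_ifs at ha with h1 h2
      · simp at ha
      · simp at ha
      · exact ⟨⟨a.val - 1 - k, by omega⟩, Subtype.ext (Fin.ext (by simp; omega))⟩
  rw [c0, c1, c2]; simp

lemma card_emb {k l : ℕ} (hk : 1 ≤ k) (hl : 1 ≤ l) {V : Type} [Fintype V] (A : V → V → Prop) :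
    Nat.card {φ : Fin (k + l + 1) → V // IsStarEmb k l A φ} =
    Nat.card {W : Finset V // W.card = k + l + 1 ∧
      ∃ φ : Fin (k + l + 1) → V, (∀ a, φ a ∈ W) ∧ IsStarEmb k l A φ} * (k.factorial * l.factorial) := by
  classical
  rw [← card_aut hk hl, ← Nat.card_prod]
  symm
  set S := {W : Finset V // W.card = k + l + 1 ∧
      ∃ φ : Fin (k + l + 1) → V, (∀ a, φ a ∈ W) ∧ IsStarEmb k l A φ}
  have hch : ∀ W : S, ∃ φ : Fin (k + l + 1) → V, (∀ a, φ a ∈ W.1) ∧ IsStarEmb k l A φ := fun W => W.2.2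
  choose p hp1 hp2 using hch
  have him : ∀ W : S, univ.image (p W) = W.1 := by
    intro W
    apply eq_of_subset_of_card_le
    · intro v hv
      obtain ⟨a, _, rfl⟩ := mem_image.1 hv
      exact hp1 W a
    · rw [W.2.1, card_image_of_injective _ (hp2 W).1]; simp
  refine Nat.card_eq_of_bijective (fun x => (⟨p x.1 ∘ x.2.1, (hp2 x.1).1.comp x.2.1.injective, fun a b => ?_⟩ :
    {φ : Fin (k + l + 1) → V // IsStarEmb k l A φ})) ⟨?_, ?_⟩
  · rw [x.2.2 a b]; exact (hp2 x.1).2 _ _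
  · rintro ⟨W, σ⟩ ⟨W', τ⟩ h
    replace h : p W ∘ σ.1 = p W' ∘ τ.1 := congrArg Subtype.val h
    have hW : W = W' := by
      apply Subtype.ext
      rw [← him W, ← him W']
      have e : ∀ (W : S) (σ : Equiv.Perm (Fin (k + l + 1))), univ.image (p W ∘ σ) = univ.image (p W) := by
        intro W σ
        rw [← image_image, image_univ_equiv]
      rw [← e W σ.1, h, e]
    subst hW
    have : σ = τ := by
      apply Subtype.ext
      apply Equiv.ext
      intro a
      exact (hp2 W).1 (congrFun h a)
    rw [this]
  · rintro ⟨φ, hφ⟩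
    let W : S := ⟨univ.image φ, by rw [card_image_of_injective _ hφ.1]; simp, φ, fun a => mem_image_of_mem _ (mem_univ a), hφ⟩
    have hex : ∀ a, ∃ b, p W b = φ a := by
      intro a
      have : φ a ∈ univ.image (p W) := by rw [him W]; exact mem_image_of_mem _ (mem_univ a)
      obtain ⟨b, _, hb⟩ := mem_image.1 this
      exact ⟨b, hb⟩
    choose σ hσ using hex
    have hinj : Function.Injective σ := by
      intro a b h
      apply hφ.1
      rw [← hσ a, ← hσ b, h]
    let τ : Equiv.Perm (Fin (k + l + 1)) := Equiv.ofBijective σ (Finite.injective_iff_bijective.1 hinj)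
    refine ⟨(W, ⟨τ, fun a b => ?_⟩), ?_⟩
    · rw [hφ.2 a b, (hp2 W).2]
      change _ ↔ A (p W (σ a)) (p W (σ b))
      rw [hσ, hσ]
    · apply Subtype.ext
      funext a
      exact hσ a
end OStar

namespace OStar
open Finset Filter Topology

/-- star maps, with center at `0` -/
def smap (k l : ℕ) {V : Type} (A : V → V → Prop) (φ : Fin (k + l + 1) → V) : Prop :=
  star k l A (φ 0) (fun i => φ i.succ)

lemma TT_one (k l : ℕ) {V : Type} [Fintype V] (A : V → V → Prop) :
    TT k l A (fun _ => 1) = Nat.card {φ : Fin (k + l + 1) → V // smap k l A φ} := by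
  classical
  unfold TT Lf
  rw [Nat.card_eq_fintype_card, Fintype.card_subtype, card_filter]
  push_cast
  simp only [one_mul, prod_const_one]
  rw [← Fintype.sum_prod_type']
  refine Fintype.sum_equiv (Fin.consEquiv (fun _ : Fin (k + l + 1) => V)) _ _ ?_
  rintro ⟨c, f⟩
  simp only [smap, Fin.consEquiv, Equiv.coe_fn_mk, Fin.cons_zero, Fin.cons_succ]

lemma smap_of_emb {k l : ℕ} {V : Type} {A : V → V → Prop} {φ : Fin (k + l + 1) → V} (h : IsStarEmb k l A φ) :
    smap k l A φ := by
  refine ⟨fun i => ⟨fun hi => (h.2 _ _).1 ?_, fun hi => (h.2 _ _).1 ?_⟩, fun i j hij => ?_⟩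
  · unfold lab at hi
    exact Or.inl ⟨rfl, by simp, by simp; omega⟩
  · unfold lab at hi
    exact Or.inr ⟨rfl, by simp; omega⟩
  · have := (h.2 _ _).2 hij
    unfold StarArc at this
    simp at this

lemma emb_of_smap {k l : ℕ} {V : Type} {A : V → V → Prop} (asym : ∀ u v, A u v → ¬ A v u)
    {φ : Fin (k + l + 1) → V} (hi : Function.Injective φ) (h : smap k l A φ) : IsStarEmb k l A φ := by
  refine ⟨hi, ?_⟩
  obtain ⟨h1, h2⟩ := h
  intro a b
  have irr : ∀ v, ¬ A v v := fun v hv => asym v v hv hv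
  refine Fin.cases ?_ (fun i => ?_) a
  · refine Fin.cases ?_ (fun j => ?_) b
    · simp [StarArc, irr]
    · by_cases hj : lab k l j
      · have := (h1 j).1 hj
        unfold lab at hj
        simp [StarArc, this]; omega
      · have := asym _ _ ((h1 j).2 hj)
        unfold lab at hj
        simp [StarArc, this]; omega
  · refine Fin.cases ?_ (fun j => ?_) b
    · by_cases hj : lab k l i
      · have := asym _ _ ((h1 i).1 hj)
        unfold lab at hj
        simp [StarArc, this]; omega
      · have := ((h1 i).2 hj)
        unfold lab at hj
        simp [StarArc, this]; omega
    · simp [StarArc, h2]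

lemma emb_le_TT (k l : ℕ) {V : Type} [Fintype V] (A : V → V → Prop) :
    (Nat.card {φ : Fin (k + l + 1) → V // IsStarEmb k l A φ} : ℝ) ≤ TT k l A (fun _ => 1) := by
  classical
  rw [TT_one]
  exact_mod_cast Nat.card_le_card_of_injective
    (fun φ : {φ : Fin (k + l + 1) → V // IsStarEmb k l A φ} => (⟨φ.1, smap_of_emb φ.2⟩ : {φ : Fin (k + l + 1) → V // smap k l A φ}))
    (fun a b h => Subtype.ext (congrArg (fun x => x.1) h))

lemma TT_le_emb (k l : ℕ) {n : ℕ} (A : Fin n → Fin n → Prop) (asym : ∀ u v, A u v → ¬ A v u) :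
    TT k l A (fun _ => 1) ≤ (Nat.card {φ : Fin (k + l + 1) → Fin n // IsStarEmb k l A φ} : ℝ) +
      ((n:ℝ) ^ (k + l + 1) - (n.descFactorial (k + l + 1) : ℝ)) := by
  classical
  rw [TT_one]
  have h1 : Nat.card {φ : Fin (k + l + 1) → Fin n // smap k l A φ} ≤
      Nat.card {φ : Fin (k + l + 1) → Fin n // IsStarEmb k l A φ} +
      Nat.card {φ : Fin (k + l + 1) → Fin n // ¬ Function.Injective φ} := by
    simp only [Nat.card_eq_fintype_card, Fintype.card_subtype]
    refine le_trans (card_le_card ?_) (card_union_le _ _)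
    intro φ hφ
    simp only [mem_filter, mem_univ, true_and, mem_union] at hφ ⊢
    by_cases hi : Function.Injective φ
    · exact Or.inl (emb_of_smap asym hi hφ)
    · exact Or.inr hi
  have h2 : Nat.card {φ : Fin (k + l + 1) → Fin n // Function.Injective φ} = n.descFactorial (k + l + 1) := by
    rw [Nat.card_congr (Equiv.subtypeInjectiveEquivEmbedding _ _), Nat.card_eq_fintype_card, Fintype.card_embedding_eq]
    simp
  have h3 : Nat.card {φ : Fin (k + l + 1) → Fin n // Function.Injective φ} +
      Nat.card {φ : Fin (k + l + 1) → Fin n // ¬ Function.Injective φ} = n ^ (k + l + 1) := by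
    simp only [Nat.card_eq_fintype_card]
    rw [Fintype.card_subtype_compl]
    have := Fintype.card_subtype_le (fun φ : Fin (k + l + 1) → Fin n => Function.Injective φ)
    rw [Nat.add_sub_cancel' this]
    simp
  rw [h2] at h3
  have h3' : (n.descFactorial (k + l + 1) : ℝ) + Nat.card {φ : Fin (k + l + 1) → Fin n // ¬ Function.Injective φ} = (n:ℝ) ^ (k + l + 1) := by
    exact_mod_cast h3
  have h1' : (Nat.card {φ : Fin (k + l + 1) → Fin n // smap k l A φ} : ℝ) ≤
      Nat.card {φ : Fin (k + l + 1) → Fin n // IsStarEmb k l A φ} +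
      Nat.card {φ : Fin (k + l + 1) → Fin n // ¬ Function.Injective φ} := by exact_mod_cast h1
  linarith

lemma indDensity_eq {k l : ℕ} (hk : 1 ≤ k) (hl : 1 ≤ l) {n : ℕ} (hn : k + l + 1 ≤ n) (A : Fin n → Fin n → Prop) :
    indDensity k l A = ((k + l + 1).factorial : ℝ) / ((k.factorial : ℝ) * l.factorial) *
      ((Nat.card {φ : Fin (k + l + 1) → Fin n // IsStarEmb k l A φ} : ℝ) / (n.descFactorial (k + l + 1) : ℝ)) := by
  unfold indDensity
  rw [card_emb hk hl, Nat.descFactorial_eq_factorial_mul_choose, Fintype.card_fin]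
  have h1 : (0:ℝ) < n.choose (k + l + 1) := by exact_mod_cast Nat.choose_pos hn
  have h2 : (0:ℝ) < k.factorial := by exact_mod_cast Nat.factorial_pos k
  have h3 : (0:ℝ) < l.factorial := by exact_mod_cast Nat.factorial_pos l
  have h4 : (0:ℝ) < (k + l + 1).factorial := by exact_mod_cast Nat.factorial_pos _
  push_cast
  field_simp

lemma desc_lim (r : ℕ) : Tendsto (fun n : ℕ => (n.descFactorial r : ℝ) / (n:ℝ) ^ r) atTop (𝓝 1) := by
  induction r with
  | zero => simp
  | succ r ih =>
    have h1 : Tendsto (fun n : ℕ => ((n - r : ℕ) : ℝ) / n) atTop (𝓝 1) := by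
      have h0 : Tendsto (fun n : ℕ => 1 - (r:ℝ) / n) atTop (𝓝 (1 - 0)) :=
        tendsto_const_nhds.sub (tendsto_const_div_atTop_nhds_zero_nat _)
      rw [sub_zero] at h0
      refine h0.congr' ?_
      filter_upwards [eventually_ge_atTop (r + 1)] with n hn
      rw [Nat.cast_sub (by omega)]
      have : (n:ℝ) ≠ 0 := by
        have : n ≠ 0 := by omega
        exact_mod_cast this
      field_simp
    have := h1.mul ih
    rw [one_mul] at this
    refine this.congr fun n => ?_
    rw [Nat.descFactorial_succ, pow_succ]
    push_cast
    rw [div_mul_div_comm]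
    ring

lemma TT_mono (k l : ℕ) {V : Type} [Fintype V] (A : V → V → Prop) {w w' : V → ℝ} (hw : ∀ v, 0 ≤ w v)
    (h : ∀ v, w v ≤ w' v) : TT k l A w ≤ TT k l A w' := by
  classical
  unfold TT
  refine sum_le_sum fun c _ => ?_
  refine mul_le_mul (h c) ?_ (Lf_nonneg hw _) ((hw c).trans (h c))
  unfold Lf
  refine sum_le_sum fun f _ => ?_
  split_ifs
  · exact prod_le_prod (fun i _ => hw _) (fun i _ => h _)
  · exact le_rfl

lemma TT_blow (k l : ℕ) {V U : Type} [Fintype V] [Fintype U] [DecidableEq U] (A : U → U → Prop) (g : V → U) :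
    TT k l (fun a b => A (g a) (g b)) (fun _ => 1) = TT k l A (fun u => ((univ.filter (fun v => g v = u)).card : ℝ)) := by
  classical
  have hL : ∀ c : U, Lf (fun _ : V => (1:ℝ)) (fun f : Fin (k + l) → V => star k l A c (fun i => g (f i))) =
      Lf (fun u => ((univ.filter (fun v => g v = u)).card : ℝ)) (star k l A c) := by
    intro c
    unfold Lf
    rw [← sum_fiberwise univ (fun f : Fin (k + l) → V => (fun i => g (f i)))]
    refine sum_congr rfl fun h _ => ?_
    have e : ∀ f ∈ univ.filter (fun f : Fin (k + l) → V => (fun i => g (f i)) = h),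
      (if star k l A c (fun i => g (f i)) then ∏ i : Fin (k + l), (1:ℝ) else 0) = if star k l A c h then 1 else 0 := by
      intro f hf
      rw [mem_filter] at hf
      rw [hf.2]; simp
    rw [sum_congr rfl e, sum_const, nsmul_eq_mul]
    have e2 : univ.filter (fun f : Fin (k + l) → V => (fun i => g (f i)) = h) =
        Fintype.piFinset (fun i => univ.filter (fun v => g v = h i)) := by
      ext f
      simp [funext_iff]
    rw [e2, Fintype.card_piFinset]
    push_cast
    split_ifs <;> simp
  unfold TT
  rw [← sum_fiberwise univ g]
  refine sum_congr rfl fun u _ => ?_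
  have e : ∀ c ∈ univ.filter (fun c => g c = u),
      (1:ℝ) * Lf (fun _ : V => (1:ℝ)) (star k l (fun a b => A (g a) (g b)) c) =
       Lf (fun u => ((univ.filter (fun v => g v = u)).card : ℝ)) (star k l A u) := by
    intro c hc
    rw [mem_filter] at hc
    rw [one_mul, ← hL, ← hc.2]
    rfl
  rw [sum_congr rfl e, sum_const, nsmul_eq_mul]

lemma exists_blow {U : Type} [Fintype U] [DecidableEq U] [Nonempty U] {n : ℕ} (N : U → ℕ) (hN : ∑ u, N u ≤ n) :
    ∃ g : Fin n → U, ∀ u, N u ≤ (univ.filter (fun v => g v = u)).card := by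
  classical
  obtain ⟨e⟩ : Nonempty ((Σ u, Fin (N u)) ↪ Fin n) := by
    apply Function.Embedding.nonempty_of_card_le
    simpa using hN
  refine ⟨Function.extend e (fun x => x.1) (fun _ => Classical.arbitrary U), fun u => ?_⟩
  calc N u = (univ : Finset (Fin (N u))).card := by simp
    _ = ((univ : Finset (Fin (N u))).image (fun j => e ⟨u, j⟩)).card := by
        rw [card_image_of_injective]
        intro i j h
        have := e.injective h
        simpa using this
    _ ≤ _ := by
        apply card_le_card
        intro v hv
        obtain ⟨j, _, rfl⟩ := mem_image.1 hv
        rw [mem_filter]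
        refine ⟨mem_univ _, ?_⟩
        rw [e.injective.extend_apply]

theorem limit_thm {k l : ℕ} (hk : 1 ≤ k) (hl : 1 ≤ l) {O : ℝ}
    (hup : ∀ {V : Type} [Fintype V] (A : V → V → Prop), (∀ u v, A u v → ¬ A v u) →
      ∀ w : V → ℝ, (∀ v, 0 ≤ w v) → TT k l A w ≤ O * (∑ v, w v) ^ (k + l + 1))
    {U : Type} [Fintype U] (A : U → U → Prop) (asym : ∀ u v, A u v → ¬ A v u)
    (w : U → ℝ) (hw : ∀ v, 0 ≤ w v) (hw1 : ∑ v, w v = 1) (hO : O ≤ TT k l A w) :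
    Tendsto (fun n => indMax k l n) atTop (𝓝 (((k + l + 1).factorial : ℝ) / ((k.factorial : ℝ) * l.factorial) * O)) := by
  classical
  have hOe : TT k l A w = O := by
    refine le_antisymm ?_ hO
    have := hup A asym w hw
    rwa [hw1, one_pow, mul_one] at this
  have hU : Nonempty U := by
    by_contra h
    rw [not_nonempty_iff] at h
    simp at hw1
  set cf : ℝ := ((k + l + 1).factorial : ℝ) / ((k.factorial : ℝ) * l.factorial) with hcf
  have hcf0 : 0 ≤ cf := by positivity
  set r : ℕ → ℝ := fun n => (n.descFactorial (k + l + 1) : ℝ) / (n:ℝ) ^ (k + l + 1) with hr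
  have hrl : Tendsto r atTop (𝓝 1) := desc_lim _
  set x : ℕ → ℝ := fun n => TT k l A (fun u => (⌊w u * (n:ℝ)⌋₊ : ℝ) / n) with hx
  have hxl : Tendsto x atTop (𝓝 O) := by
    rw [← hOe]
    have : Tendsto (fun n : ℕ => (fun u => (⌊w u * (n:ℝ)⌋₊ : ℝ) / n)) atTop (𝓝 w) := by
      rw [tendsto_pi_nhds]
      intro u
      exact (tendsto_nat_floor_mul_div_atTop (hw u)).comp tendsto_natCast_atTop_atTop
    exact ((TT_cont k l A).tendsto w).comp this
  have hub : ∀ n, k + l + 1 ≤ n → ∀ B : Fin n → Fin n → Prop, (∀ u v, B u v → ¬ B v u) → indDensity k l B ≤ cf * (O / r n) := by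
    intro n hn B hB
    rw [indDensity_eq hk hl hn]
    refine mul_le_mul_of_nonneg_left ?_ hcf0
    have h1 := (emb_le_TT k l B).trans (hup B hB (fun _ => 1) (fun _ => zero_le_one))
    simp only [sum_const, card_univ, Fintype.card_fin, nsmul_eq_mul, mul_one] at h1
    have hd : (0:ℝ) < n.descFactorial (k + l + 1) := by exact_mod_cast Nat.descFactorial_pos.2 hn
    have hn0 : (0:ℝ) < n := by
      have : 0 < n := by omega
      exact_mod_cast this
    rw [hr]
    simp only
    rw [div_div_eq_mul_div]
    gcongr
  have hbdd : ∀ n, k + l + 1 ≤ n → BddAbove {x : ℝ | ∃ A : Fin n → Fin n → Prop, Irreflexive A ∧ (∀ u v, A u v → ¬ A v u) ∧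
    x = indDensity k l A} := by
    intro n hn
    refine ⟨cf * (O / r n), ?_⟩
    rintro _ ⟨B, _, hB, rfl⟩
    exact hub n hn B hB
  have hlb : ∀ n, k + l + 1 ≤ n → cf * ((x n - (1 - r n)) / r n) ≤ indMax k l n := by
    intro n hn
    have hd : (0:ℝ) < n.descFactorial (k + l + 1) := by exact_mod_cast Nat.descFactorial_pos.2 hn
    have hn0 : (0:ℝ) < n := by
      have : 0 < n := by omega
      exact_mod_cast this
    obtain ⟨g, hg⟩ := exists_blow (n := n) (fun u => ⌊w u * (n:ℝ)⌋₊) (by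
      have : ((∑ u, ⌊w u * (n:ℝ)⌋₊ : ℕ) : ℝ) ≤ n := by
        push_cast
        calc ∑ u, (⌊w u * (n:ℝ)⌋₊ : ℝ) ≤ ∑ u, w u * (n:ℝ) :=
              sum_le_sum fun u _ => Nat.floor_le (mul_nonneg (hw u) hn0.le)
          _ = n := by rw [← sum_mul, hw1, one_mul]
      exact_mod_cast this)
    set B : Fin n → Fin n → Prop := fun a b => A (g a) (g b) with hB
    have hBa : ∀ u v, B u v → ¬ B v u := fun u v => asym _ _
    have h1 : indDensity k l B ≤ indMax k l n := by
      apply le_csSup (hbdd n hn)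
      exact ⟨B, fun v hv => hBa v v hv hv, hBa, rfl⟩
    refine le_trans ?_ h1
    rw [indDensity_eq hk hl hn]
    refine mul_le_mul_of_nonneg_left ?_ hcf0
    have h2 := TT_le_emb k l B hBa
    have h3 : (n:ℝ) ^ (k + l + 1) * x n ≤ TT k l B (fun _ => 1) := by
      rw [hB, TT_blow, hx]
      simp only
      rw [← TT_smul]
      refine TT_mono k l A (fun u => by positivity) (fun u => ?_)
      rw [mul_div_cancel₀ _ hn0.ne']
      exact_mod_cast hg u
    have hp : (0:ℝ) < (n:ℝ) ^ (k + l + 1) := by positivity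
    have e : (x n - (1 - r n)) / r n = ((n:ℝ) ^ (k + l + 1) * x n - ((n:ℝ) ^ (k + l + 1) - n.descFactorial (k + l + 1))) / n.descFactorial (k + l + 1) := by
      rw [hr]; simp only; field_simp
    rw [e]
    gcongr
    linarith
  have hub' : ∀ n, k + l + 1 ≤ n → indMax k l n ≤ cf * (O / r n) := by
    intro n hn
    apply csSup_le
    · exact ⟨_, fun _ _ => False, fun v h => h, fun _ _ h => h.elim, rfl⟩
    · rintro _ ⟨B, _, hB, rfl⟩
      exact hub n hn B hB
  have l1 : Tendsto (fun n => cf * ((x n - (1 - r n)) / r n)) atTop (𝓝 (cf * ((O - (1 - 1)) / 1))) :=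
    ((hxl.sub (tendsto_const_nhds.sub hrl)).div hrl one_ne_zero).const_mul cf
  have l2 : Tendsto (fun n => cf * (O / r n)) atTop (𝓝 (cf * (O / 1))) :=
    (tendsto_const_nhds.div hrl one_ne_zero).const_mul cf
  rw [sub_self, sub_zero, div_one] at l1
  rw [div_one] at l2
  refine tendsto_of_tendsto_of_tendsto_of_le_of_le' l1 l2 ?_ ?_
  · filter_upwards [eventually_ge_atTop (k + l + 1)] with n hn using hlb n hn
  · filter_upwards [eventually_ge_atTop (k + l + 1)] with n hn using hub' n hn
end OStar

namespace OStar
open Finset Filter Topology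

lemma TT_ge (k l : ℕ) {V : Type} [Fintype V] (A : V → V → Prop) {w : V → ℝ} (hw : ∀ v, 0 ≤ w v)
    (hb : ∀ c u v, (A c u ∨ A u c) → (A c v ∨ A v c) → ¬ A u v) :
    ∑ c, w c * (mu w (fun u => A c u) ^ k * mu w (fun u => A u c) ^ l) ≤ TT k l A w := by
  classical
  unfold TT
  refine sum_le_sum fun c _ => mul_le_mul_of_nonneg_left ?_ (hw c)
  rw [← prod_lab k l]
  have e : ∀ i : Fin (k + l), (if lab k l i then mu w (fun u => A c u) else mu w (fun u => A u c)) =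
      ∑ v, if (if lab k l i then A c v else A v c) then w v else 0 := by
    intro i
    by_cases h : lab k l i
    · simp only [h, if_true]; unfold mu; congr!
    · simp only [h, if_false]; unfold mu; congr!
  rw [prod_congr rfl (fun i _ => e i), ← sum_fun_prod]
  unfold Lf
  refine sum_le_sum fun f _ => ?_
  by_cases hs : ∀ i, if lab k l i then A c (f i) else A (f i) c
  · have hst : star k l A c f := by
      have hadj : ∀ i, A c (f i) ∨ A (f i) c := by
        intro i
        have := hs i
        split_ifs at this with h
        · exact Or.inl this
        · exact Or.inr this
      refine ⟨fun i => ⟨fun h => ?_, fun h => ?_⟩, fun i j => hb c _ _ (hadj i) (hadj j)⟩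
      · have := hs i; rwa [if_pos h] at this
      · have := hs i; rwa [if_neg h] at this
    rw [if_pos hst]
    apply le_of_eq
    refine prod_congr rfl fun i _ => ?_
    rw [if_pos (hs i)]
  · push Not at hs
    obtain ⟨i, hi⟩ := hs
    rw [prod_eq_zero (mem_univ i) (if_neg hi)]
    split_ifs
    · exact prod_nonneg fun i _ => hw _
    · exact le_rfl

/-- extremal graph, balanced case -/
def Aeq (p q : Bool × Bool) : Prop := p.1 ≠ q.1 ∧ (p.1 = (p.2 == q.2))

instance (p q : Bool × Bool) : Decidable (Aeq p q) := by unfold Aeq; infer_instance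

lemma constr_eq (k l : ℕ) {a : ℝ} (h0 : 0 ≤ a) (h1 : a ≤ 1) :
    ∃ (A : Bool × Bool → Bool × Bool → Prop) (w : Bool × Bool → ℝ), (∀ u v, A u v → ¬ A v u) ∧ (∀ v, 0 ≤ w v) ∧
      ∑ v, w v = 1 ∧ (1 / 2) ^ (k + l) * (a * (1 - a) ^ (k + l) + (1 - a) * a ^ (k + l)) ≤ TT k l A w := by
  refine ⟨Aeq, fun p => if p.1 then a / 2 else (1 - a) / 2, by decide, ?_, ?_, ?_⟩
  · rintro ⟨p, q⟩
    cases p <;> simp <;> linarith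
  · simp [Fintype.sum_prod_type]
  · refine le_trans (le_of_eq ?_) (TT_ge k l Aeq ?_ (by decide))
    · simp only [mu, Fintype.sum_prod_type, Fintype.sum_bool, Aeq]
      simp
      rw [← pow_add, ← pow_add, div_pow, div_pow]
      field_simp
      ring
    · rintro ⟨p, q⟩
      cases p <;> simp <;> linarith

lemma zcount (r t : ℕ) [NeZero r] (ht : t ≤ r) : (univ.filter (fun z : ZMod r => z.val < t)).card = t := by
  classical
  have : (univ.filter (fun z : ZMod r => z.val < t)) = (range t).image (fun i : ℕ => (i : ZMod r)) := by
    ext z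
    simp only [mem_filter, mem_univ, true_and, mem_image, mem_range]
    constructor
    · intro h; exact ⟨z.val, h, ZMod.natCast_zmod_val z⟩
    · rintro ⟨i, hi, rfl⟩
      rwa [ZMod.val_natCast_of_lt (by omega)]
  rw [this, card_image_of_injOn, card_range]
  intro i hi j hj h
  simp only [coe_range, Set.mem_Iio] at hi hj
  have := congrArg ZMod.val h
  simp only at this
  rwa [ZMod.val_natCast_of_lt (by omega), ZMod.val_natCast_of_lt (by omega)] at this

lemma zcount1 (r t : ℕ) [NeZero r] (ht : t ≤ r) (j : ZMod r) : (univ.filter (fun i : ZMod r => (i - j).val < t)).card = t := by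
  classical
  refine Eq.trans ?_ (zcount r t ht)
  refine card_bij (fun i _ => i - j) ?_ ?_ ?_
  · intro i hi; simpa using hi
  · intro i _ i' _ h; simpa using h
  · intro z hz; exact ⟨z + j, by simpa using hz, by simp⟩

lemma zcount2 (r t : ℕ) [NeZero r] (ht : t ≤ r) (i : ZMod r) : (univ.filter (fun j : ZMod r => (i - j).val < t)).card = t := by
  classical
  refine Eq.trans ?_ (zcount r t ht)
  refine card_bij (fun j _ => i - j) ?_ ?_ ?_
  · intro i hi; simpa using hi
  · intro i _ i' _ h; simpa using h
  · intro z hz; exact ⟨i - z, by simpa using hz, by simp⟩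

/-- extremal graph, unbalanced case -/
def Agt (r t : ℕ) : ZMod r ⊕ Option (ZMod r) → ZMod r ⊕ Option (ZMod r) → Prop
  | Sum.inl i, Sum.inr (some j) => ¬ (i - j).val < t
  | Sum.inl _, Sum.inr none => True
  | Sum.inr (some j), Sum.inl i => (i - j).val < t
  | _, _ => False

/-- weights of the extremal graph -/
def Wgt (r : ℕ) (x y z : ℝ) : ZMod r ⊕ Option (ZMod r) → ℝ
  | Sum.inl _ => x
  | Sum.inr (some _) => y
  | Sum.inr none => z

lemma Agt_asym (r t : ℕ) : ∀ u v, Agt r t u v → ¬ Agt r t v u := by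
  rintro (i | _ | j) (i' | _ | j') <;> simp [Agt]

lemma Agt_bip (r t : ℕ) : ∀ c u v, (Agt r t c u ∨ Agt r t u c) → (Agt r t c v ∨ Agt r t v c) → ¬ Agt r t u v := by
  rintro (i | _ | j) (i' | _ | j') (i'' | _ | j'') <;> simp [Agt]

lemma sum_ite_c {α : Type*} [Fintype α] (P : α → Prop) [DecidablePred P] (x : ℝ) :
    (∑ v, if P v then x else 0) = ((univ.filter P).card : ℝ) * x := by
  rw [← sum_filter, sum_const, nsmul_eq_mul]

lemma mu3 (r : ℕ) [NeZero r] (x y z : ℝ) (S : ZMod r ⊕ Option (ZMod r) → Prop) (P Q : ZMod r → Prop) (R : Prop)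
    [DecidablePred P] [DecidablePred Q] [Decidable R] (hP : ∀ i, S (Sum.inl i) ↔ P i)
    (hR : S (Sum.inr none) ↔ R) (hQ : ∀ i, S (Sum.inr (some i)) ↔ Q i) :
    mu (Wgt r x y z) S = ((univ.filter P).card : ℝ) * x + ((if R then z else 0) + ((univ.filter Q).card : ℝ) * y) := by
  classical
  rw [← sum_ite_c, ← sum_ite_c]
  unfold mu
  rw [Fintype.sum_sum_type, Fintype.sum_option]
  congr 1
  · refine sum_congr rfl fun i _ => ?_
    by_cases h : P i
    · rw [if_pos h, if_pos ((hP i).2 h)]; rfl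
    · rw [if_neg h, if_neg (fun h' => h ((hP i).1 h'))]
  · congr 1
    · by_cases h : R
      · rw [if_pos h, if_pos (hR.2 h)]; rfl
      · rw [if_neg h, if_neg (fun h' => h (hR.1 h'))]
    · refine sum_congr rfl fun i _ => ?_
      by_cases h : Q i
      · rw [if_pos h, if_pos ((hQ i).2 h)]; rfl
      · rw [if_neg h, if_neg (fun h' => h ((hQ i).1 h'))]

lemma constr_gt {k l : ℕ} (hk : 2 ≤ k) (hl : 1 ≤ l) {a d : ℝ} (h0 : 0 ≤ a) (h1 : a ≤ 1) (hd : (l:ℝ) / ((k:ℝ) + l - 1) ≤ d) (hd1 : d ≤ 1) :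
    ∃ (r : ℕ) (_ : NeZero r) (A : ZMod r ⊕ Option (ZMod r) → ZMod r ⊕ Option (ZMod r) → Prop) (w : ZMod r ⊕ Option (ZMod r) → ℝ), (∀ u v, A u v → ¬ A v u) ∧ (∀ v, 0 ≤ w v) ∧
      ∑ v, w v = 1 ∧ a * (1 - a) ^ (k + l) * d ^ k * (1 - d) ^ l + Gf (k - 1) l * (1 - a) * a ^ (k + l) * (1 - d) ≤ TT k l A w := by
  classical
  obtain ⟨t, rfl⟩ : ∃ t, k = t + 1 := ⟨k - 1, by omega⟩
  have ht : 1 ≤ t := by omega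
  haveI : NeZero (t + l) := ⟨by omega⟩
  have tR : (1:ℝ) ≤ t := by exact_mod_cast ht
  have lR : (1:ℝ) ≤ l := by exact_mod_cast hl
  set y : ℝ := (1 - a) * (1 - d) / t with hy
  set x : ℝ := a / ((t:ℝ) + l) with hx
  set z : ℝ := (1 - a) - ((t:ℝ) + l) * y with hz
  have x0 : 0 ≤ x := by positivity
  have y0 : 0 ≤ y := div_nonneg (mul_nonneg (by linarith) (by linarith)) (by linarith)
  have hd' : (l:ℝ) ≤ d * ((t:ℝ) + l) := by
    rw [div_le_iff₀ (by push_cast; linarith)] at hd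
    push_cast at hd
    linarith
  have z0 : 0 ≤ z := by
    have : z = (1 - a) * (d * ((t:ℝ) + l) - l) / t := by rw [hz, hy]; field_simp; ring
    rw [this]
    exact div_nonneg (mul_nonneg (by linarith) (by linarith)) (by linarith)
  have W0 : ∀ v, 0 ≤ Wgt (t + l) x y z v := by
    rintro (i | _ | j)
    · exact x0
    · exact z0
    · exact y0
  refine ⟨t + l, inferInstance, Agt (t + l) t, Wgt (t + l) x y z, Agt_asym _ _, W0, ?_, ?_⟩
  · simp only [Fintype.sum_sum_type, Fintype.sum_option, Wgt, sum_const, card_univ, ZMod.card, nsmul_eq_mul]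
    push_cast
    rw [hz, hx]; field_simp; ring
  · refine le_trans (le_of_eq ?_) (TT_ge (t + 1) l _ W0 (Agt_bip _ _))
    have c1 : ∀ j : ZMod (t + l), ((univ.filter (fun i : ZMod (t + l) => (i - j).val < t)).card : ℝ) = t :=
      fun j => by rw [zcount1 _ _ (by omega)]
    have c2 : ∀ i : ZMod (t + l), ((univ.filter (fun j : ZMod (t + l) => (i - j).val < t)).card : ℝ) = t :=
      fun j => by rw [zcount2 _ _ (by omega)]
    have c3 : ∀ j : ZMod (t + l), ((univ.filter (fun i : ZMod (t + l) => ¬ (i - j).val < t)).card : ℝ) = l := by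
      intro j
      have h := card_filter_add_card_filter_not (s := (univ : Finset (ZMod (t + l)))) (fun i => (i - j).val < t)
      rw [card_univ, ZMod.card] at h
      have h' : ((univ.filter (fun i : ZMod (t + l) => (i - j).val < t)).card : ℝ) + ((univ.filter (fun i : ZMod (t + l) => ¬ (i - j).val < t)).card : ℝ) = (t:ℝ) + l := by exact_mod_cast h
      rw [c1] at h'; linarith
    have c4 : ∀ i : ZMod (t + l), ((univ.filter (fun j : ZMod (t + l) => ¬ (i - j).val < t)).card : ℝ) = l := by
      intro i
      have h := card_filter_add_card_filter_not (s := (univ : Finset (ZMod (t + l)))) (fun j => (i - j).val < t)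
      rw [card_univ, ZMod.card] at h
      have h' : ((univ.filter (fun j : ZMod (t + l) => (i - j).val < t)).card : ℝ) + ((univ.filter (fun j : ZMod (t + l) => ¬ (i - j).val < t)).card : ℝ) = (t:ℝ) + l := by exact_mod_cast h
      rw [c2] at h'; linarith
    have m1 : ∀ i, mu (Wgt (t + l) x y z) (fun u => Agt (t + l) t (Sum.inl i) u) = (1 - a) * d := by
      intro i
      rw [mu3 (t + l) x y z _ (fun _ => False) (fun j => ¬ (i - j).val < t) True (fun _ => Iff.rfl) Iff.rfl (fun _ => Iff.rfl)]
      simp only [if_true, if_false, filter_false, card_empty, Nat.cast_zero]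
      rw [c4, hz, hy]; field_simp; ring
    have m2 : ∀ i, mu (Wgt (t + l) x y z) (fun u => Agt (t + l) t u (Sum.inl i)) = (1 - a) * (1 - d) := by
      intro i
      rw [mu3 (t + l) x y z _ (fun _ => False) (fun j => (i - j).val < t) False (fun _ => Iff.rfl) Iff.rfl (fun _ => Iff.rfl)]
      simp only [if_true, if_false, filter_false, card_empty, Nat.cast_zero]
      rw [c2, hy]; field_simp; ring
    have m3 : ∀ j, mu (Wgt (t + l) x y z) (fun u => Agt (t + l) t (Sum.inr (some j)) u) = t * x := by
      intro i
      rw [mu3 (t + l) x y z _ (fun j => (j - i).val < t) (fun _ => False) False (fun _ => Iff.rfl) Iff.rfl (fun _ => Iff.rfl)]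
      simp only [if_true, if_false, filter_false, card_empty, Nat.cast_zero]
      rw [c1]; ring
    have m4 : ∀ j, mu (Wgt (t + l) x y z) (fun u => Agt (t + l) t u (Sum.inr (some j))) = l * x := by
      intro i
      rw [mu3 (t + l) x y z _ (fun j => ¬ (j - i).val < t) (fun _ => False) False (fun _ => Iff.rfl) Iff.rfl (fun _ => Iff.rfl)]
      simp only [if_true, if_false, filter_false, card_empty, Nat.cast_zero]
      rw [c3]; ring
    have m5 : mu (Wgt (t + l) x y z) (fun u => Agt (t + l) t (Sum.inr none) u) = 0 := by
      rw [mu3 (t + l) x y z _ (fun _ => False) (fun _ => False) False (fun _ => Iff.rfl) Iff.rfl (fun _ => Iff.rfl)]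
      simp only [if_true, if_false, filter_false, card_empty, Nat.cast_zero]
      ring
    simp only [Fintype.sum_sum_type, Fintype.sum_option, m1, m2, m3, m4, m5, sum_const, card_univ, ZMod.card, nsmul_eq_mul]
    simp only [Wgt, Gf, Nat.add_sub_cancel, sum_const, card_univ, ZMod.card, nsmul_eq_mul]
    rw [hx, hy]
    push_cast
    rw [zero_pow (by omega), zero_mul, mul_zero, zero_add, mul_pow, mul_pow, mul_pow, mul_pow, div_pow, div_pow, pow_add (1 - a), pow_add a, pow_add ((t:ℝ) + l) t l]
    have : (0:ℝ) < t := by linarith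
    field_simp
    ring
end OStar

namespace OStar
open Finset Filter Topology

lemma final_eq (k : ℕ) (hm : 6 ≤ k + k) :
    Tendsto (fun n => indMax k k n) atTop (𝓝 (((Nat.factorial (2 * k + 1) : ℝ) / (2 ^ (2 * k) * (Nat.factorial k : ℝ) ^ 2)) *
          sSup {y : ℝ | ∃ a ∈ Set.Icc (0 : ℝ) 1,
            y = a * (1 - a) ^ (2 * k) + (1 - a) * a ^ (2 * k)})) := by
  set f : ℝ → ℝ := fun a => a * (1 - a) ^ (2 * k) + (1 - a) * a ^ (2 * k) with hf
  obtain ⟨a, ha, hmx⟩ := (isCompact_Icc (a := (0:ℝ)) (b := 1)).exists_isMaxOn ⟨0, by simp⟩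
    (show ContinuousOn f (Set.Icc 0 1) by apply Continuous.continuousOn; rw [hf]; fun_prop)
  have hsup : sSup {y : ℝ | ∃ a ∈ Set.Icc (0 : ℝ) 1, y = a * (1 - a) ^ (2 * k) + (1 - a) * a ^ (2 * k)} = f a := by
    apply IsGreatest.csSup_eq
    refine ⟨⟨a, ha, rfl⟩, ?_⟩
    rintro _ ⟨b, hb, rfl⟩
    exact hmx hb
  rw [hsup]
  have hG : Gf k k = (1 / 2) ^ (k + k) := by
    unfold Gf
    have : (k:ℝ) + k = 2 * k := by ring
    have hk : (0:ℝ) < k := by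
      have : 0 < k := by omega
      exact_mod_cast this
    rw [this, ← pow_add, mul_pow, one_div, inv_pow]
    field_simp
  obtain ⟨A, w, hA, hw, hw1, hT⟩ := constr_eq k k ha.1 ha.2
  have := limit_thm (k := k) (l := k) (by omega) (by omega) (O := (1 / 2) ^ (k + k) * f a) (fun {V} _ A hA w hw =>
    TT_le_eq (k := k) (l := k) (by omega) le_rfl hm (fun b hb0 hb1 => by
      rw [hG]
      refine mul_le_mul_of_nonneg_left ?_ (by positivity)
      have := hmx ⟨hb0, hb1⟩
      simp only [Set.mem_setOf_eq, hf] at this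
      rw [two_mul] at this
      rw [hf]; simp only
      rw [two_mul]
      exact this) A hA w hw) A hA w hw hw1 (by
        rw [hf]; simp only
        rw [two_mul]; exact hT)
  convert this using 2
  rw [two_mul, one_div, inv_pow]
  have h2 : (0:ℝ) < k.factorial := by exact_mod_cast Nat.factorial_pos k
  field_simp

lemma final_gt (k l : ℕ) (hl : 1 ≤ l) (hlk : l < k) (hm : 6 ≤ k + l) :
    Tendsto (fun n => indMax k l n) atTop (𝓝 (((Nat.factorial (k + l + 1) : ℝ) / ((Nat.factorial k : ℝ) * (Nat.factorial l : ℝ))) *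
          sSup {y : ℝ | ∃ a ∈ Set.Icc (0 : ℝ) (1 / 2),
            ∃ d ∈ Set.Icc (0 : ℝ) ((k : ℝ) / ((k : ℝ) + (l : ℝ))),
            y = a * (1 - a) ^ (k + l) * d ^ k * (1 - d) ^ l
              + (((k : ℝ) - 1) ^ (k - 1) * (l : ℝ) ^ l / ((k : ℝ) + (l : ℝ) - 1) ^ (k + l - 1))
                * (1 - a) * a ^ (k + l) * (1 - d)})) := by
  have hk4 : 4 ≤ k := by omega
  have kR : (4:ℝ) ≤ k := by exact_mod_cast hk4
  have lR : (1:ℝ) ≤ l := by exact_mod_cast hl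
  have klR : (l:ℝ) + 1 ≤ k := by exact_mod_cast hlk
  have hG : (((k : ℝ) - 1) ^ (k - 1) * (l : ℝ) ^ l / ((k : ℝ) + (l : ℝ) - 1) ^ (k + l - 1)) = Gf (k - 1) l := by
    unfold Gf
    rw [Nat.cast_sub (by omega), show k + l - 1 = k - 1 + l by omega]
    push_cast
    rw [show (k:ℝ) + l - 1 = k - 1 + l by ring]
  rw [hG]
  set f : ℝ × ℝ → ℝ := fun p => p.1 * (1 - p.1) ^ (k + l) * p.2 ^ k * (1 - p.2) ^ l
              + Gf (k - 1) l * (1 - p.1) * p.1 ^ (k + l) * (1 - p.2) with hf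
  obtain ⟨⟨a, d⟩, had, hmx⟩ := ((isCompact_Icc (a := (0:ℝ)) (b := 1 / 2)).prod (isCompact_Icc (a := (0:ℝ)) (b := (k:ℝ) / (k + l)))).exists_isMaxOn
    ⟨(0, 0), by constructor <;> constructor <;> first | positivity | simp⟩
    (show ContinuousOn f _ by apply Continuous.continuousOn; rw [hf]; fun_prop)
  obtain ⟨ha, hd⟩ := had
  simp only at ha hd
  have hsup : sSup {y : ℝ | ∃ a ∈ Set.Icc (0 : ℝ) (1 / 2),
            ∃ d ∈ Set.Icc (0 : ℝ) ((k : ℝ) / ((k : ℝ) + (l : ℝ))),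
            y = a * (1 - a) ^ (k + l) * d ^ k * (1 - d) ^ l + Gf (k - 1) l * (1 - a) * a ^ (k + l) * (1 - d)} = f (a, d) := by
    apply IsGreatest.csSup_eq
    refine ⟨⟨a, ha, d, hd, rfl⟩, ?_⟩
    rintro _ ⟨b, hb, e, he, rfl⟩
    exact hmx (Set.mk_mem_prod hb he)
  rw [hsup]
  have ha1 : a ≤ 1 := by linarith [ha.2]
  have hd1 : d ≤ 1 := hd.2.trans (by rw [div_le_one (by linarith)]; linarith)
  have g0 := Gf_pos (k - 1) l
  have hex : ∃ d', (l:ℝ) / ((k:ℝ) + l - 1) ≤ d' ∧ d' ≤ 1 ∧ f (a, d) ≤ f (a, d') := by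
    rcases le_total ((l:ℝ) / ((k:ℝ) + l - 1)) d with h | h
    · exact ⟨d, h, hd1, le_rfl⟩
    · have hr : 0 < (k:ℝ) + l - 1 := by linarith
      set e : ℝ := ((k:ℝ) - 1) / ((k:ℝ) + l - 1) with he
      have e1 : 1 - e = l / ((k:ℝ) + l - 1) := by rw [he]; field_simp; ring
      have le : (l:ℝ) / ((k:ℝ) + l - 1) ≤ e := by rw [he]; gcongr; linarith
      have e0 : 0 ≤ e := div_nonneg (by linarith) hr.le
      refine ⟨e, le, ?_, ?_⟩
      · rw [he, div_le_one hr]; linarith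
      · have am := amgm (k - 1) l (p := d) (q := 1 - d) (s := 1) hd.1 (by linarith) (by linarith)
        rw [one_pow, mul_one] at am
        have ee : e ^ (k - 1) * (1 - e) ^ l = Gf (k - 1) l := by
          rw [← hG, e1, he, div_pow, div_pow, div_mul_div_comm, ← pow_add, show k - 1 + l = k + l - 1 by omega]
        have hp : ∀ x : ℝ, x ^ k * (1 - x) ^ l = x * (x ^ (k - 1) * (1 - x) ^ l) := by
          intro x
          have : x ^ k = x ^ (k - 1) * x := by rw [← pow_succ]; congr 1; omega
          rw [this]; ring
        have s1 : d ^ k * (1 - d) ^ l ≤ Gf (k - 1) l * d := by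
          rw [hp, mul_comm]; exact mul_le_mul_of_nonneg_right am hd.1
        have s2 : e ^ k * (1 - e) ^ l = Gf (k - 1) l * e := by rw [hp, ee, mul_comm]
        have hc : (1 - a) * a ^ (k + l) ≤ a * (1 - a) ^ (k + l) := by
          have q : k + l = (k + l - 1) + 1 := by omega
          rw [q, pow_succ, pow_succ]
          have := pow_le_pow_left₀ ha.1 (by linarith [ha.2] : a ≤ 1 - a) (k + l - 1)
          have := mul_le_mul_of_nonneg_left this (mul_nonneg ha.1 (by linarith : 0 ≤ 1 - a))
          linarith
        have hP : 0 ≤ a * (1 - a) ^ (k + l) := mul_nonneg ha.1 (pow_nonneg (by linarith) _)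
        have s3 := mul_le_mul_of_nonneg_left s1 hP
        have s4 : Gf (k - 1) l * (e - d) * ((1 - a) * a ^ (k + l)) ≤ Gf (k - 1) l * (e - d) * (a * (1 - a) ^ (k + l)) :=
          mul_le_mul_of_nonneg_left hc (mul_nonneg g0.le (by linarith))
        have s5 : a * (1 - a) ^ (k + l) * (e ^ k * (1 - e) ^ l) = a * (1 - a) ^ (k + l) * (Gf (k - 1) l * e) := by rw [s2]
        rw [hf]; simp only
        linarith
  obtain ⟨d', hd', hd1', hle⟩ := hex
  obtain ⟨r, _, A, w, hA, hw, hw1, hT⟩ := constr_gt (k := k) (l := l) (by omega) hl ha.1 ha1 hd' hd1'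
  exact limit_thm (k := k) (l := l) (by omega) hl (O := f (a, d)) (fun {V} _ A hA w hw =>
    TT_le_gt (k := k) (l := l) hl hlk.le hm (fun b e hb0 hb1 he0 he1 =>
      hmx (Set.mk_mem_prod ⟨hb0, hb1⟩ ⟨he0, he1⟩)) A hA w hw) A hA w hw hw1 (hle.trans hT)

end OStar

theorem stmt0 (k l : ℕ) (hl : 1 ≤ l) (hlk : l ≤ k) (hm : 6 ≤ k + l) :
    Filter.Tendsto (fun n => indMax k l n) Filter.atTop (nhds
      (if k = l then
        ((Nat.factorial (2 * k + 1) : ℝ) / (2 ^ (2 * k) * (Nat.factorial k : ℝ) ^ 2)) *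
          sSup {y : ℝ | ∃ a ∈ Set.Icc (0 : ℝ) 1,
            y = a * (1 - a) ^ (2 * k) + (1 - a) * a ^ (2 * k)}
      else
        ((Nat.factorial (k + l + 1) : ℝ) / ((Nat.factorial k : ℝ) * (Nat.factorial l : ℝ))) *
          sSup {y : ℝ | ∃ a ∈ Set.Icc (0 : ℝ) (1 / 2),
            ∃ d ∈ Set.Icc (0 : ℝ) ((k : ℝ) / ((k : ℝ) + (l : ℝ))),
            y = a * (1 - a) ^ (k + l) * d ^ k * (1 - d) ^ l
              + (((k : ℝ) - 1) ^ (k - 1) * (l : ℝ) ^ l / ((k : ℝ) + (l : ℝ) - 1) ^ (k + l - 1))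
                * (1 - a) * a ^ (k + l) * (1 - d)})) := by
  split_ifs with h
  · subst h
    exact OStar.final_eq k hm
  · exact OStar.final_gt k l hl (lt_of_le_of_ne hlk (fun e => h e.symm)) hm
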